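/- arXiv:2208.00685 — 2 statements merged into one kernel-verified Lean document; each statement's English description precedes it below -/
import Mathlib

section
/- For every finite alphabet A with |A| ≥ 2, there exist a finite set F ⊆ Aut(A^ℤ) and an element g of the subgroup ⟨F⟩ generated by F such that g has infinite order and, for some constant K > 0, the word norm satisfies ‖g^n‖_F ≤ K·(log n)⁴ for all n ≥ 2. -/
/-- The word norm of `g` with respect to the generating set `F`:
the least `n` such that `g` is a product of `n` elements of `F ∪ F⁻¹`. -/
noncomputable def wordNorm {G : Type*} [Group G] (F : Set G) (g : G) : ℕ :=
  sInf {n : ℕ | ∃ w : List G, w.length = n ∧ (∀ x ∈ w, x ∈ F ∨ x⁻¹ ∈ F) ∧ w.prod = g}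
/-- The shift map on the full shift `A^ℤ`. -/
def shiftMap (A : Type*) : (ℤ → A) → (ℤ → A) := fun x i => x (i + 1)

/-- A subshift: a closed, shift-invariant subset of `A^ℤ`. -/
def IsSubshift {A : Type*} [TopologicalSpace A] (X : Set (ℤ → A)) : Prop :=
  IsClosed X ∧ shiftMap A '' X = X

/-- The automorphism group of the full shift `A^ℤ`, as the set of those permutations of
`A^ℤ` which are homeomorphisms commuting with the shift. -/
def FullShiftAut (A : Type*) [TopologicalSpace A] : Set (Equiv.Perm (ℤ → A)) :=
  {f | Continuous f ∧ Continuous f.symm ∧ ∀ x, f (shiftMap A x) = shiftMap A (f x)}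

/-- The automorphism group of a subshift `X ⊆ A^ℤ`, as the set of those permutations of
`X` which are homeomorphisms (for the subspace topology) commuting with the shift. -/
def SubshiftAut {A : Type*} [TopologicalSpace A] (X : Set (ℤ → A)) :
    Set (Equiv.Perm X) :=
  {f | Continuous f ∧ Continuous f.symm ∧
    ∀ x y : X, (y : ℤ → A) = shiftMap A (x : ℤ → A) →
      ((f y : X) : ℤ → A) = shiftMap A ((f x : X) : ℤ → A)}

/-- The number of words of length `k` appearing in elements of `X`. -/
noncomputable def wordCount {A : Type*} (X : Set (ℤ → A)) (k : ℕ) : ℕ :=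
  Set.ncard {w : Fin k → A | ∃ x ∈ X, ∃ i : ℤ, ∀ j : Fin k, x (i + (j : ℤ)) = w j}

/-- The lower entropy dimension of a subshift,
`liminf_k log (log N_k(X)) / log k` (base-2 logarithms). -/
noncomputable def lowerEntropyDim {A : Type*} (X : Set (ℤ → A)) : ℝ :=
  Filter.liminf
    (fun k : ℕ => Real.logb 2 (Real.logb 2 (wordCount X k)) / Real.logb 2 k)
    Filter.atTop

namespace SlowMachine
open Equiv
open scoped commutatorElement

/-- Tape symbols. -/
abbrev Sym := Fin 3

/-- Head states: machine state, direction of travel, and a flag which freezes the machine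
when it is not zero. -/
abbrev St := Fin 4 × Bool × Fin 3

/-- Instructions executed by a head sitting at a gap of a cyclic tape. -/
inductive Instr
  | perm (π : Perm (St × Sym))
  | swp (f : St → Bool)
  | rot (f : St → Bool)
  | unrot (f : St → Bool)

/-- The inverse instruction. -/
def Instr.inv : Instr → Instr
  | .perm π => .perm π⁻¹
  | .swp f => .swp f
  | .rot f => .unrot f
  | .unrot f => .rot f

/-- The inverse of a word of instructions. -/
def winv (w : List Instr) : List Instr := (w.map Instr.inv).reverse

/-- The commutator of two words of instructions. -/
def wcomm (v w : List Instr) : List Instr := v ++ w ++ winv v ++ winv w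

/-- Configurations of a head on a cyclic tape, read off from the head; `r` is a register
and `z` the position of the head. -/
@[ext] structure Cfg (M : ℕ) where
  q : St
  r : Sym
  z : ZMod M
  l : List Sym

/-- Rotate a list by one step to the left. -/
def rotl {α : Type*} : List α → List α
  | [] => []
  | a :: t => t ++ [a]

/-- Rotate a list by one step to the right. -/
def unrotl {α : Type*} (l : List α) : List α := (rotl l.reverse).reverse

section rotl
variable {α : Type*}

@[simp] lemma rotl_nil : rotl ([] : List α) = [] := rfl
@[simp] lemma rotl_cons (a : α) (t : List α) : rotl (a :: t) = t ++ [a] := rfl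
@[simp] lemma unrotl_nil : unrotl ([] : List α) = [] := rfl
@[simp] lemma unrotl_concat (a : α) (t : List α) : unrotl (t ++ [a]) = a :: t := by
  simp [unrotl]
@[simp] lemma length_rotl (l : List α) : (rotl l).length = l.length := by
  cases l <;> simp
@[simp] lemma length_unrotl (l : List α) : (unrotl l).length = l.length := by
  simp [unrotl]
@[simp] lemma unrotl_rotl (l : List α) : unrotl (rotl l) = l := by
  cases l <;> simp
@[simp] lemma rotl_unrotl (l : List α) : rotl (unrotl l) = l := by
  induction l using List.reverseRecOn <;> simp

end rotl

variable {M : ℕ}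

/-- The effect of one instruction. -/
def step : Instr → Cfg M → Cfg M
  | .perm π, ⟨q, r, z, a :: t⟩ => ⟨(π (q, a)).1, r, z, (π (q, a)).2 :: t⟩
  | .swp f, ⟨q, r, z, a :: t⟩ => bif f q then ⟨q, a, z, r :: t⟩ else ⟨q, r, z, a :: t⟩
  | .rot f, ⟨q, r, z, l⟩ => bif f q then ⟨q, r, z + 1, rotl l⟩ else ⟨q, r, z, l⟩
  | .unrot f, ⟨q, r, z, l⟩ => bif f q then ⟨q, r, z - 1, unrotl l⟩ else ⟨q, r, z, l⟩
  | _, c => c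

@[simp] lemma step_perm (π : Perm (St × Sym)) (q r) (z : ZMod M) (a t) :
    step (.perm π) ⟨q, r, z, a :: t⟩ = ⟨(π (q, a)).1, r, z, (π (q, a)).2 :: t⟩ := rfl
@[simp] lemma step_swp (f : St → Bool) (q r) (z : ZMod M) (a t) :
    step (.swp f) ⟨q, r, z, a :: t⟩ =
      bif f q then ⟨q, a, z, r :: t⟩ else ⟨q, r, z, a :: t⟩ := rfl
@[simp] lemma step_rot (f : St → Bool) (q r) (z : ZMod M) (l) :
    step (.rot f) ⟨q, r, z, l⟩ =
      bif f q then ⟨q, r, z + 1, rotl l⟩ else ⟨q, r, z, l⟩ := by cases l <;> rfl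
@[simp] lemma step_unrot (f : St → Bool) (q r) (z : ZMod M) (l) :
    step (.unrot f) ⟨q, r, z, l⟩ =
      bif f q then ⟨q, r, z - 1, unrotl l⟩ else ⟨q, r, z, l⟩ := by cases l <;> rfl
@[simp] lemma step_perm_nil (π : Perm (St × Sym)) (q r) (z : ZMod M) :
    step (.perm π) ⟨q, r, z, []⟩ = ⟨q, r, z, []⟩ := rfl
@[simp] lemma step_swp_nil (f : St → Bool) (q r) (z : ZMod M) :
    step (.swp f) ⟨q, r, z, []⟩ = ⟨q, r, z, []⟩ := rfl

@[simp] lemma Instr.inv_inv (i : Instr) : i.inv.inv = i := by cases i <;> simp [Instr.inv]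

lemma length_step (i : Instr) (c : Cfg M) : (step i c).l.length = c.l.length := by
  obtain ⟨q, r, z, l⟩ := c
  cases i with
  | perm π => cases l <;> simp
  | swp f => cases l <;> cases h : f q <;> simp [h]
  | rot f => cases h : f q <;> simp [h]
  | unrot f => cases h : f q <;> simp [h]

lemma step_inv_step (i : Instr) (c : Cfg M) : step i.inv (step i c) = c := by
  obtain ⟨q, r, z, l⟩ := c
  cases i with
  | perm π => cases l <;> simp [Instr.inv]
  | swp f => cases l <;> cases h : f q <;> simp [Instr.inv, h]
  | rot f => cases h : f q <;> simp [Instr.inv, h]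
  | unrot f => cases h : f q <;> simp [Instr.inv, h]

/-- Running a word of instructions, the last one first. -/
def run (w : List Instr) (c : Cfg M) : Cfg M := w.foldr step c

@[simp] lemma run_nil (c : Cfg M) : run [] c = c := rfl
@[simp] lemma run_cons (i : Instr) (w : List Instr) (c : Cfg M) :
    run (i :: w) c = step i (run w c) := rfl
@[simp] lemma run_append (v w : List Instr) (c : Cfg M) :
    run (v ++ w) c = run v (run w c) := by simp [run]

lemma length_run (w : List Instr) (c : Cfg M) : (run w c).l.length = c.l.length := by
  induction w with
  | nil => rfl
  | cons i w ih => rw [run_cons, length_step, ih]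

lemma run_winv_run (w : List Instr) (c : Cfg M) : run (winv w) (run w c) = c := by
  induction w with
  | nil => rfl
  | cons i w ih => simpa [winv, step_inv_step] using ih

lemma winv_winv (w : List Instr) : winv (winv w) = w := by
  have h : Instr.inv ∘ Instr.inv = id := funext Instr.inv_inv
  simp [winv, h]

lemma run_run_winv (w : List Instr) (c : Cfg M) : run w (run (winv w) c) = c := by
  simpa [winv_winv] using run_winv_run (winv w) c

/-- Configurations on a tape of length `L`. -/
abbrev Tape (M L : ℕ) := {c : Cfg M // c.l.length = L}

/-- The permutation of the configurations on tapes of length `L` induced by a word. -/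
def ev (M L : ℕ) (w : List Instr) : Perm (Tape M L) where
  toFun c := ⟨run w c.1, by rw [length_run, c.2]⟩
  invFun c := ⟨run (winv w) c.1, by rw [length_run, c.2]⟩
  left_inv c := Subtype.ext (run_winv_run w c.1)
  right_inv c := Subtype.ext (run_run_winv w c.1)

variable {L : ℕ}

@[simp] lemma coe_ev (w : List Instr) (c : Tape M L) : (ev M L w c : Cfg M) = run w c := rfl

@[simp] lemma ev_nil : ev M L [] = 1 := rfl

@[simp] lemma ev_append (v w : List Instr) : ev M L (v ++ w) = ev M L v * ev M L w := by
  ext1 c; exact Subtype.ext (run_append v w c.1)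

@[simp] lemma ev_winv (w : List Instr) : ev M L (winv w) = (ev M L w)⁻¹ := by
  ext1 c; exact Subtype.ext rfl

@[simp] lemma ev_wcomm (v w : List Instr) :
    ev M L (wcomm v w) = ⁅ev M L v, ev M L w⁆ := by
  simp [wcomm, commutatorElement_def, mul_assoc]

/-- The `n`-th power of a word. -/
def wpow (w : List Instr) (n : ℕ) : List Instr := (List.replicate n w).flatten

@[simp] lemma wpow_zero (w : List Instr) : wpow w 0 = [] := rfl
lemma wpow_succ (w : List Instr) (n : ℕ) : wpow w (n + 1) = w ++ wpow w n := by
  simp [wpow, List.replicate_succ]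

@[simp] lemma ev_wpow (w : List Instr) (n : ℕ) : ev M L (wpow w n) = ev M L w ^ n := by
  induction n with
  | zero => rfl
  | succ n ih => rw [wpow_succ, ev_append, ih, pow_succ']

@[simp] lemma length_winv (w : List Instr) : (winv w).length = w.length := by simp [winv]
@[simp] lemma length_wpow (w : List Instr) (n : ℕ) : (wpow w n).length = n * w.length := by
  simp [wpow]
@[simp] lemma length_wcomm (v w : List Instr) :
    (wcomm v w).length = 2 * v.length + 2 * w.length := by
  simp [wcomm]; omega

/-! ### Carrying a block of cells -/

/-- Insert the block `d` to the right of the head. -/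
def carry (d : List Sym) (c : Cfg M) : Cfg M := ⟨c.q, c.r, c.z, d ++ c.l⟩

/-- Exchange the first two symbols, using the register. -/
def swapWord (f : St → Bool) : List Instr :=
  [.swp f, .unrot f, .swp f, .rot f, .swp f]

/-- Rotate the tape while carrying a block of `k` cells. -/
def rotWord (k : ℕ) (f : St → Bool) : List Instr :=
  .rot f :: wpow (swapWord f ++ [.unrot f]) k ++ wpow [.rot f] k

/-- Execute an instruction while carrying a block of `k` cells. -/
def liftInstr (k : ℕ) : Instr → List Instr
  | .perm π => wpow [.unrot fun _ => true] k ++ .perm π :: wpow [.rot fun _ => true] k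
  | .swp _ => []
  | .rot f => rotWord k f
  | .unrot f => winv (rotWord k f)

/-- Execute a word while carrying a block of `k` cells. -/
def lift (k : ℕ) (w : List Instr) : List Instr := w.flatMap (liftInstr k)

/-- Instructions not using the register. -/
def Instr.Pure : Instr → Prop
  | .swp _ => False
  | _ => True

lemma step_of_false {f : St → Bool} {c : Cfg M} (h : f c.q = false) :
    step (.swp f) c = c ∧ step (.rot f) c = c ∧ step (.unrot f) c = c := by
  obtain ⟨q, r, z, l⟩ := c
  simp only at h
  cases l <;> simp [h]

lemma run_wpow_rot (f : St → Bool) (q r) (z : ZMod M) (d l : List Sym) (h : f q = true) :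
    run (wpow [.rot f] d.length) ⟨q, r, z, d ++ l⟩ = ⟨q, r, z + d.length, l ++ d⟩ := by
  induction d using List.reverseRecOn generalizing l with
  | nil => simp
  | append_singleton d a ih =>
    simp [wpow_succ, ih, h, add_assoc]

lemma run_wpow_unrot (f : St → Bool) (q r) (z : ZMod M) (d l : List Sym) (h : f q = true) :
    run (wpow [.unrot f] d.length) ⟨q, r, z, l ++ d⟩ = ⟨q, r, z - d.length, d ++ l⟩ := by
  induction d generalizing l with
  | nil => simp
  | cons a d ih =>
    have := ih (l ++ [a])
    simp only [List.append_assoc, List.cons_append, List.nil_append] at this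
    simp only [List.length_cons, wpow_succ, run_append, this, run_cons, run_nil, step_unrot, h,
      cond_true]
    rw [← List.append_assoc, unrotl_concat]
    simp [sub_sub]

lemma run_swapWord (f : St → Bool) (q r) (z : ZMod M) (a b l) (h : f q = true) :
    run (swapWord f) ⟨q, r, z, a :: b :: l⟩ = ⟨q, r, z, b :: a :: l⟩ := by
  simp only [swapWord, run_cons, run_nil, step_swp, h, cond_true, step_rot, rotl_cons,
    List.cons_append, step_unrot]
  rw [← List.cons_append, unrotl_concat]
  simp [h]

lemma run_bubble (f : St → Bool) (q r) (z : ZMod M) (a) (d l : List Sym) (h : f q = true) :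
    run (wpow (swapWord f ++ [.unrot f]) d.length) ⟨q, r, z, a :: (l ++ d)⟩ =
      ⟨q, r, z - d.length, a :: (d ++ l)⟩ := by
  induction d generalizing l with
  | nil => simp
  | cons b d ih =>
    have := ih (l ++ [b])
    simp only [List.append_assoc, List.cons_append, List.nil_append] at this
    simp only [List.length_cons, wpow_succ, run_append, this, run_cons, run_nil, step_unrot, h,
      cond_true]
    rw [← List.append_assoc, ← List.cons_append, unrotl_concat, run_swapWord _ _ _ _ _ _ _ h]
    simp [sub_sub]

lemma run_rotWord (f : St → Bool) (d : List Sym) (c : Cfg M) (hc : c.l ≠ []) :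
    run (rotWord d.length f) (carry d c) = carry d (step (.rot f) c) := by
  obtain ⟨q, r, z, _ | ⟨a, l⟩⟩ := c
  · simp at hc
  cases h : f q with
  | true =>
    simp [carry, rotWord, run_wpow_rot _ _ _ _ _ _ h, h, run_bubble]
  | false =>
    have key : ∀ (w : List Instr) (c : Cfg M), f c.q = false →
        (∀ i ∈ w, i = .swp f ∨ i = .rot f ∨ i = .unrot f) → run w c = c := by
      intro w c hf hw
      induction w with
      | nil => rfl
      | cons i w ih =>
        rw [run_cons, ih fun j hj => hw j (List.mem_cons_of_mem _ hj)]
        obtain ⟨h1, h2, h3⟩ := step_of_false hf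
        rcases hw i List.mem_cons_self with rfl | rfl | rfl <;> assumption
    have : step (.rot f) ⟨q, r, z, a :: l⟩ = ⟨q, r, z, a :: l⟩ := by simp [h]
    rw [this]
    refine key _ _ h fun i hi => ?_
    simp only [rotWord, wpow, swapWord, List.cons_append, List.mem_cons, List.mem_append,
      List.mem_flatten, List.mem_replicate] at hi
    rcases hi with hi | ⟨w, ⟨_, rfl⟩, hi⟩ | ⟨w, ⟨_, rfl⟩, hi⟩
    · simp [hi]
    · simp at hi; tauto
    · simp at hi; tauto

lemma l_ne_nil_step {c : Cfg M} (i : Instr) (hc : c.l ≠ []) : (step i c).l ≠ [] := by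
  rw [← List.length_pos_iff_ne_nil, length_step]; exact List.length_pos_iff_ne_nil.2 hc

lemma run_liftInstr {i : Instr} (hi : i.Pure) (d : List Sym) (c : Cfg M) (hc : c.l ≠ []) :
    run (liftInstr d.length i) (carry d c) = carry d (step i c) := by
  cases i with
  | swp f => exact hi.elim
  | rot f => exact run_rotWord f d c hc
  | unrot f =>
    have := run_rotWord f d (step (.unrot f) c) (l_ne_nil_step _ hc)
    rw [show step (.rot f) (step (.unrot f) c) = c from step_inv_step (.unrot f) c] at this
    rw [liftInstr, ← this, run_winv_run]
  | perm π =>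
    obtain ⟨q, r, z, _ | ⟨a, l⟩⟩ := c
    · simp at hc
    simp only [liftInstr, carry, run_append, run_cons]
    rw [run_wpow_rot _ _ _ _ _ _ rfl, List.cons_append, step_perm, ← List.cons_append,
      run_wpow_unrot _ _ _ _ _ _ rfl]
    simp

lemma run_lift {w : List Instr} (hw : ∀ i ∈ w, i.Pure) (d : List Sym) (c : Cfg M)
    (hc : c.l ≠ []) : run (lift d.length w) (carry d c) = carry d (run w c) := by
  induction w with
  | nil => rfl
  | cons i w ih =>
    have hn : (run w c).l ≠ [] := by
      rw [← List.length_pos_iff_ne_nil, length_run]; exact List.length_pos_iff_ne_nil.2 hc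
    rw [lift, List.flatMap_cons, run_append, ← lift,
      ih fun j hj => hw j (List.mem_cons_of_mem _ hj), run_cons,
      run_liftInstr (hw i List.mem_cons_self) d _ hn]

lemma exists_carry (k : ℕ) (c : Cfg M) (h : k < c.l.length) :
    ∃ (d : List Sym) (c' : Cfg M), d.length = k ∧ c'.l.length = c.l.length - k ∧
      c = carry d c' := by
  refine ⟨c.l.take k, ⟨c.q, c.r, c.z, c.l.drop k⟩, by simp; omega, by simp, ?_⟩
  simp [carry]

@[simp] lemma length_carry (d : List Sym) (c : Cfg M) :
    (carry d c).l.length = d.length + c.l.length := by simp [carry]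

lemma length_lift (k : ℕ) (w : List Instr) : (lift k w).length ≤ w.length * (7 * k + 1) := by
  induction w with
  | nil => simp [lift]
  | cons i w ih =>
    have : (liftInstr k i).length ≤ 7 * k + 1 := by
      cases i <;> simp [liftInstr, rotWord, swapWord] <;> omega
    simp only [lift, List.flatMap_cons, List.length_append, List.length_cons] at ih ⊢
    linarith

/-! ### The machine -/

/-- The write-and-change-state table of the machine. -/
def tableA (p : Fin 4 × Fin 3) : Fin 4 × Fin 3 :=
  ![![(0, 1), (1, 1), (2, 1)], ![(0, 0), (3, 0), (0, 2)], ![(1, 0), (3, 1), (1, 2)],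
    ![(2, 0), (3, 2), (2, 2)]] p.1 p.2

/-- The inverse of `tableA`. -/
def tableAInv (p : Fin 4 × Fin 3) : Fin 4 × Fin 3 :=
  ![![(1, 0), (0, 0), (1, 2)], ![(2, 0), (0, 1), (2, 2)], ![(3, 0), (0, 2), (3, 2)],
    ![(1, 1), (2, 1), (3, 1)]] p.1 p.2

/-- The write-and-change-state table of the substitution. -/
def tableE (p : Fin 4 × Fin 3) : Fin 4 × Fin 3 :=
  ![![(1, 0), (0, 0), (0, 1)], ![(1, 1), (3, 0), (2, 0)], ![(1, 2), (0, 2), (2, 1)],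
    ![(3, 1), (3, 2), (2, 2)]] p.1 p.2

/-- The inverse of `tableE`. -/
def tableEInv (p : Fin 4 × Fin 3) : Fin 4 × Fin 3 :=
  ![![(0, 1), (0, 2), (2, 1)], ![(0, 0), (1, 0), (2, 0)], ![(1, 2), (2, 2), (3, 2)],
    ![(1, 1), (3, 0), (3, 1)]] p.1 p.2

/-- The pairs at which the substitution turns the head around. -/
def turnE (p : Fin 4 × Fin 3) : Bool :=
  p = (0, 1) ∨ p = (2, 1) ∨ p = (3, 1) ∨ p = (3, 2)

/-- The pairs after which the machine does not turn. -/
def goOnA (p : Fin 4 × Fin 3) : Bool := p.2 = 1 ∨ p.1 = 3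

/-- The turn of the machine before it moves to its site. -/
def turnA : Perm (St × Sym) where
  toFun := fun ((h, d, φ), x) => ((h, d ^^ (decide (h = 0 ∨ h = 3) && φ = 0), φ), x)
  invFun := fun ((h, d, φ), x) => ((h, d ^^ (decide (h = 0 ∨ h = 3) && φ = 0), φ), x)
  left_inv := by decide
  right_inv := by decide

/-- The write step of the machine. -/
def writeA : Perm (St × Sym) where
  toFun := fun ((h, d, φ), s) =>
    if φ = 0 then (((tableA (h, s)).1, d ^^ !goOnA (tableA (h, s)), φ), (tableA (h, s)).2)
    else ((h, d, φ), s)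
  invFun := fun ((h, d, φ), s) =>
    if φ = 0 then (((tableAInv (h, s)).1, d ^^ !goOnA (h, s), φ), (tableAInv (h, s)).2)
    else ((h, d, φ), s)
  left_inv := by decide
  right_inv := by decide

/-- The write step of the substitution. -/
def writeE : Perm (St × Sym) where
  toFun := fun ((h, d, φ), s) =>
    (((tableE (h, s)).1, d ^^ turnE (h, s), φ), (tableE (h, s)).2)
  invFun := fun ((h, d, φ), s) =>
    (((tableEInv (h, s)).1, d ^^ turnE (tableEInv (h, s)), φ), (tableEInv (h, s)).2)
  left_inv := by decide
  right_inv := by decide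

/-- One step of the machine. -/
def aW : List Instr :=
  [.rot fun q => q.2.1 && q.2.2 = 0, .perm writeA, .unrot fun q => !q.2.1 && q.2.2 = 0,
    .perm turnA]

/-- The substitution. -/
def eW : List Instr := [.rot fun q => decide (q.1 = 1) ^^ q.2.1, .perm writeE]

lemma pure_aW : ∀ i ∈ aW, i.Pure := by simp [aW, Instr.Pure]
lemma pure_eW : ∀ i ∈ eW, i.Pure := by simp [eW, Instr.Pure]

/-! ### Symbolic execution -/

/-- Symbolic configurations: state, displacement, known cells after and before the head. -/
abbrev SymCfg := St × ℤ × List Sym × List Sym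

/-- Symbolic execution of an instruction on partially known tapes. -/
def symStep : Instr → SymCfg → Option SymCfg
  | .perm π, (q, z, a :: f, b) => some ((π (q, a)).1, z, (π (q, a)).2 :: f, b)
  | .rot p, (q, z, f, b) => bif p q then
      (match f with
        | [] => none
        | a :: f => some (q, z + 1, f, a :: b))
      else some (q, z, f, b)
  | .unrot p, (q, z, f, b) => bif p q then
      (match b with
        | [] => none
        | a :: b => some (q, z - 1, a :: f, b))
      else some (q, z, f, b)
  | _, _ => none

/-- Symbolic execution of a word. -/
def symRun (w : List Instr) (s : SymCfg) : Option SymCfg :=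
  w.foldr (fun i o => o.bind (symStep i)) (some s)

/-- The configuration described by a symbolic one. -/
def SymCfg.real (r : Sym) (z : ZMod M) (m : List Sym) (s : SymCfg) : Cfg M :=
  ⟨s.1, r, z + s.2.1, s.2.2.1 ++ (m ++ s.2.2.2.reverse)⟩

lemma step_real {i : Instr} {s s' : SymCfg} (h : symStep i s = some s') (r : Sym) (z : ZMod M)
    (m : List Sym) : step i (s.real r z m) = s'.real r z m := by
  obtain ⟨q, t, f, b⟩ := s
  cases i with
  | swp p => simp [symStep] at h
  | perm π =>
    cases f with
    | nil => simp [symStep] at h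
    | cons a f =>
      simp only [symStep, Option.some.injEq] at h
      subst h
      simp [SymCfg.real]
  | rot p =>
    cases hp : p q with
    | false => simp [symStep, hp] at h; subst h; simp [SymCfg.real, hp]
    | true =>
      cases f with
      | nil => simp [symStep, hp] at h
      | cons a f => simp [symStep, hp] at h; subst h; simp [SymCfg.real, hp, add_assoc]
  | unrot p =>
    cases hp : p q with
    | false => simp [symStep, hp] at h; subst h; simp [SymCfg.real, hp]
    | true =>
      cases b with
      | nil => simp [symStep, hp] at h
      | cons a b =>
        simp [symStep, hp] at h; subst h
        simp only [SymCfg.real, step_unrot, hp, cond_true, List.reverse_cons]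
        rw [← List.append_assoc m, ← List.append_assoc f, unrotl_concat]
        simp [add_sub_assoc]

lemma run_real {w : List Instr} {s s' : SymCfg} (h : symRun w s = some s') (r : Sym)
    (z : ZMod M) (m : List Sym) : run w (s.real r z m) = s'.real r z m := by
  induction w generalizing s' with
  | nil => simp [symRun] at h; simp [h]
  | cons i w ih =>
    change (symRun w s).bind (symStep i) = some s' at h
    obtain ⟨t, ht, h⟩ := Option.bind_eq_some_iff.1 h
    rw [run_cons, ih ht, step_real h]

/-- The reduction map, for `ℤ` written as `ZMod 0`. -/
def ofZ (M : ℕ) : ZMod 0 →+* ZMod M := Int.castRingHom (ZMod M)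

/-- Transport of a configuration along `ℤ → ZMod M`, with a displacement and a new register. -/
def Cfg.cast (r : Sym) (z : ZMod M) (c : Cfg 0) : Cfg M := ⟨c.q, r, z + ofZ M c.z, c.l⟩

lemma step_cast {i : Instr} (hi : i.Pure) (r : Sym) (z : ZMod M) (c : Cfg 0) :
    step i (c.cast r z) = (step i c).cast r z := by
  obtain ⟨q, r, t, l⟩ := c
  cases i with
  | perm π => cases l <;> rfl
  | swp f => exact hi.elim
  | rot f => cases h : f q <;> simp [h, Cfg.cast, add_assoc]
  | unrot f => cases h : f q <;> simp [h, Cfg.cast, add_sub_assoc]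

lemma run_cast {w : List Instr} (hw : ∀ i ∈ w, i.Pure) (r : Sym) (z : ZMod M) (c : Cfg 0) :
    run w (c.cast r z) = (run w c).cast r z := by
  induction w with
  | nil => rfl
  | cons i w ih =>
    rw [run_cons, ih fun j hj => hw j (List.mem_cons_of_mem _ hj),
      step_cast (hw i List.mem_cons_self), run_cons]

/-! ### The flag -/

lemma run_aW_of_frozen {c : Cfg M} (h : c.q.2.2 ≠ 0) : run aW c = c := by
  obtain ⟨⟨q, d, φ⟩, r, z, l⟩ := c
  simp only at h
  cases l <;> simp [aW, turnA, writeA, h]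

/-- Add one to the flag. -/
def Cfg.bump (c : Cfg M) : Cfg M := ⟨(c.q.1, c.q.2.1, c.q.2.2 + 1), c.r, c.z, c.l⟩

lemma run_eW_bump (c : Cfg M) : run eW c.bump = (run eW c).bump := by
  obtain ⟨⟨h, d, φ⟩, r, z, l⟩ := c
  cases l with
  | nil =>
    simp only [eW, Cfg.bump, run_cons, run_nil, step_perm_nil, step_rot]
    cases (decide (h = 1) ^^ d) <;> rfl
  | cons a l =>
    simp only [eW, Cfg.bump, run_cons, run_nil, step_perm, step_rot, writeE, Equiv.coe_fn_mk]
    cases (decide ((tableE (h, a)).1 = 1) ^^ (d ^^ turnE (h, a))) <;> rfl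

lemma flag_run_eW (c : Cfg M) : (run eW c).q.2.2 = c.q.2.2 := by
  obtain ⟨⟨h, d, φ⟩, r, z, l⟩ := c
  cases l with
  | nil =>
    simp only [eW, run_cons, run_nil, step_perm_nil, step_rot]
    cases (decide (h = 1) ^^ d) <;> rfl
  | cons a l =>
    simp only [eW, run_cons, run_nil, step_perm, step_rot, writeE, Equiv.coe_fn_mk]
    cases (decide ((tableE (h, a)).1 = 1) ^^ (d ^^ turnE (h, a))) <;> rfl

/-! ### The substitution -/

instance : DecidableEq (ZMod 0) := inferInstanceAs (DecidableEq ℤ)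

instance : DecidableEq (Cfg 0) := fun a b =>
  decidable_of_iff (a.q = b.q ∧ a.r = b.r ∧ a.z = b.z ∧ a.l = b.l) Cfg.ext_iff.symm

lemma substitution_singleton : ∀ (h : Fin 4) (d : Bool) (x y : Sym),
    run (aW ++ aW ++ aW ++ eW) (carry [x] (⟨(h, d, 0), 0, 0, [y]⟩ : Cfg 0)) =
      run eW (carry [x] (run aW ⟨(h, d, 0), 0, 0, [y]⟩)) := by
  decide +kernel

lemma substitution_pair : ∀ (h : Fin 4) (d : Bool) (x y t : Sym),
    run (aW ++ aW ++ aW ++ eW) (carry [x] (⟨(h, d, 0), 0, 0, [y, t]⟩ : Cfg 0)) =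
      run eW (carry [x] (run aW ⟨(h, d, 0), 0, 0, [y, t]⟩)) := by
  decide +kernel

lemma substitution_of_zero {q : St} {x : Sym} {l : List Sym} (r : Sym) (z : ZMod M)
    (h : run (aW ++ aW ++ aW ++ eW) (carry [x] (⟨q, 0, 0, l⟩ : Cfg 0)) =
      run eW (carry [x] (run aW ⟨q, 0, 0, l⟩))) :
    run (aW ++ aW ++ aW ++ eW) (carry [x] (⟨q, r, z, l⟩ : Cfg M)) =
      run eW (carry [x] (run aW ⟨q, r, z, l⟩)) := by
  have e2 : (⟨q, r, z, l⟩ : Cfg M) = (⟨q, 0, 0, l⟩ : Cfg 0).cast r z := by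
    simp [Cfg.cast]
  have e3 : ∀ c : Cfg 0, carry [x] (c.cast r z) = (carry [x] c).cast r z := fun _ => rfl
  rw [e2, run_cast pure_aW, e3, e3, run_cast pure_eW, run_cast _, h]
  simp only [List.mem_append]
  rintro i (((h | h) | h) | h)
  exacts [pure_aW i h, pure_aW i h, pure_aW i h, pure_eW i h]

/-- Symbolic version of `carry`. -/
def symCarry (x : Sym) (s : SymCfg) : SymCfg := (s.1, s.2.1, x :: s.2.2.1, s.2.2.2)

instance : DecidableEq SymCfg := inferInstanceAs (DecidableEq (St × ℤ × List Sym × List Sym))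

lemma substitution_long : ∀ (h : Fin 4) (d : Bool) (x y u t : Sym),
    (symRun (aW ++ aW ++ aW ++ eW) ((h, d, 0), 0, [x, y, u], [t])).isSome ∧
    symRun (aW ++ aW ++ aW ++ eW) ((h, d, 0), 0, [x, y, u], [t]) =
      (symRun aW ((h, d, 0), 0, [y, u], [t])).bind fun s => symRun eW (symCarry x s) := by
  decide +kernel

/-- The substitution conjugates one machine step past a carried cell to three machine steps. -/
lemma substitution (x : Sym) (c : Cfg M) (hc : c.l ≠ []) :
    run (aW ++ aW ++ aW ++ eW) (carry [x] c) = run eW (carry [x] (run aW c)) := by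
  by_cases hφ : c.q.2.2 ≠ 0
  · have h1 : (run eW (carry [x] c)).q.2.2 ≠ 0 := by rwa [flag_run_eW]
    simp only [run_append, run_aW_of_frozen hφ, run_aW_of_frozen h1]
  obtain ⟨⟨h, d, φ⟩, r, z, l⟩ := c
  obtain rfl : φ = 0 := not_not.1 hφ
  rcases l with _ | ⟨y, l⟩
  · simp at hc
  rcases List.eq_nil_or_concat l with rfl | ⟨m, t, rfl⟩
  · exact substitution_of_zero r z (substitution_singleton h d x y)
  rw [List.concat_eq_append]
  rcases m with _ | ⟨u, m⟩
  · exact substitution_of_zero r z (substitution_pair h d x y t)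
  obtain ⟨h1, h2⟩ := substitution_long h d x y u t
  obtain ⟨s, hs⟩ := Option.isSome_iff_exists.1 h1
  rw [hs] at h2
  obtain ⟨v, hu, hv⟩ := Option.bind_eq_some_iff.1 h2.symm
  have e1 : carry [x] (⟨(h, d, 0), r, z, y :: (u :: m ++ [t])⟩ : Cfg M) =
      SymCfg.real r z m ((h, d, 0), 0, [x, y, u], [t]) := by simp [carry, SymCfg.real]
  have e2 : (⟨(h, d, 0), r, z, y :: (u :: m ++ [t])⟩ : Cfg M) =
      SymCfg.real r z m ((h, d, 0), 0, [y, u], [t]) := by simp [SymCfg.real]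
  have e3 : carry [x] (SymCfg.real r z m v) = SymCfg.real r z m (symCarry x v) := rfl
  rw [e1, e2, run_real hs, run_real hu, e3, run_real hv]

/-- Three machine steps as one machine step past a carried cell. -/
lemma ev_lift_pow_three {i : ℕ} (hi : i + 2 ≤ L) :
    ev M L (lift i aW) ^ 3 =
      ev M L (lift i eW) * ev M L (lift (i + 1) aW) * (ev M L (lift i eW))⁻¹ := by
  rw [eq_mul_inv_iff_mul_eq]
  ext1 ⟨c, hc⟩
  apply Subtype.ext
  obtain ⟨d, c, hd, hl, rfl⟩ := exists_carry i c (by omega)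
  obtain ⟨d', c, hd', hl', rfl⟩ := exists_carry 1 c (by omega)
  obtain ⟨x, rfl⟩ := List.length_eq_one_iff.1 hd'
  subst hd
  simp only [length_carry, List.length_singleton] at hc hl
  have hn : ∀ c : Cfg M, 0 < c.l.length → c.l ≠ [] := fun c => List.length_pos_iff_ne_nil.1
  have hx := hn (carry [x] c) (by simp)
  have hc0 := hn c (by omega)
  have e1 : ∀ c : Cfg M, carry d (carry [x] c) = carry (d ++ [x]) c := fun c => by
    simp [carry]
  have hlen : (d ++ [x]).length = d.length + 1 := by simp
  have h3 := substitution x c hc0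
  simp only [run_append] at h3
  simp only [pow_succ, pow_zero, one_mul, Perm.mul_apply, coe_ev]
  rw [run_lift pure_eW _ _ hx, run_lift pure_aW _ _ (hn _ (by rw [length_run]; simp)),
    run_lift pure_aW _ _ (hn _ (by simp only [length_run]; simp)),
    run_lift pure_aW _ _ (hn _ (by simp only [length_run]; simp)), h3, e1, ← hlen,
    run_lift pure_aW _ _ hc0, ← e1,
    run_lift pure_eW _ _ (hn _ (by simp))]

lemma ev_lift_aW_of_frozen {i : ℕ} (hi : i < L) {c : Tape M L} (h : c.1.q.2.2 ≠ 0) :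
    ev M L (lift i aW) c = c := by
  obtain ⟨c, hc⟩ := c
  apply Subtype.ext
  obtain ⟨d, c, rfl, hl, rfl⟩ := exists_carry i c (by omega)
  rw [coe_ev, run_lift pure_aW _ _ (List.length_pos_iff_ne_nil.1 (by omega)),
    run_aW_of_frozen (c := c) h]

/-! ### The clock -/

/-- The permutation adding one to the flag. -/
def bumpPerm : Perm (St × Sym) where
  toFun p := ((p.1.1, p.1.2.1, p.1.2.2 + 1), p.2)
  invFun p := ((p.1.1, p.1.2.1, p.1.2.2 - 1), p.2)
  left_inv p := by simp
  right_inv p := by simp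

/-- The word adding one to the flag. -/
def bW : List Instr := [.perm bumpPerm]

lemma coe_ev_bW (hL : 0 < L) (c : Tape M L) : (ev M L bW c).1 = c.1.bump := by
  obtain ⟨⟨q, r, z, _ | ⟨a, l⟩⟩, hc⟩ := c
  · simp at hc; omega
  · rfl

lemma ev_bW_pow_three (hL : 0 < L) : ev M L bW ^ 3 = 1 := by
  ext1 c
  apply Subtype.ext
  simp only [pow_succ, pow_zero, one_mul, Perm.mul_apply, coe_ev_bW hL, Perm.one_apply]
  obtain ⟨⟨⟨h, d, φ⟩, r, z, l⟩, hc⟩ := c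
  simp only [Cfg.bump, add_assoc, Cfg.mk.injEq, Prod.mk.injEq, true_and, and_true]
  exact (by decide : ∀ φ : Fin 3, φ + (1 + (1 + 1)) = φ) φ

lemma commute_ev_lift_eW_bW {i : ℕ} (hi : i < L) :
    Commute (ev M L (lift i eW)) (ev M L bW) := by
  ext1 ⟨c, hc⟩
  apply Subtype.ext
  simp only [Perm.mul_apply, coe_ev_bW (i.zero_le.trans_lt hi), coe_ev]
  obtain ⟨d, c, rfl, hl, rfl⟩ := exists_carry i c (by omega)
  have e : ∀ c : Cfg M, (carry d c).bump = carry d c.bump := fun _ => rfl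
  have hc0 : c.l ≠ [] := List.length_pos_iff_ne_nil.1 (by omega)
  rw [e, run_lift pure_eW _ _ hc0, e, run_lift pure_eW _ _ (by exact hc0), run_eW_bump]

lemma ev_conj_lift_aW_of_thawed {i : ℕ} (hi : i < L) {c : Tape M L} (h : c.1.q.2.2 = 0) :
    (ev M L bW * ev M L (lift i aW) * (ev M L bW)⁻¹) c = c := by
  have h1 : ((ev M L bW)⁻¹ c).1.q.2.2 ≠ 0 := by
    intro h0
    have h2 := coe_ev_bW (i.zero_le.trans_lt hi) ((ev M L bW)⁻¹ c)
    rw [show ev M L bW ((ev M L bW)⁻¹ c) = c from Equiv.apply_symm_apply _ c] at h2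
    rw [h2] at h
    simp only [Cfg.bump, h0, zero_add, one_ne_zero] at h
  rw [Perm.mul_apply, Perm.mul_apply, ev_lift_aW_of_frozen hi h1, Perm.inv_def,
    Equiv.apply_symm_apply]

lemma commute_ev_lift_aW {i : ℕ} (hi : i < L) :
    Commute (ev M L (lift i aW)) (ev M L bW * ev M L (lift i aW) * (ev M L bW)⁻¹) := by
  apply Perm.Disjoint.commute
  intro c
  by_cases h : c.1.q.2.2 = 0
  · exact Or.inr (ev_conj_lift_aW_of_thawed hi h)
  · exact Or.inl (ev_lift_aW_of_frozen hi h)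

lemma commutator_pow {i : ℕ} (hi : i < L) (n : ℕ) :
    ⁅ev M L (lift i aW), ev M L bW⁆ ^ n = ⁅ev M L (lift i aW) ^ n, ev M L bW⁆ := by
  have h := (commute_ev_lift_aW (M := M) hi).inv_right
  have e : ∀ a s : Perm (Tape M L), ⁅a, s⁆ = a * (s * a * s⁻¹)⁻¹ := fun a s => by
    simp [commutatorElement_def, mul_assoc]
  rw [e, e, h.mul_pow, inv_pow, conj_pow]

/-- The flag commutator of the machine past `i` carried cells, computed by Horner's rule in
base three; `τ` is the word used to change the flag. -/
def horner (τ : List Instr) : ℕ → ℕ → ℕ → List Instr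
  | 0, i, n => wpow (wcomm (lift i aW) τ) n
  | t + 1, i, n => wpow (wcomm (lift i aW) τ) (n % 3) ++
      (lift i eW ++ (horner τ t (i + 1) (n / 3) ++ winv (lift i eW)))

lemma ev_horner_of_trivial {τ : List Instr} (h : ev M L τ = 1) (t i n : ℕ) :
    ev M L (horner τ t i n) = 1 := by
  induction t generalizing i n with
  | zero => simp [horner, h]
  | succ t ih => simp [horner, h, ih]

lemma ev_horner {τ : List Instr} (h : ev M L τ = ev M L bW) (t i n : ℕ) (hL : i + t < L) :
    ev M L (horner τ t i n) = ⁅ev M L (lift i aW), ev M L bW⁆ ^ n := by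
  induction t generalizing i n with
  | zero => simp [horner, h]
  | succ t ih =>
    simp only [horner, ev_append, ev_wpow, ev_wcomm, h, ev_winv]
    rw [ih (i + 1) (n / 3) (by omega)]
    have h3 : ⁅ev M L (lift i aW), ev M L bW⁆ ^ 3 =
        ev M L (lift i eW) * ⁅ev M L (lift (i + 1) aW), ev M L bW⁆ * (ev M L (lift i eW))⁻¹ := by
      rw [commutator_pow (by omega), ev_lift_pow_three (by omega)]
      have hc := (commute_ev_lift_eW_bW (M := M) (L := L) (i := i) (by omega))
      simp only [commutatorElement_def, mul_inv_rev, inv_inv, mul_assoc]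
      have h1 := hc.symm.inv_left.eq
      have h2 := hc.eq
      have h4 := hc.inv_left.eq
      have h5 := hc.inv_inv.eq
      simp only [mul_right_inj]
      rw [← mul_assoc _ (ev M L bW), h4, mul_assoc, inv_mul_cancel_left, h5]
    rw [← mul_assoc (ev M L (lift i eW)), ← conj_pow, ← h3, ← pow_mul, ← pow_add,
      Nat.mod_add_div]

lemma exists_conj_pow (t i : ℕ) (hL : i + t < L) :
    ∃ X : Perm (Tape M L),
      ev M L (lift i aW) ^ 3 ^ t = X * ev M L (lift (i + t) aW) * X⁻¹ := by
  induction t generalizing i with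
  | zero => exact ⟨1, by simp⟩
  | succ t ih =>
    obtain ⟨X, hX⟩ := ih (i + 1) (by omega)
    refine ⟨ev M L (lift i eW) * X, ?_⟩
    rw [pow_succ', pow_mul, ev_lift_pow_three (by omega), conj_pow, hX,
      show i + 1 + t = i + (t + 1) by ring]
    simp only [mul_inv_rev, mul_assoc]

/-! ### Tapes of length one -/

/-- The machine on a tape of length one, forgetting positions. -/
def unitStep (p : St × Sym) : St × Sym :=
  let c := run aW (⟨p.1, 0, 0, [p.2]⟩ : Cfg 0)
  (c.q, c.l.headD 0)

/-- The displacement of the machine on a tape of length one. -/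
def unitShift (p : St × Sym) : ZMod 0 := (run aW (⟨p.1, 0, 0, [p.2]⟩ : Cfg 0)).z

lemma run_aW_unit (p : St × Sym) (r : Sym) (z : ZMod M) :
    run aW ⟨p.1, r, z, [p.2]⟩ =
      ⟨(unitStep p).1, r, z + ofZ M (unitShift p), [(unitStep p).2]⟩ := by
  have h := run_cast pure_aW r z (⟨p.1, 0, 0, [p.2]⟩ : Cfg 0)
  have h1 : (⟨p.1, 0, 0, [p.2]⟩ : Cfg 0).cast r z = ⟨p.1, r, z, [p.2]⟩ := by simp [Cfg.cast]
  rw [h1] at h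
  rw [h]
  have hl := length_run aW (⟨p.1, 0, 0, [p.2]⟩ : Cfg 0)
  obtain ⟨x, hx⟩ := List.length_eq_one_iff.1 hl
  simp [Cfg.cast, unitStep, unitShift, hx]

lemma iterate_run_aW_unit (n : ℕ) (p : St × Sym) (r : Sym) (z : ZMod M) :
    (run aW)^[n] ⟨p.1, r, z, [p.2]⟩ = ⟨(unitStep^[n] p).1, r,
      z + ofZ M (∑ k ∈ Finset.range n, unitShift (unitStep^[k] p)), [(unitStep^[n] p).2]⟩ := by
  induction n with
  | zero => simp
  | succ n ih =>
    rw [Function.iterate_succ_apply', ih, run_aW_unit, Finset.sum_range_succ,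
      Function.iterate_succ_apply', map_add, add_assoc]

lemma unitStep_iterate_six (p : St × Sym) : unitStep^[6] p = p := by
  revert p; decide +kernel

lemma unitStep_iterate_mul_six (j : ℕ) (p : St × Sym) : unitStep^[6 * j] p = p := by
  have h : unitStep^[6] = id := funext unitStep_iterate_six
  rw [Function.iterate_mul, h, Function.iterate_id, id]

lemma sum_unitShift (j : ℕ) (p : St × Sym) :
    ∑ k ∈ Finset.range (6 * j), unitShift (unitStep^[k] p) =
      j * ∑ k ∈ Finset.range 6, unitShift (unitStep^[k] p) := by
  induction j with
  | zero => simp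
  | succ j ih =>
    rw [Nat.mul_succ, Finset.sum_range_add, ih]
    have : ∀ k, unitStep^[6 * j + k] p = unitStep^[k] p := fun k => by
      rw [add_comm, Function.iterate_add_apply, unitStep_iterate_mul_six]
    simp only [this]
    push_cast; ring

lemma coe_ev_pow (w : List Instr) (n : ℕ) (c : Tape M L) :
    ((ev M L w ^ n) c).1 = (run w)^[n] c.1 := by
  induction n with
  | zero => rfl
  | succ n ih => rw [pow_succ', Perm.mul_apply, coe_ev, ih, Function.iterate_succ_apply']

lemma iterate_run_lift {w : List Instr} (hw : ∀ i ∈ w, i.Pure) (d : List Sym) (c : Cfg M)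
    (hc : c.l ≠ []) (n : ℕ) :
    (run (lift d.length w))^[n] (carry d c) = carry d ((run w)^[n] c) := by
  induction n generalizing c with
  | zero => rfl
  | succ n ih =>
    rw [Function.iterate_succ_apply, run_lift hw _ _ hc, ih, Function.iterate_succ_apply]
    rw [← List.length_pos_iff_ne_nil, length_run]
    exact List.length_pos_iff_ne_nil.2 hc

lemma ev_lift_pow_order (j : ℕ) : ev (j + 1) (j + 1) (lift j aW) ^ (6 * (j + 1)) = 1 := by
  ext1 ⟨c, hc⟩
  apply Subtype.ext
  rw [coe_ev_pow]
  obtain ⟨d, ⟨q, r, z, l⟩, rfl, hl, rfl⟩ := exists_carry j c (by omega)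
  obtain ⟨x, rfl⟩ := List.length_eq_one_iff.1 (hl.trans (by omega))
  have h := iterate_run_aW_unit (6 * (d.length + 1)) (q, x) r z
  simp only [unitStep_iterate_mul_six, sum_unitShift] at h
  rw [iterate_run_lift pure_aW _ _ (by simp), h, map_mul, map_natCast, ZMod.natCast_self]
  simp

lemma commutator_pow_order (j : ℕ) :
    ⁅ev (j + 1) (j + 1) (lift 0 aW), ev (j + 1) (j + 1) bW⁆ ^ (6 * (j + 1) * 3 ^ j) = 1 := by
  obtain ⟨X, hX⟩ := exists_conj_pow (M := j + 1) (L := j + 1) j 0 (by omega)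
  rw [commutator_pow (by omega), mul_comm, pow_mul, hX, zero_add, conj_pow, ev_lift_pow_order]
  simp

lemma unitStep_iterate_ne : ∀ v : Fin 6, (v : ℕ) % 3 ≠ 0 →
    unitStep^[(v : ℕ)] ((0, true, 0), 0) ≠ ((0, true, 0), 0) := by
  decide +kernel

lemma pow_ne_one_of_not_dvd {K n : ℕ} (hn : ¬ 3 ∣ n) :
    ev M (K + 1) (lift K aW) ^ n ≠ 1 := by
  intro h
  set d : List Sym := List.replicate K 0
  have hd : d.length = K := by simp [d]
  have h1 := congrArg Subtype.val (Equiv.ext_iff.1 h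
    ⟨carry d (⟨(0, true, 0), 0, 0, [0]⟩ : Cfg M), by simp [hd]⟩)
  rw [coe_ev_pow] at h1
  nth_rewrite 1 [← hd] at h1
  rw [iterate_run_lift pure_aW _ _ (by simp)] at h1
  have h2 := iterate_run_aW_unit (M := M) n ((0, true, 0), 0) 0 0
  simp only at h2
  rw [h2] at h1
  simp only [carry, Perm.one_apply, Cfg.mk.injEq, List.append_cancel_left_eq,
    List.cons.injEq, and_true] at h1
  have h3 : unitStep^[n] ((0, true, 0), 0) = ((0, true, 0), 0) := Prod.ext h1.1 h1.2.2.2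
  rw [← Nat.mod_add_div n 6, Function.iterate_add_apply, unitStep_iterate_mul_six] at h3
  exact unitStep_iterate_ne ⟨n % 6, Nat.mod_lt _ (by norm_num)⟩ (by simp; omega) h3

/-- The infinite order of the flag commutator, on tapes of even length. -/
lemma exists_commutator_pow_ne_one {n : ℕ} (hn : n ≠ 0) :
    ∃ l, 1 ≤ l ∧ ∀ M, ⁅ev M (2 * l) (lift 0 aW), ev M (2 * l) bW⁆ ^ n ≠ 1 := by
  obtain ⟨k, m, hm, rfl⟩ := Nat.exists_eq_pow_mul_and_not_dvd hn 3 (by norm_num)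
  obtain ⟨K, hK, l, hl⟩ : ∃ K, k ≤ K ∧ ∃ l, K + 1 = 2 * l := by
    rcases Nat.even_or_odd' k with ⟨l, h | h⟩
    · exact ⟨k + 1, by omega, l + 1, by omega⟩
    · exact ⟨k, le_rfl, l + 1, by omega⟩
  refine ⟨l, by omega, fun M h => ?_⟩
  rw [← hl] at h
  have h1 : ev M (K + 1) (lift 0 aW) ^ (3 ^ k * m) = 1 := by
    rw [commutator_pow (by omega)] at h
    have hfix : ∀ (N : ℕ) (c : Tape M (K + 1)), c.1.q.2.2 ≠ 0 →
        (ev M (K + 1) (lift 0 aW) ^ N) c = c := fun N c hc =>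
      Perm.pow_apply_eq_self_of_apply_eq_self (ev_lift_aW_of_frozen (by omega) hc) N
    ext1 c
    by_cases hc : c.1.q.2.2 = 0
    · have hb : (ev M (K + 1) bW c).1.q.2.2 ≠ 0 := by
        rw [coe_ev_bW (by omega)]; simp [Cfg.bump, hc]
      rw [commutatorElement_eq_one_iff_mul_comm] at h
      have h2 := Equiv.ext_iff.1 h c
      rw [Perm.mul_apply, Perm.mul_apply, hfix _ _ hb] at h2
      exact (ev M (K + 1) bW).injective h2.symm
    · exact hfix _ c hc
  have h2 : (ev M (K + 1) (lift 0 aW) ^ 3 ^ K) ^ m = 1 := by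
    rw [← pow_mul, show 3 ^ K * m = 3 ^ k * m * 3 ^ (K - k) by
      rw [mul_right_comm, ← pow_add, Nat.add_sub_cancel' hK], pow_mul, h1, one_pow]
  obtain ⟨X, hX⟩ := exists_conj_pow (M := M) (L := K + 1) K 0 (by omega)
  rw [hX, zero_add, conj_pow, mul_inv_eq_one, mul_eq_left] at h2
  exact pow_ne_one_of_not_dvd hm h2

/-! ### Measuring the length of the tape -/

/-- Add the symbol under the head to the flag. -/
def addPerm : Perm (St × Sym) where
  toFun p := ((p.1.1, p.1.2.1, p.1.2.2 + p.2), p.2)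
  invFun p := ((p.1.1, p.1.2.1, p.1.2.2 - p.2), p.2)
  left_inv p := by simp
  right_inv p := by simp

/-- Add one to the symbol under the head. -/
def incPerm : Perm (St × Sym) where
  toFun p := (p.1, p.2 + 1)
  invFun p := (p.1, p.2 - 1)
  left_inv p := by simp
  right_inv p := by simp

/-- Unconditional rotation. -/
def rW : List Instr := [.rot fun _ => true]

/-- A word which adds one to the flag if the length of the tape divides `j`, and acts
trivially otherwise. -/
def dvdWord (j : ℕ) : List Instr :=
  wcomm [.perm addPerm] (wpow rW j ++ ([.perm incPerm] ++ winv (wpow rW j)))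

lemma length_dvdWord (j : ℕ) : (dvdWord j).length = 4 * j + 4 := by
  simp [dvdWord, rW]; ring

lemma coe_ev_rW_pow_length (c : Tape M L) :
    ((ev M L rW ^ L) c).1 = ⟨c.1.q, c.1.r, c.1.z + L, c.1.l⟩ := by
  obtain ⟨⟨q, r, z, l⟩, rfl⟩ := c
  have h := run_wpow_rot (fun _ => true) q r z l [] rfl
  simpa [rW, ← ev_wpow] using h

lemma commute_rW_pow_length (π : Perm (St × Sym)) :
    Commute (ev M L rW ^ L) (ev M L [.perm π]) := by
  ext1 c
  apply Subtype.ext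
  simp only [Perm.mul_apply, coe_ev_rW_pow_length, coe_ev, run_cons, run_nil]
  obtain ⟨⟨q, r, z, _ | ⟨a, l⟩⟩, hc⟩ := c <;> simp

lemma conj_rW_apply {u t : List Sym} {y : Sym} (q r) (z : ZMod M)
    (h : (u ++ y :: t).length = L) :
    (ev M L rW ^ (t.length + 1) * ev M L [.perm incPerm] * (ev M L rW ^ (t.length + 1))⁻¹)
      ⟨⟨q, r, z, u ++ y :: t⟩, h⟩ =
    ⟨⟨q, r, z, u ++ (y + 1) :: t⟩, by simpa using h⟩ := by
  have key : ∀ y, ∀ h : (u ++ y :: t).length = L,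
      (ev M L rW ^ (t.length + 1)) ⟨⟨q, r, z - (t.length + 1), y :: t ++ u⟩, by
        simp at h ⊢; omega⟩ = ⟨⟨q, r, z, u ++ y :: t⟩, h⟩ := by
    intro y h
    apply Subtype.ext
    rw [← ev_wpow, coe_ev]
    have := run_wpow_rot (fun _ => true) q r (z - ((t.length : ZMod M) + 1)) (y :: t) u rfl
    simpa [rW] using this
  rw [Perm.mul_apply, Perm.mul_apply, ← key y h, Perm.inv_def, Equiv.symm_apply_apply,
    ← key (y + 1)]
  rfl

lemma ev_dvdWord (hL : 0 < L) (j : ℕ) :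
    ev M L (dvdWord j) = if L ∣ j then ev M L bW else 1 := by
  simp only [dvdWord, ev_wcomm, ev_append, ev_winv, ev_wpow, ← mul_assoc]
  split_ifs with h
  · obtain ⟨k, rfl⟩ := h
    have hc := (commute_rW_pow_length (M := M) (L := L) incPerm).pow_left k
    rw [pow_mul, hc.eq, mul_inv_cancel_right]
    rw [commutatorElement_def, mul_inv_eq_iff_eq_mul, mul_inv_eq_iff_eq_mul]
    ext1 c
    apply Subtype.ext
    obtain ⟨⟨⟨h, d, φ⟩, r, z, _ | ⟨a, l⟩⟩, hc⟩ := c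
    · simp at hc; omega
    simp [addPerm, incPerm, bW, bumpPerm, add_assoc, add_comm]
  · have hj : 0 < j % L := Nat.pos_of_ne_zero fun h0 => h (Nat.dvd_of_mod_eq_zero h0)
    have hj' := Nat.mod_lt j hL
    have hc := (commute_rW_pow_length (M := M) (L := L) incPerm).pow_left (j / L)
    rw [← Nat.mod_add_div j L, pow_add, pow_mul, mul_inv_rev]
    rw [mul_assoc _ _ (ev M L [.perm incPerm]), hc.eq]
    simp only [mul_assoc, mul_inv_cancel_left]
    simp only [← mul_assoc]
    rw [commutatorElement_eq_one_iff_mul_comm]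
    ext1 c
    obtain ⟨⟨q, r, z, l⟩, hl⟩ := c
    simp only at hl
    obtain ⟨u, t, y, rfl, ht⟩ : ∃ u t y, l = u ++ y :: t ∧ t.length + 1 = j % L := by
      refine ⟨l.take (L - j % L), (l.drop (L - j % L)).tail,
        (l.drop (L - j % L)).head (by rw [← List.length_pos_iff_ne_nil]; simp; omega), ?_, ?_⟩
      · simp
      · simp; omega
    rcases u with _ | ⟨x, u⟩
    · simp at hl; omega
    rw [← ht, Perm.mul_apply (ev M L [.perm addPerm]), conj_rW_apply q r z hl,
      Perm.mul_apply _ (ev M L [.perm addPerm])]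
    have e : ∀ y : Sym, ∀ h : (x :: u ++ y :: t).length = L,
        ev M L [.perm addPerm] ⟨⟨q, r, z, x :: u ++ y :: t⟩, h⟩ =
        ⟨⟨(addPerm (q, x)).1, r, z, (addPerm (q, x)).2 :: u ++ y :: t⟩, by simpa using h⟩ :=
      fun _ _ => rfl
    rw [e, e, conj_rW_apply]

lemma exists_list_countP (b : ℕ → ℕ) (k n : ℕ) (hn : n < k) :
    ∃ J : List ℕ, J.length ≤ 2 * n ∧ (∀ j ∈ J, k - n ≤ j ∧ j < k) ∧
      ∀ L, k - n ≤ L → L < k → J.countP (L ∣ ·) % 3 = b L % 3 := by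
  induction n with
  | zero => exact ⟨[], by simp, by simp, fun L h1 h2 => by omega⟩
  | succ n ih =>
    obtain ⟨J, h1, h2, h3⟩ := ih (by omega)
    set p := k - (n + 1) with hp
    set e := (b p + 2 * J.countP (p ∣ ·)) % 3
    have he : e < 3 := Nat.mod_lt _ (by norm_num)
    refine ⟨List.replicate e p ++ J, by simp; omega, ?_, ?_⟩
    · intro j hj
      rcases List.mem_append.1 hj with h | h
      · rw [(List.mem_replicate.1 h).2]; omega
      · have := h2 j h; omega
    · intro L hL hLk
      rw [List.countP_append, List.countP_replicate]
      rcases hL.eq_or_lt with rfl | hlt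
      · simp [e]; omega
      · have : ¬ L ∣ p := fun hd => by
          have := Nat.le_of_dvd (by omega) hd; omega
        simpa [this] using h3 L (by omega) hLk

lemma ev_flatMap_dvdWord (hL : 0 < L) (J : List ℕ) :
    ev M L (J.flatMap dvdWord) = ev M L bW ^ J.countP (L ∣ ·) := by
  induction J with
  | nil => simp
  | cons j J ih =>
    rw [List.flatMap_cons, ev_append, ih, ev_dvdWord hL, List.countP_cons]
    by_cases h : L ∣ j <;> simp [h, pow_succ']

lemma exists_flag_word (b : ℕ → ℕ) (k : ℕ) (hk : 0 < k) :
    ∃ w : List Instr, w.length ≤ 8 * k ^ 2 ∧ ∀ M L, 0 < L →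
      ev M L w = if L < k then ev M L bW ^ b L else 1 := by
  obtain ⟨J, h1, h2, h3⟩ := exists_list_countP b k (k - 1) (by omega)
  refine ⟨J.flatMap dvdWord, ?_, fun M L hL => ?_⟩
  · have : ∀ x ∈ J.map fun j => (dvdWord j).length, x ≤ 4 * k := by
      simp only [List.mem_map, length_dvdWord]
      rintro _ ⟨j, hj, rfl⟩
      have := h2 j hj
      omega
    have h4 := List.sum_le_card_nsmul _ _ this
    rw [List.length_flatMap]
    refine h4.trans ?_
    rw [List.length_map, smul_eq_mul]
    calc J.length * (4 * k) ≤ (2 * k) * (4 * k) := Nat.mul_le_mul_right _ (by omega)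
      _ = 8 * k ^ 2 := by ring
  · rw [ev_flatMap_dvdWord hL]
    split_ifs with h
    · rw [pow_eq_pow_mod _ (ev_bW_pow_three hL), h3 L (by omega) h,
        ← pow_eq_pow_mod _ (ev_bW_pow_three hL)]
    · rw [List.countP_eq_zero.2, pow_zero]
      intro j hj hd
      have := h2 j hj
      have := Nat.le_of_dvd (by omega) (of_decide_eq_true hd)
      omega

lemma exists_flag_word_eq (j : ℕ) :
    ∃ w : List Instr, w.length ≤ 9 * (j + 2) ^ 2 ∧ ∀ M L, 0 < L →
      ev M L w = if L = j + 1 then ev M L bW else 1 := by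
  obtain ⟨w, hw, h⟩ := exists_flag_word (fun L => if L = j + 1 then 1 else 0) (j + 2) (by omega)
  refine ⟨w, by omega, fun M L hL => ?_⟩
  rw [h M L hL]
  split_ifs <;> first | simp | omega

lemma exists_flag_word_ge (k : ℕ) (hk : 0 < k) :
    ∃ w : List Instr, w.length ≤ 9 * k ^ 2 ∧ ∀ M L, 0 < L →
      ev M L w = if L < k then 1 else ev M L bW := by
  obtain ⟨w, hw, h⟩ := exists_flag_word (fun _ => 2) k hk
  refine ⟨bW ++ w, ?_, fun M L hL => ?_⟩
  · have : 0 < k ^ 2 := by positivity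
    simp [bW]; omega
  rw [ev_append, h M L hL]
  split_ifs
  · rw [← pow_succ', ev_bW_pow_three hL]
  · simp

/-! ### Short words for powers -/

lemma length_horner {τ : List Instr} {k : ℕ} (hτ : τ.length ≤ 9 * k ^ 2) (t i n : ℕ)
    (hi : i + t < k) :
    (horner τ t i n).length ≤ (3 * t + n / 3 ^ t) * (74 * k ^ 2) := by
  have hlift : ∀ (w : List Instr) (i : ℕ), i < k → (lift i w).length ≤ w.length * (7 * k) :=
    fun w i hi => (length_lift i w).trans (Nat.mul_le_mul_left _ (by omega))
  have hk : k ≤ k ^ 2 := Nat.le_self_pow (by norm_num) k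
  have hcomm : ∀ i, i < k → (wcomm (lift i aW) τ).length ≤ 74 * k ^ 2 := by
    intro i hi
    have := hlift aW i hi
    rw [length_wcomm]
    simp only [aW, List.length_cons, List.length_nil] at this ⊢
    omega
  induction t generalizing i n with
  | zero =>
    simp only [horner, length_wpow, mul_zero, zero_add, pow_zero, Nat.div_one]
    exact Nat.mul_le_mul_left _ (hcomm i (by omega))
  | succ t ih =>
    simp only [horner, List.length_append, length_wpow, length_winv]
    have h1 := ih (i + 1) (n / 3) (by omega)
    have h2 := hcomm i (by omega)
    have h3 := hlift eW i (by omega)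
    have h4 : n % 3 * (wcomm (lift i aW) τ).length ≤ 2 * (74 * k ^ 2) :=
      Nat.mul_le_mul (by omega) h2
    rw [Nat.div_div_eq_div_mul, ← pow_succ'] at h1
    simp only [eW, List.length_cons, List.length_nil] at h3 ⊢
    have e : (3 * (t + 1) + n / 3 ^ (t + 1)) * (74 * k ^ 2) =
      (3 * t + n / 3 ^ (t + 1)) * (74 * k ^ 2) + 3 * (74 * k ^ 2) := by ring
    omega

/-- The distorted word. -/
def gW : List Instr := wcomm (lift 0 aW) bW

lemma exists_word_pow_of_le (n m : ℕ) :
    ∃ w : List Instr, w.length ≤ m * (666 * (m + 1) ^ 3) ∧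
      ∀ L, 0 < L → ev L L w = if L ≤ m then ev L L gW ^ n else 1 := by
  induction m with
  | zero => exact ⟨[], by simp, fun L hL => by simp [hL.ne']⟩
  | succ m ih =>
    obtain ⟨w, hw, h⟩ := ih
    obtain ⟨τ, hτ, hτ'⟩ := exists_flag_word_eq m
    refine ⟨w ++ horner τ m 0 (n % (6 * (m + 1) * 3 ^ m)), ?_, fun L hL => ?_⟩
    · have h1 := length_horner hτ m 0 (n % (6 * (m + 1) * 3 ^ m)) (by omega)
      have h2 : n % (6 * (m + 1) * 3 ^ m) / 3 ^ m < 6 * (m + 1) :=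
        Nat.div_lt_of_lt_mul (by rw [mul_comm (3 ^ m)]; exact Nat.mod_lt _ (by positivity))
      rw [List.length_append]
      calc _ ≤ m * (666 * (m + 1) ^ 3) + (9 * (m + 2)) * (74 * (m + 2) ^ 2) :=
            Nat.add_le_add hw (h1.trans (Nat.mul_le_mul_right _ (by omega)))
        _ ≤ m * (666 * (m + 2) ^ 3) + 666 * (m + 2) ^ 3 :=
            Nat.add_le_add (by gcongr; omega) (le_of_eq (by ring))
        _ = _ := by ring
    · rw [ev_append, h L hL]
      by_cases hm : L = m + 1
      · subst hm
        rw [ev_horner (by simp [hτ']) _ _ _ (by omega), if_neg (by omega), one_mul,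
          if_pos le_rfl, ← pow_eq_pow_mod _ (commutator_pow_order m), gW, ev_wcomm]
      · rw [ev_horner_of_trivial (by simp [hτ' L L hL, hm]), mul_one]
        congr 1
        exact propext (by omega)

/-- Powers of the distorted word are represented by words of polylogarithmic length. -/
theorem exists_short_word {n : ℕ} (hn : 2 ≤ n) :
    ∃ w : List Instr, w.length ≤ 14208 * Nat.log 2 n ^ 4 ∧
      ∀ L, 0 < L → ev L L w = ev L L gW ^ n := by
  set m := Nat.log 2 n
  have hm : 1 ≤ m := Nat.log_pos (by norm_num) hn
  obtain ⟨w, hw, h⟩ := exists_word_pow_of_le n m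
  obtain ⟨τ, hτ, hτ'⟩ := exists_flag_word_ge (m + 1) (by omega)
  refine ⟨w ++ horner τ m 0 n, ?_, fun L hL => ?_⟩
  · have h1 := length_horner hτ m 0 n (by omega)
    have h2 : n / 3 ^ m < 3 := by
      apply Nat.div_lt_of_lt_mul
      rw [← pow_succ]
      exact (Nat.lt_pow_succ_log_self (by norm_num) n).trans_le
        (Nat.pow_le_pow_left (by norm_num) _)
    rw [List.length_append]
    calc _ ≤ m * (666 * (m + 1) ^ 3) + (3 * (m + 1)) * (74 * (m + 1) ^ 2) :=
          Nat.add_le_add hw (h1.trans (Nat.mul_le_mul_right _ (by omega)))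
      _ ≤ (m + 1) * (666 * (m + 1) ^ 3) + (m + 1) * (222 * (m + 1) ^ 3) := by
          refine Nat.add_le_add (Nat.mul_le_mul_right _ (by omega)) ?_
          have : (m + 1) ^ 3 ≤ (m + 1) * (m + 1) ^ 3 := Nat.le_mul_of_pos_left _ (by omega)
          nlinarith
      _ = 888 * (m + 1) ^ 4 := by ring
      _ ≤ 888 * (2 * m) ^ 4 := by gcongr; omega
      _ = _ := by ring
  · rw [ev_append, h L hL]
    by_cases hm : L ≤ m
    · rw [if_pos hm, ev_horner_of_trivial (by simp [hτ' L L hL]; omega), mul_one]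
    · rw [if_neg hm, one_mul, ev_horner (by simp [hτ' L L hL]; omega) _ _ _ (by omega), gW,
        ev_wcomm]

/-- The distorted word has infinite order on tapes of even length. -/
theorem exists_gW_pow_ne_one {n : ℕ} (hn : n ≠ 0) :
    ∃ l, 1 ≤ l ∧ ev (2 * l) (2 * l) gW ^ n ≠ 1 := by
  obtain ⟨l, hl, h⟩ := exists_commutator_pow_ne_one hn
  exact ⟨l, hl, by rw [gW, ev_wcomm]; exact h _⟩

/-! ### Conveyor belts -/

/-- The type of a cell of a conveyor belt: it points to the head, or holds the head on its
upper or lower track. -/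
inductive Ty
  | right
  | left
  | head (up : Bool) (q : St) (r : Sym)

/-- A cell: its type, and the symbols on its upper and lower tracks. -/
abbrev Cell := Ty × Sym × Sym

/-- Local rules on conveyor belts. -/
inductive Rule
  | perm (π : Perm (St × Sym))
  | swp (f : St → Bool)
  | flip (f : St → Bool)
  | hop (f : St → Bool)

/-- The inverse rule. -/
def Rule.inv : Rule → Rule
  | .perm π => .perm π⁻¹
  | ρ => ρ

/-- The rules implementing an instruction. -/
def Instr.rules : Instr → List Rule
  | .perm π => [.perm π]
  | .swp f => [.swp f]
  | .rot f => [.flip f, .hop f]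
  | .unrot f => [.hop f, .flip f]

/-- Let a head on the upper track hop to the right and onto the lower track, and vice versa. -/
def hopTy (f : St → Bool) (a : Option Ty) (b : Ty) (c : Option Ty) : Ty :=
  match b with
  | .head true q _ => match c with
    | some .left => bif f q then .right else b
    | _ => b
  | .head false q _ => match a with
    | some .right => bif f q then .left else b
    | _ => b
  | .left => match a with
    | some (.head true q r) => bif f q then .head false q r else b
    | _ => b
  | .right => match c with
    | some (.head false q r) => bif f q then .head true q r else b
    | _ => b

/-- The effect of a rule on a cell with neighbours of given types. -/
def cellStep (a c : Option Ty) : Rule → Cell → Cell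
  | .perm π, (.head true q r, u, w) => (.head true (π (q, u)).1 r, (π (q, u)).2, w)
  | .perm π, (.head false q r, u, w) => (.head false (π (q, w)).1 r, u, (π (q, w)).2)
  | .swp f, (.head true q r, u, w) =>
      bif f q then (.head true q u, r, w) else (.head true q r, u, w)
  | .swp f, (.head false q r, u, w) =>
      bif f q then (.head false q w, u, r) else (.head false q r, u, w)
  | .flip f, (.head up q r, u, w) => (.head (up ^^ f q) q r, u, w)
  | .hop f, (t, u, w) => (hopTy f a t c, u, w)
  | _, b => b

/-- The effect of a rule on a belt, where neighbours are at distance `N`. -/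
def yStep (N : ℤ) (ρ : Rule) (y : ℤ → Option Cell) (s : ℤ) : Option Cell :=
  (y s).map (cellStep ((y (s - N)).map Prod.fst) ((y (s + N)).map Prod.fst) ρ)

/-- Running a word of rules, the last one first. -/
def yRun (N : ℤ) (u : List Rule) (y : ℤ → Option Cell) : ℤ → Option Cell := u.foldr (yStep N) y

@[simp] lemma yRun_nil (N : ℤ) (y) : yRun N [] y = y := rfl
@[simp] lemma yRun_cons (N : ℤ) (ρ u y) : yRun N (ρ :: u) y = yStep N ρ (yRun N u y) := rfl
lemma yRun_append (N : ℤ) (u v y) : yRun N (u ++ v) y = yRun N u (yRun N v y) := by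
  simp [yRun]

@[simp] lemma isSome_yStep (N : ℤ) (ρ y s) : (yStep N ρ y s).isSome = (y s).isSome := by
  simp [yStep]

lemma hopTy_hopTy (f : St → Bool) (a₀ a : Option Ty) (b : Ty) (c c₀ : Option Ty) :
    hopTy f (a.map fun t => hopTy f a₀ t (some b)) (hopTy f a b c)
      (c.map fun t => hopTy f (some b) t c₀) = b := by
  rcases b with _ | _ | ⟨_ | _, q, r⟩
  · rcases c with _ | _ | _ | ⟨_ | _, q, r⟩
    · simp [hopTy]
    · rcases c₀ with _ | _ | _ | ⟨_ | _, q', r'⟩ <;> simp [hopTy]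
      cases h : f q' <;> simp
    · simp [hopTy]
    · cases h : f q <;> simp [hopTy, h]
    · rcases c₀ with _ | _ | _ | ⟨_ | _, q', r'⟩ <;> cases h : f q <;> simp [hopTy, h]
  · rcases a with _ | _ | _ | ⟨_ | _, q, r⟩
    · simp [hopTy]
    · simp [hopTy]
    · rcases a₀ with _ | _ | _ | ⟨_ | _, q', r'⟩ <;> simp [hopTy]
      cases h : f q' <;> simp
    · rcases a₀ with _ | _ | _ | ⟨_ | _, q', r'⟩ <;> cases h : f q <;> simp [hopTy, h]
    · cases h : f q <;> simp [hopTy, h]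
  · rcases a with _ | _ | _ | ⟨_ | _, q', r'⟩
    · simp [hopTy]
    · cases h : f q <;> simp [hopTy, h]
    · rcases a₀ with _ | _ | _ | ⟨_ | _, q', r'⟩ <;> simp [hopTy]
      cases h : f q' <;> simp
    · rcases a₀ with _ | _ | _ | ⟨_ | _, q', r'⟩ <;> simp [hopTy]
      all_goals cases h : f q' <;> simp
    · simp [hopTy]
  · rcases c with _ | _ | _ | ⟨_ | _, q', r'⟩
    · simp [hopTy]
    · rcases c₀ with _ | _ | _ | ⟨_ | _, q', r'⟩ <;> simp [hopTy]
      cases h : f q' <;> simp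
    · cases h : f q <;> simp [hopTy, h]
    · simp [hopTy]
    · rcases c₀ with _ | _ | _ | ⟨_ | _, q', r'⟩ <;> simp [hopTy]
      all_goals cases h : f q' <;> simp

lemma yStep_inv_yStep (N : ℤ) (ρ : Rule) (y : ℤ → Option Cell) :
    yStep N ρ.inv (yStep N ρ y) = y := by
  funext s
  cases hs : y s with
  | none => simp [yStep, hs]
  | some b =>
    obtain ⟨t, u, w⟩ := b
    cases ρ with
    | perm π => rcases t with _ | _ | ⟨_ | _, q, r⟩ <;> simp [yStep, hs, Rule.inv, cellStep]
    | swp f =>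
      rcases t with _ | _ | ⟨_ | _, q, r⟩ <;> simp [yStep, hs, Rule.inv, cellStep] <;>
        cases h : f q <;> simp [h]
    | flip f => rcases t with _ | _ | ⟨_ | _, q, r⟩ <;> simp [yStep, hs, Rule.inv, cellStep]
    | hop f =>
      simp only [yStep, hs, Rule.inv, Option.map_some, Option.map_map, sub_add_cancel,
        add_sub_cancel_right, Option.some.injEq, cellStep, Prod.mk.injEq, and_true]
      simpa [Option.map_map, Function.comp_def, cellStep] using
        hopTy_hopTy f ((y (s - N - N)).map Prod.fst) ((y (s - N)).map Prod.fst) t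
        ((y (s + N)).map Prod.fst) ((y (s + N + N)).map Prod.fst)

lemma yRun_arith (N : ℤ) (u : List Rule) (y : ℤ → Option Cell) (m k : ℤ) :
    yRun N u y (m + N * k) = yRun 1 u (fun k => y (m + N * k)) k := by
  induction u generalizing k with
  | nil => rfl
  | cons ρ u ih =>
    simp only [yRun_cons, yStep]
    rw [← ih, ← ih, ← ih]
    congr 3 <;> ring_nf

lemma yRun_congr (u : List Rule) {y y' : ℤ → Option Cell} {s : ℤ}
    (h : ∀ t, |t - s| ≤ u.length → y t = y' t) : yRun 1 u y s = yRun 1 u y' s := by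
  induction u generalizing s with
  | nil => exact h s (by simp)
  | cons ρ u ih =>
    simp only [yRun_cons, yStep]
    have key : ∀ s', |s' - s| ≤ 1 → yRun 1 u y s' = yRun 1 u y' s' := fun s' hs =>
      ih fun t ht => h t <| by
        simp only [List.length_cons, Nat.cast_add, Nat.cast_one]
        rw [abs_le] at *
        omega
    rw [key s (by simp), key (s - 1) (by simp), key (s + 1) (by simp)]

/-! ### Cyclic tapes as functions -/

/-- The cyclic tape of length `L` with contents `S`, read off from `z`. -/
def tapeList (L : ℕ) (S : ℕ → Sym) (z : ℕ) : List Sym :=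
  (List.range L).map fun k => S ((z + k) % L)

/-- The configuration with head at `z` on the cyclic tape with contents `S`. -/
def mkCfg (L : ℕ) (q : St) (r : Sym) (z : ℕ) (S : ℕ → Sym) : Cfg L :=
  ⟨q, r, z, tapeList L S z⟩

@[simp] lemma length_tapeList (L : ℕ) (S : ℕ → Sym) (z : ℕ) : (tapeList L S z).length = L := by
  simp [tapeList]

lemma tapeList_eq_cons {S : ℕ → Sym} {z : ℕ} (hz : z < L) :
    tapeList L S z = S z :: (List.range (L - 1)).map fun k => S ((z + (k + 1)) % L) := by
  obtain ⟨n, rfl⟩ : ∃ n, L = n + 1 := ⟨L - 1, by omega⟩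
  simp [tapeList, List.range_succ_eq_map, Nat.mod_eq_of_lt hz]

lemma tapeList_update {S : ℕ → Sym} {z : ℕ} (hz : z < L) (a : Sym) :
    tapeList L (Function.update S z a) z =
      a :: (List.range (L - 1)).map fun k => S ((z + (k + 1)) % L) := by
  rw [tapeList_eq_cons hz, Function.update_self]
  congr 1
  refine List.map_congr_left fun k hk => Function.update_of_ne ?_ _ _
  rw [List.mem_range] at hk
  by_cases h : z + (k + 1) < L
  · rw [Nat.mod_eq_of_lt h]; omega
  · rw [Nat.mod_eq_sub_mod (by omega), Nat.mod_eq_of_lt (by omega)]; omega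

lemma rotl_tapeList {S : ℕ → Sym} {z : ℕ} (hz : z < L) :
    rotl (tapeList L S z) = tapeList L S ((z + 1) % L) := by
  rw [tapeList_eq_cons hz, rotl_cons, tapeList]
  obtain ⟨n, rfl⟩ : ∃ n, L = n + 1 := ⟨L - 1, by omega⟩
  rw [List.range_succ, List.map_append]
  congr 1
  · refine List.map_congr_left fun k _ => ?_
    rw [Nat.mod_add_mod]; congr 2; ring
  · have : (z + 1 + n) % (n + 1) = z := by
      rw [show z + 1 + n = z + (n + 1) by ring, Nat.add_mod_right, Nat.mod_eq_of_lt hz]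
    simp [this]

lemma step_perm_mkCfg {z : ℕ} (hz : z < L) (π : Perm (St × Sym)) (q r S) :
    step (.perm π) (mkCfg L q r z S) =
      mkCfg L (π (q, S z)).1 r z (Function.update S z (π (q, S z)).2) := by
  simp only [mkCfg, tapeList_update hz, tapeList_eq_cons (S := S) hz, step_perm]

lemma step_swp_mkCfg {z : ℕ} (hz : z < L) (f : St → Bool) (q r S) :
    step (.swp f) (mkCfg L q r z S) =
      bif f q then mkCfg L q (S z) z (Function.update S z r) else mkCfg L q r z S := by
  simp only [mkCfg, tapeList_update hz, tapeList_eq_cons (S := S) hz, step_swp]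

lemma step_rot_mkCfg {z : ℕ} (hz : z < L) (f : St → Bool) (q r S) :
    step (.rot f) (mkCfg L q r z S) = mkCfg L q r (bif f q then (z + 1) % L else z) S := by
  cases h : f q <;> simp [mkCfg, h, rotl_tapeList hz]

lemma step_unrot_mkCfg {z : ℕ} (hz : z < L) (f : St → Bool) (q r S) :
    step (.unrot f) (mkCfg L q r z S) =
      mkCfg L q r (bif f q then (z + (L - 1)) % L else z) S := by
  have h1 : ((z + (L - 1)) % L + 1) % L = z := by
    rw [Nat.mod_add_mod, show z + (L - 1) + 1 = z + L by omega, Nat.add_mod_right,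
      Nat.mod_eq_of_lt hz]
  have h2 := rotl_tapeList (L := L) (S := S) (z := (z + (L - 1)) % L) (Nat.mod_lt _ (by omega))
  rw [h1] at h2
  have h3 : (z : ZMod L) - 1 = ((z + (L - 1) : ℕ) : ZMod L) := by
    rw [Nat.cast_add, Nat.cast_sub (by omega)]; simp [sub_eq_add_neg]
  cases h : f q <;> simp [mkCfg, h]
  refine ⟨by simpa using h3, ?_⟩
  rw [← h2, unrotl_rotl]

lemma exists_eq_mkCfg (c : Cfg L) (hc : c.l.length = L) (hL : 0 < L) :
    ∃ z < L, ∃ S, c = mkCfg L c.q c.r z S := by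
  have : NeZero L := ⟨hL.ne'⟩
  obtain ⟨q, r, z, l⟩ := c
  simp only at hc
  refine ⟨z.val, z.val_lt, fun i => l.getD ((i + L - z.val) % L) 0, ?_⟩
  have hz := z.val_lt
  simp only [mkCfg, ZMod.natCast_val, ZMod.cast_id', id_eq, Cfg.mk.injEq, true_and]
  refine List.ext_getElem (by simp [hc]) fun k h1 h2 => ?_
  have hk : k < L := hc ▸ h1
  simp only [tapeList, List.getElem_map, List.getElem_range]
  have : ((z.val + k) % L + L - z.val) % L = k := by
    by_cases h : z.val + k < L
    · rw [Nat.mod_eq_of_lt h, show z.val + k + L - z.val = k + L by omega, Nat.add_mod_right,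
        Nat.mod_eq_of_lt hk]
    · rw [Nat.mod_eq_sub_mod (a := z.val + k) (by omega),
        Nat.mod_eq_of_lt (a := z.val + k - L) (by omega),
        show z.val + k - L + L - z.val = k by omega, Nat.mod_eq_of_lt hk]
  rw [this, List.getD_eq_getElem _ _ h1]

lemma mkCfg_inj {q q' : St} {r r' : Sym} {z z' : ℕ} {S S' : ℕ → Sym} (hz : z < L) (hz' : z' < L)
    (h : mkCfg L q r z S = mkCfg L q' r' z' S') :
    q = q' ∧ r = r' ∧ z = z' ∧ ∀ i < L, S i = S' i := by
  simp only [mkCfg, Cfg.mk.injEq] at h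
  obtain ⟨h1, h2, h3, h4⟩ := h
  rw [ZMod.natCast_eq_natCast_iff', Nat.mod_eq_of_lt hz, Nat.mod_eq_of_lt hz'] at h3
  subst h3
  refine ⟨h1, h2, rfl, fun i hi => ?_⟩
  have hk : (i + L - z) % L < L := Nat.mod_lt _ (by omega)
  have := List.map_inj_left.1 h4 _ (List.mem_range.2 hk)
  have e : (z + (i + L - z) % L) % L = i := by
    rw [Nat.add_mod_mod, show z + (i + L - z) = i + L by omega, Nat.add_mod_right,
      Nat.mod_eq_of_lt hi]
  simpa [e] using this

lemma mkCfg_congr {q : St} {r : Sym} {z : ℕ} {S S' : ℕ → Sym} (hL : 0 < L)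
    (h : ∀ i < L, S i = S' i) : mkCfg L q r z S = mkCfg L q r z S' := by
  simp only [mkCfg, Cfg.mk.injEq, true_and]
  exact List.map_congr_left fun k _ => h _ (Nat.mod_lt _ hL)

/-! ### Zones of a conveyor belt -/

/-- The types of the cells of a zone with head in cell `h`. -/
def zoneTy (h : ℕ) (up : Bool) (q : St) (r : Sym) (j : ℕ) : Ty :=
  if j < h then .right else if j = h then .head up q r else .left

/-- The position of the head on the cyclic tape formed by both tracks of a zone. -/
def site (n h : ℕ) (up : Bool) : ℕ := bif up then h else 2 * n - 1 - h

/-- The belt `y` has a zone of `n` cells starting at `a` with head in cell `h`; its tracks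
form a cyclic tape with contents `S`. -/
structure Zone (y : ℤ → Option Cell) (a : ℤ) (n h : ℕ) (up : Bool) (q : St) (r : Sym)
    (S : ℕ → Sym) : Prop where
  lt : h < n
  cells : ∀ j < n, y (a + j) = some (zoneTy h up q r j, S j, S (2 * n - 1 - j))
  lo : (y (a - 1)).map Prod.fst ≠ some .right
  hi : (y (a + n)).map Prod.fst ≠ some .left

lemma site_lt {n h : ℕ} (hh : h < n) (up : Bool) : site n h up < 2 * n := by
  cases up <;> simp [site] <;> omega

lemma site_inj {n h h' : ℕ} {up up' : Bool} (hh : h < n) (hh' : h' < n)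
    (e : site n h up = site n h' up') : h = h' ∧ up = up' := by
  cases up <;> cases up' <;> simp [site] at e ⊢ <;> omega

lemma exists_site {n z : ℕ} (hz : z < 2 * n) : ∃ h < n, ∃ up, site n h up = z := by
  by_cases h : z < n
  · exact ⟨z, h, true, rfl⟩
  · exact ⟨2 * n - 1 - z, by omega, false, by simp [site]; omega⟩

lemma fst_cellStep_ne_right {a c : Option Ty} (hc : c ≠ some .left) (ρ : Rule) {b : Cell}
    (hb : b.1 ≠ .right) : (cellStep a c ρ b).1 ≠ .right := by
  obtain ⟨t, u, w⟩ := b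
  cases ρ with
  | perm π => rcases t with _ | _ | ⟨_ | _, q, r⟩ <;> simp_all [cellStep]
  | swp f =>
    rcases t with _ | _ | ⟨_ | _, q, r⟩ <;> simp_all [cellStep] <;> cases f q <;> simp
  | flip f => rcases t with _ | _ | ⟨_ | _, q, r⟩ <;> simp_all [cellStep]
  | hop f =>
    rcases t with _ | _ | ⟨_ | _, q, r⟩
    · simp_all
    · rcases a with _ | _ | _ | ⟨_ | _, q, r⟩ <;> simp_all [cellStep, hopTy]
      cases f q <;> simp
    · rcases a with _ | _ | _ | ⟨_ | _, q', r'⟩ <;> simp_all [cellStep, hopTy]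
      cases f q <;> simp
    · rcases c with _ | _ | _ | ⟨_ | _, q', r'⟩ <;> simp_all [cellStep, hopTy]

lemma fst_cellStep_ne_left {a c : Option Ty} (ha : a ≠ some .right) (ρ : Rule) {b : Cell}
    (hb : b.1 ≠ .left) : (cellStep a c ρ b).1 ≠ .left := by
  obtain ⟨t, u, w⟩ := b
  cases ρ with
  | perm π => rcases t with _ | _ | ⟨_ | _, q, r⟩ <;> simp_all [cellStep]
  | swp f =>
    rcases t with _ | _ | ⟨_ | _, q, r⟩ <;> simp_all [cellStep] <;> cases f q <;> simp
  | flip f => rcases t with _ | _ | ⟨_ | _, q, r⟩ <;> simp_all [cellStep]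
  | hop f =>
    rcases t with _ | _ | ⟨_ | _, q, r⟩
    · rcases c with _ | _ | _ | ⟨_ | _, q, r⟩ <;> simp_all [cellStep, hopTy]
      cases f q <;> simp
    · simp_all
    · rcases a with _ | _ | _ | ⟨_ | _, q', r'⟩ <;> simp_all [cellStep, hopTy]
    · rcases c with _ | _ | _ | ⟨_ | _, q', r'⟩ <;> simp_all [cellStep, hopTy]
      cases f q <;> simp

namespace Zone
variable {y : ℤ → Option Cell} {a : ℤ} {n h : ℕ} {up : Bool} {q : St} {r : Sym} {S : ℕ → Sym}

lemma step_lo (Z : Zone y a n h up q r S) (ρ : Rule) :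
    (yStep 1 ρ y (a - 1)).map Prod.fst ≠ some .right := by
  have h0 := Z.cells 0 (by have := Z.lt; omega)
  have hlo := Z.lo
  simp only [Nat.cast_zero, add_zero] at h0
  cases hy : y (a - 1) with
  | none => simp [yStep, hy]
  | some b =>
    simp only [yStep, hy, sub_add_cancel, h0, Option.map_some, ne_eq, Option.some.injEq]
    rw [hy] at hlo
    refine fst_cellStep_ne_right ?_ ρ (by simpa using hlo)
    simp only [zoneTy, ne_eq, Option.some.injEq]
    split_ifs <;> first | omega | simp

lemma step_hi (Z : Zone y a n h up q r S) (ρ : Rule) :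
    (yStep 1 ρ y (a + n)).map Prod.fst ≠ some .left := by
  have hlt := Z.lt
  have h0 := Z.cells (n - 1) (by omega)
  have hhi := Z.hi
  rw [show a + ((n - 1 : ℕ) : ℤ) = a + n - 1 by omega] at h0
  cases hy : y (a + n) with
  | none => simp [yStep, hy]
  | some b =>
    simp only [yStep, hy, h0, Option.map_some, ne_eq, Option.some.injEq]
    rw [hy] at hhi
    refine fst_cellStep_ne_left ?_ ρ (by simpa using hhi)
    simp only [zoneTy, ne_eq, Option.some.injEq]
    split_ifs <;> first | omega | simp

lemma of_cells (Z : Zone y a n h up q r S) (ρ : Rule) {h' : ℕ} {up' : Bool} {q' : St} {r' : Sym}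
    {S' : ℕ → Sym} (hlt : h' < n)
    (hc : ∀ j < n, cellStep ((y (a + j - 1)).map Prod.fst) ((y (a + j + 1)).map Prod.fst) ρ
      (zoneTy h up q r j, S j, S (2 * n - 1 - j)) =
        (zoneTy h' up' q' r' j, S' j, S' (2 * n - 1 - j))) :
    Zone (yStep 1 ρ y) a n h' up' q' r' S' :=
  ⟨hlt, fun j hj => by rw [yStep, Z.cells j hj, Option.map_some, hc j hj], Z.step_lo ρ,
    Z.step_hi ρ⟩

lemma perm (Z : Zone y a n h up q r S) (π : Perm (St × Sym)) :
    Zone (yStep 1 (.perm π) y) a n h up (π (q, S (site n h up))).1 r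
      (Function.update S (site n h up) (π (q, S (site n h up))).2) := by
  refine Z.of_cells _ Z.lt fun j hj => ?_
  have := Z.lt
  have e1 : up = true → j ≠ h → j ≠ site n h up := by rintro rfl; simp [site]
  have e2 : up = true → 2 * n - 1 - j ≠ site n h up := by rintro rfl; simp [site]; omega
  have e3 : up = false → j ≠ site n h up := by rintro rfl; simp [site]; omega
  have e4 : up = false → j ≠ h → 2 * n - 1 - j ≠ site n h up := by
    rintro rfl; simp [site]; omega
  rcases lt_trichotomy j h with hjh | rfl | hjh
  · cases up <;> simp_all [zoneTy, cellStep, hjh.ne]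
  · cases up <;> simp_all [zoneTy, cellStep, site]
  · cases up <;> simp_all [zoneTy, cellStep, hjh.ne', hjh.not_gt]

lemma swp (Z : Zone y a n h up q r S) {f : St → Bool} (hf : f q = true) :
    Zone (yStep 1 (.swp f) y) a n h up q (S (site n h up))
      (Function.update S (site n h up) r) := by
  refine Z.of_cells _ Z.lt fun j hj => ?_
  have := Z.lt
  have e1 : up = true → j ≠ h → j ≠ site n h up := by rintro rfl; simp [site]
  have e2 : up = true → 2 * n - 1 - j ≠ site n h up := by rintro rfl; simp [site]; omega
  have e3 : up = false → j ≠ site n h up := by rintro rfl; simp [site]; omega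
  have e4 : up = false → j ≠ h → 2 * n - 1 - j ≠ site n h up := by
    rintro rfl; simp [site]; omega
  rcases lt_trichotomy j h with hjh | rfl | hjh
  · cases up <;> simp_all [zoneTy, cellStep, hjh.ne]
  · cases up <;> simp_all [zoneTy, cellStep, site]
  · cases up <;> simp_all [zoneTy, cellStep, hjh.ne', hjh.not_gt]

lemma swp_of_not (Z : Zone y a n h up q r S) {f : St → Bool} (hf : f q = false) :
    Zone (yStep 1 (.swp f) y) a n h up q r S := by
  refine Z.of_cells _ Z.lt fun j hj => ?_
  rcases lt_trichotomy j h with hjh | rfl | hjh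
  · cases up <;> simp_all [zoneTy, cellStep]
  · cases up <;> simp_all [zoneTy, cellStep]
  · cases up <;> simp_all [zoneTy, cellStep, hjh.ne', hjh.not_gt]

lemma flip (Z : Zone y a n h up q r S) (f : St → Bool) :
    Zone (yStep 1 (.flip f) y) a n h (up ^^ f q) q r S := by
  refine Z.of_cells _ Z.lt fun j hj => ?_
  rcases lt_trichotomy j h with hjh | rfl | hjh
  · simp_all [zoneTy, cellStep]
  · simp_all [zoneTy, cellStep]
  · simp_all [zoneTy, cellStep, hjh.ne', hjh.not_gt]

lemma fst_pred (Z : Zone y a n h up q r S) {j : ℕ} (hj : j < n) (h0 : 0 < j) :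
    (y (a + j - 1)).map Prod.fst = some (zoneTy h up q r (j - 1)) := by
  rw [show a + (j : ℤ) - 1 = a + ((j - 1 : ℕ) : ℤ) by omega, Z.cells _ (by omega)]; rfl

lemma fst_succ (Z : Zone y a n h up q r S) {j : ℕ} (hj : j + 1 < n) :
    (y (a + j + 1)).map Prod.fst = some (zoneTy h up q r (j + 1)) := by
  rw [show a + (j : ℤ) + 1 = a + ((j + 1 : ℕ) : ℤ) by omega, Z.cells _ hj]; rfl

lemma hop_of_not (Z : Zone y a n h up q r S) {f : St → Bool} (hf : f q = false) :
    Zone (yStep 1 (.hop f) y) a n h up q r S := by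
  refine Z.of_cells _ Z.lt fun j hj => ?_
  have := Z.lt
  simp only [cellStep, Prod.mk.injEq, and_true]
  rcases lt_trichotomy j h with hjh | rfl | hjh
  · rw [Z.fst_succ (by omega)]
    simp only [zoneTy, hjh, if_true, hopTy]
    split_ifs <;> cases up <;> simp [hf]
  · simp only [zoneTy, lt_irrefl, if_true, if_false]
    cases up <;> simp [hopTy, hf] <;> split <;> rfl
  · rw [Z.fst_pred hj (by omega)]
    simp only [zoneTy, hjh.ne', hjh.not_gt, if_false, hopTy]
    split_ifs <;> cases up <;> simp [hf]

lemma hop_up (Z : Zone y a n h true q r S) {f : St → Bool} (hf : f q = true) (hn : h + 1 < n) :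
    Zone (yStep 1 (.hop f) y) a n (h + 1) false q r S := by
  refine Z.of_cells _ hn fun j hj => ?_
  simp only [cellStep, Prod.mk.injEq, and_true]
  rcases lt_trichotomy j h with hjh | rfl | hjh
  · rw [Z.fst_succ (by omega)]
    have : j < h + 1 := by omega
    simp only [zoneTy, hjh, this, if_true, hopTy]
    split_ifs <;> simp
  · rw [Z.fst_succ hn]
    simp [zoneTy, hopTy, hf]
  · rw [Z.fst_pred hj (by omega)]
    have e : ¬ j < h + 1 := by omega
    have e' : ¬ j - 1 < h := by omega
    simp only [zoneTy, hjh.ne', hjh.not_gt, if_false, hopTy, e, e']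
    by_cases e'' : j = h + 1
    · subst e''; simp [hf]
    · rw [if_neg (by omega), if_neg e'']

lemma hop_down (Z : Zone y a n h false q r S) {f : St → Bool} (hf : f q = true) (hn : 0 < h) :
    Zone (yStep 1 (.hop f) y) a n (h - 1) true q r S := by
  have hlt := Z.lt
  refine Z.of_cells _ (by omega) fun j hj => ?_
  simp only [cellStep, Prod.mk.injEq, and_true]
  rcases lt_trichotomy j h with hjh | rfl | hjh
  · rw [Z.fst_succ (by omega)]
    simp only [zoneTy, hjh, if_true, hopTy]
    by_cases e : j = h - 1
    · subst e; rw [Nat.sub_add_cancel hn]; simp [hf]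
    · rw [if_pos (by omega), if_pos (by omega)]
  · rw [Z.fst_pred hj hn]
    have e : ¬ j < j - 1 := by omega
    have e' : ¬ j = j - 1 := by omega
    have e'' : j - 1 < j := by omega
    simp [zoneTy, hopTy, hf, e, e', e'']
  · rw [Z.fst_pred hj (by omega)]
    have e : ¬ j < h - 1 := by omega
    have e' : ¬ j = h - 1 := by omega
    have e'' : ¬ j - 1 < h := by omega
    simp only [zoneTy, hjh.ne', hjh.not_gt, if_false, hopTy, e, e', e'']
    split_ifs <;> simp

lemma hop_up_last (Z : Zone y a n h true q r S) (f : St → Bool) (hn : h + 1 = n) :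
    Zone (yStep 1 (.hop f) y) a n h true q r S := by
  refine Z.of_cells _ Z.lt fun j hj => ?_
  simp only [cellStep, Prod.mk.injEq, and_true]
  rcases lt_trichotomy j h with hjh | rfl | hjh
  · rw [Z.fst_succ (by omega)]
    simp only [zoneTy, hjh, if_true, hopTy]
    split_ifs <;> simp
  · have hhi := Z.hi
    rw [← hn, Nat.cast_add, Nat.cast_one, ← add_assoc] at hhi
    simp only [zoneTy, lt_irrefl, if_true, if_false, hopTy]
  · omega

lemma hop_down_first (Z : Zone y a n h false q r S) (f : St → Bool) (hn : h = 0) :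
    Zone (yStep 1 (.hop f) y) a n h false q r S := by
  refine Z.of_cells _ Z.lt fun j hj => ?_
  subst hn
  simp only [cellStep, Prod.mk.injEq, and_true]
  rcases Nat.eq_zero_or_pos j with rfl | hjh
  · have hlo := Z.lo
    simp only [zoneTy, lt_irrefl, if_true, if_false, hopTy, Nat.cast_zero, add_zero]
  · rw [Z.fst_pred hj (by omega)]
    simp only [zoneTy, hjh.ne', hjh.not_gt, if_false, hopTy]
    split_ifs <;> simp_all

/-- One instruction on a zone acts as on its cyclic tape. -/
lemma exists_instr (Z : Zone y a n h up q r S) (i : Instr) :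
    ∃ h' up' q' r' S', Zone (yRun 1 i.rules y) a n h' up' q' r' S' ∧
      step i (mkCfg (2 * n) q r (site n h up) S) = mkCfg (2 * n) q' r' (site n h' up') S' := by
  have hs := site_lt Z.lt up
  have hlt := Z.lt
  cases i with
  | perm π => exact ⟨_, _, _, _, _, Z.perm π, step_perm_mkCfg hs π q r S⟩
  | swp f =>
    cases hf : f q
    · exact ⟨_, _, _, _, _, Z.swp_of_not hf, by rw [step_swp_mkCfg hs, hf, cond_false]⟩
    · exact ⟨_, _, _, _, _, Z.swp hf, by rw [step_swp_mkCfg hs, hf, cond_true]⟩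
  | rot f =>
    simp only [step_rot_mkCfg hs, Instr.rules, yRun_cons, yRun_nil]
    cases hf : f q
    · exact ⟨_, _, _, _, _, (Z.hop_of_not hf).flip f, by simp [hf]⟩
    cases up
    · rcases Nat.eq_zero_or_pos h with h0 | h0
      · refine ⟨_, _, _, _, _, (Z.hop_down_first f h0).flip f, ?_⟩
        congr 1
        subst h0
        simp [hf, site, Nat.sub_add_cancel (show 1 ≤ 2 * n by omega)]
      · refine ⟨_, _, _, _, _, (Z.hop_down hf h0).flip f, ?_⟩
        congr 1
        simp only [hf, site, cond_true, cond_false, Bool.xor_true, Bool.not_true]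
        rw [Nat.mod_eq_of_lt (by omega)]; omega
    · rcases Nat.eq_or_lt_of_le (show h + 1 ≤ n from hlt) with h0 | h0
      · refine ⟨_, _, _, _, _, (Z.hop_up_last f h0).flip f, ?_⟩
        congr 1
        simp only [hf, site, cond_true, cond_false, Bool.xor_true, Bool.not_true]
        rw [Nat.mod_eq_of_lt (by omega)]; omega
      · refine ⟨_, _, _, _, _, (Z.hop_up hf h0).flip f, ?_⟩
        congr 1
        simp only [hf, site, cond_true, Bool.xor_true, Bool.not_false]
        rw [Nat.mod_eq_of_lt (by omega)]
  | unrot f =>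
    simp only [step_unrot_mkCfg hs, Instr.rules, yRun_cons, yRun_nil]
    cases hf : f q
    · refine ⟨_, _, _, _, _, (Z.flip f).hop_of_not hf, by simp [hf]⟩
    have Z' := Z.flip f
    rw [hf] at Z'
    cases up
    · rcases Nat.eq_or_lt_of_le (show h + 1 ≤ n from hlt) with h0 | h0
      · refine ⟨_, _, _, _, _, Z'.hop_up_last f h0, ?_⟩
        congr 1
        simp only [site, cond_true, cond_false]
        rw [Nat.mod_eq_sub_mod (by omega), Nat.mod_eq_of_lt (by omega)]; omega
      · refine ⟨_, _, _, _, _, Z'.hop_up hf h0, ?_⟩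
        congr 1
        simp only [site, cond_true, cond_false]
        rw [Nat.mod_eq_sub_mod (by omega), Nat.mod_eq_of_lt (by omega)]; omega
    · rcases Nat.eq_zero_or_pos h with h0 | h0
      · refine ⟨_, _, _, _, _, Z'.hop_down_first f h0, ?_⟩
        congr 1
        simp only [site, cond_true, cond_false]
        rw [Nat.mod_eq_of_lt (by omega)]; omega
      · refine ⟨_, _, _, _, _, Z'.hop_down hf h0, ?_⟩
        congr 1
        simp only [site, cond_true]
        rw [Nat.mod_eq_sub_mod (by omega), Nat.mod_eq_of_lt (by omega)]; omega

/-- A word of instructions on a zone acts as on its cyclic tape. -/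
lemma exists_run (Z : Zone y a n h up q r S) (w : List Instr) :
    ∃ h' up' q' r' S', Zone (yRun 1 (w.flatMap Instr.rules) y) a n h' up' q' r' S' ∧
      run w (mkCfg (2 * n) q r (site n h up) S) = mkCfg (2 * n) q' r' (site n h' up') S' := by
  induction w with
  | nil => exact ⟨_, _, _, _, _, Z, rfl⟩
  | cons i w ih =>
    obtain ⟨h', up', q', r', S', Z', e⟩ := ih
    obtain ⟨h'', up'', q'', r'', S'', Z'', e'⟩ := Z'.exists_instr i
    refine ⟨h'', up'', q'', r'', S'', ?_, by rw [run_cons, e, e']⟩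
    rwa [List.flatMap_cons, yRun_append]

/-- A word acting trivially on cyclic tapes acts trivially on zones. -/
lemma yRun_eq (Z : Zone y a n h up q r S) {w : List Instr} (hw : ev (2 * n) (2 * n) w = 1) {j : ℕ}
    (hj : j < n) : yRun 1 (w.flatMap Instr.rules) y (a + j) = y (a + j) := by
  obtain ⟨h', up', q', r', S', Z', e⟩ := Z.exists_run w
  have e2 := congrArg Subtype.val
    (Equiv.congr_fun hw ⟨mkCfg (2 * n) q r (site n h up) S, by simp [mkCfg]⟩)
  simp only [coe_ev, Perm.coe_one, id_eq] at e2
  obtain ⟨rfl, rfl, hs, hS⟩ := mkCfg_inj (site_lt Z.lt up) (site_lt Z'.lt up') (e2.symm.trans e)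
  obtain ⟨rfl, rfl⟩ := site_inj Z.lt Z'.lt hs
  rw [Z.cells j hj, Z'.cells j hj, hS j (by omega), hS _ (by omega)]

end Zone

lemma yRun_eq_of_mem_dead {y : ℤ → Option Cell} {D : Set ℤ}
    (hD : ∀ s ∈ D, y s = none ∨ ((y s).map Prod.fst = some .right ∧ s + 1 ∈ D) ∨
      ((y s).map Prod.fst = some .left ∧ s - 1 ∈ D)) (u : List Rule) :
    ∀ s ∈ D, yRun 1 u y s = y s := by
  have hd : ∀ s ∈ D, (y s).map Prod.fst = none ∨ (y s).map Prod.fst = some .right ∨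
      (y s).map Prod.fst = some .left := fun s hs => by
    rcases hD s hs with h | h | h
    · simp [h]
    · exact .inr (.inl h.1)
    · exact .inr (.inr h.1)
  induction u with
  | nil => exact fun _ _ => rfl
  | cons ρ u ih =>
    intro s hs
    rw [yRun_cons, yStep, ih s hs]
    rcases hD s hs with h | ⟨h, h1⟩ | ⟨h, h1⟩
    · simp [h]
    · obtain ⟨⟨t, b⟩, hb, rfl⟩ := Option.map_eq_some_iff.1 h
      rw [hb, Option.map_some, ih _ h1]
      rcases hd _ h1 with e | e | e <;> rw [e] <;> cases ρ <;> rfl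
    · obtain ⟨⟨t, b⟩, hb, rfl⟩ := Option.map_eq_some_iff.1 h
      rw [hb, Option.map_some, ih _ h1]
      rcases hd _ h1 with e | e | e <;> rw [e] <;> cases ρ <;> rfl

lemma exists_zone_of_head {y : ℤ → Option Cell} {B : ℕ} (hB : ∀ s, (B : ℤ) < |s| → y s = none)
    {s : ℤ} {up : Bool} {q : St} {r : Sym} (hs : (y s).map Prod.fst = some (.head up q r)) :
    ∃ a n h S, Zone y a n h up q r S ∧ s = a + h := by
  classical
  have ex1 : ∃ m : ℕ, (y (s - 1 - m)).map Prod.fst ≠ some .right :=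
    ⟨B + s.natAbs, by
      rw [hB _ (by rw [lt_abs]; right; push_cast; have := le_abs_self s; omega)]; simp⟩
  have ex2 : ∃ m : ℕ, (y (s + 1 + m)).map Prod.fst ≠ some .left :=
    ⟨B + s.natAbs, by
      rw [hB _ (by rw [lt_abs]; left; push_cast; have := neg_abs_le s; omega)]; simp⟩
  obtain ⟨m, hm, hm'⟩ : ∃ m : ℕ, (y (s - 1 - m)).map Prod.fst ≠ some .right ∧
      ∀ i < m, (y (s - 1 - i)).map Prod.fst = some .right :=
    ⟨_, Nat.find_spec ex1, fun i hi => not_not.1 (Nat.find_min ex1 hi)⟩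
  obtain ⟨k, hk, hk'⟩ : ∃ k : ℕ, (y (s + 1 + k)).map Prod.fst ≠ some .left ∧
      ∀ i < k, (y (s + 1 + i)).map Prod.fst = some .left :=
    ⟨_, Nat.find_spec ex2, fun i hi => not_not.1 (Nat.find_min ex2 hi)⟩
  refine ⟨s - m, m + 1 + k, m, fun i => if i < m + 1 + k
    then ((y (s - m + i)).map fun c => c.2.1).getD 0
    else ((y (s - m + ((2 * (m + 1 + k) - 1 - i : ℕ) : ℤ))).map fun c => c.2.2).getD 0, ?_,
    by ring⟩
  refine ⟨by omega, fun j hj => ?_, ?_, ?_⟩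
  · rw [if_pos hj, if_neg (by omega),
      show 2 * (m + 1 + k) - 1 - (2 * (m + 1 + k) - 1 - j) = j by omega]
    have ht : (y (s - m + j)).map Prod.fst = some (zoneTy m up q r j) := by
      rcases lt_trichotomy j m with h | rfl | h
      · rw [zoneTy, if_pos h, ← hm' (m - 1 - j) (by omega)]
        congr 2; omega
      · simpa [zoneTy] using hs
      · rw [zoneTy, if_neg h.not_gt, if_neg h.ne', ← hk' (j - m - 1) (by omega)]
        congr 2; omega
    obtain ⟨⟨t, b⟩, hb, ht⟩ := Option.map_eq_some_iff.1 ht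
    rw [hb, ← ht]; rfl
  · rwa [show s - (m : ℤ) - 1 = s - 1 - m by ring]
  · rwa [show s - (m : ℤ) + ((m + 1 + k : ℕ) : ℤ) = s + 1 + k by push_cast; ring]

/-- A word acting trivially on all cyclic tapes of even length acts trivially on all belts. -/
lemma yRun_eq_self {w : List Instr} (hw : ∀ n, 0 < n → ev (2 * n) (2 * n) w = 1)
    (y : ℤ → Option Cell) : yRun 1 (w.flatMap Instr.rules) y = y := by
  funext s
  set u := w.flatMap Instr.rules
  obtain ⟨B, hB⟩ : ∃ B : ℕ, |s| + u.length ≤ (B : ℤ) := ⟨s.natAbs + u.length, by simp⟩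
  set y' : ℤ → Option Cell := fun t => if |t - s| ≤ u.length then y t else none with hy'
  rw [yRun_congr u (y' := y') fun t ht => by simp [hy', ht],
    show y s = y' s by simp [hy']]
  have hB' : ∀ t, (B : ℤ) < |t| → y' t = none := fun t ht => if_neg fun h => by
    have := abs_sub_abs_le_abs_sub t s
    omega
  clear_value y'
  by_cases hs : ∃ a n h up q r S, Zone y' a n h up q r S ∧ ∃ j < n, s = a + (j : ℕ)
  · obtain ⟨a, n, h, up, q, r, S, Z, j, hj, rfl⟩ := hs
    exact Z.yRun_eq (hw n (by omega)) hj
  · refine yRun_eq_of_mem_dead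
      (D := {s | ¬ ∃ a n h up q r S, Zone y' a n h up q r S ∧ ∃ j < n, s = a + (j : ℕ)})
      (fun s hs => ?_) u s hs
    rw [Set.mem_ofPred_eq] at hs
    rcases hy : y' s with _ | ⟨_ | _ | ⟨up, q, r⟩, b⟩
    · simp
    · refine .inr (.inl ⟨rfl, ?_⟩)
      rintro ⟨a, n, h, up, q, r, S, Z, j, hj, e⟩
      rcases Nat.eq_zero_or_pos j with rfl | h0
      · refine Z.lo ?_
        rw [show a - 1 = s by rw [Nat.cast_zero] at e; omega, hy]; rfl
      · exact hs ⟨a, n, h, up, q, r, S, Z, j - 1, by omega, by omega⟩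
    · refine .inr (.inr ⟨rfl, ?_⟩)
      rintro ⟨a, n, h, up, q, r, S, Z, j, hj, e⟩
      rcases Nat.lt_or_ge (j + 1) n with h0 | h0
      · exact hs ⟨a, n, h, up, q, r, S, Z, j + 1, h0, by omega⟩
      · refine Z.hi ?_
        rw [show a + n = s by omega, hy]; rfl
    · obtain ⟨a, n, h, S, Z, e⟩ := exists_zone_of_head hB' (s := s) (by rw [hy]; rfl)
      exact absurd ⟨a, n, h, up, q, r, S, Z, h, Z.lt, e⟩ hs

/-- A word acting trivially on all belts acts trivially on cyclic tapes of even length. -/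
lemma ev_eq_one_of_yRun {w : List Instr}
    (hw : ∀ y, yRun 1 (w.flatMap Instr.rules) y = y) {n : ℕ} (hn : 0 < n) :
    ev (2 * n) (2 * n) w = 1 := by
  ext1 ⟨c, hc⟩
  refine Subtype.ext ?_
  obtain ⟨z, hz, S, e⟩ := exists_eq_mkCfg c hc (by omega)
  obtain ⟨h, hh, up, rfl⟩ := exists_site hz
  set y : ℤ → Option Cell := fun s => if 0 ≤ s ∧ s < n then
    some (zoneTy h up c.q c.r s.toNat, S s.toNat, S (2 * n - 1 - s.toNat)) else none with hy
  have Z : Zone y 0 n h up c.q c.r S :=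
    ⟨hh, fun j hj => by simp [hy, hj], by simp [hy], by simp [hy]⟩
  obtain ⟨h', up', q', r', S', Z', e'⟩ := Z.exists_run w
  rw [hw] at Z'
  have hcell : ∀ j < n, zoneTy h up c.q c.r j = zoneTy h' up' q' r' j ∧ S j = S' j ∧
      S (2 * n - 1 - j) = S' (2 * n - 1 - j) := fun j hj => by
    simpa using (Z.cells j hj).symm.trans (Z'.cells j hj)
  have hS : ∀ i < 2 * n, S' i = S i := fun i hi => by
    rcases Nat.lt_or_ge i n with h | h
    · exact (hcell i h).2.1.symm
    · have := (hcell (2 * n - 1 - i) (by omega)).2.2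
      rw [show 2 * n - 1 - (2 * n - 1 - i) = i by omega] at this
      exact this.symm
  have ht := (hcell h hh).1
  simp only [zoneTy, lt_irrefl, if_false, if_true] at ht
  split_ifs at ht with h1 h2
  subst h2
  simp only [Ty.head.injEq] at ht
  obtain ⟨rfl, h3, h4⟩ := ht
  rw [← h3, ← h4, mkCfg_congr (by omega) hS, ← e] at e'
  exact e'

lemma yRun_eq_iff_ev_eq_one {w : List Instr} :
    (∀ y, yRun 1 (w.flatMap Instr.rules) y = y) ↔ ∀ n, 0 < n → ev (2 * n) (2 * n) w = 1 :=
  ⟨fun h _ hn => ev_eq_one_of_yRun h hn, yRun_eq_self⟩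

/-! ### Conveyor belts in the full shift -/

/-- A code writing cells as words of length `N` which do not overlap. -/
structure BlockCode (A : Type*) (N : ℕ) where
  code : Cell → ℕ → A
  blank : A
  inj : ∀ c c', (∀ k < N, code c k = code c' k) → c = c'
  overlap : ∀ c c' k, 0 < k → k < N → ∃ j, j + k < N ∧ code c (j + k) ≠ code c' j
  ne_blank : ∀ c, code c 0 ≠ blank
  pos : 0 < N

instance : Finite Ty :=
  Finite.of_surjective
    (fun t : Option (Option (Bool × St × Sym)) => match t with
      | none => Ty.right
      | some none => .left
      | some (some (up, q, r)) => .head up q r)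
    (by
      rintro (_ | _ | ⟨up, q, r⟩)
      exacts [⟨none, rfl⟩, ⟨some none, rfl⟩, ⟨some (some (up, q, r)), rfl⟩])

instance : Finite Rule :=
  Finite.of_surjective
    (fun t : Perm (St × Sym) ⊕ (St → Bool) ⊕ (St → Bool) ⊕ (St → Bool) => match t with
      | .inl π => Rule.perm π
      | .inr (.inl f) => .swp f
      | .inr (.inr (.inl f)) => .flip f
      | .inr (.inr (.inr f)) => .hop f)
    (by
      rintro (π | f | f | f)
      exacts [⟨.inl π, rfl⟩, ⟨.inr (.inl f), rfl⟩, ⟨.inr (.inr (.inl f)), rfl⟩,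
        ⟨.inr (.inr (.inr f)), rfl⟩])

lemma exists_blockCode (A : Type*) [Nontrivial A] : ∃ N, Nonempty (BlockCode A N) := by
  classical
  obtain ⟨α, β, hαβ⟩ := exists_pair_ne A
  obtain ⟨m, ⟨e⟩⟩ := Finite.exists_equiv_fin Cell
  have lt (c : Cell) : (e c).val < m := (e c).2
  refine ⟨2 * m + 3, ⟨fun c k => if k < 2 ∨ k = 2 * (e c).val + 3 then β else α, α, ?_, ?_, ?_,
    by omega⟩⟩
  · intro c c' h
    have := h (2 * (e c).val + 3) (by have := lt c; omega)
    simp only [or_true, if_true] at this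
    split_ifs at this with h'
    · exact e.injective (Fin.ext (by omega))
    · exact absurd this.symm hαβ
  · intro c c' k h0 hk
    rcases Nat.even_or_odd' k with ⟨i, rfl | rfl⟩
    · refine ⟨0, by omega, ?_⟩
      rw [if_neg (by omega), if_pos (by omega)]
      exact hαβ
    · refine ⟨1, by omega, ?_⟩
      rw [if_neg (by omega), if_pos (by omega)]
      exact hαβ
  · intro c
    rw [if_pos (by omega)]
    exact hαβ.symm

namespace BlockCode
variable {A : Type*} {N : ℕ} (C : BlockCode A N)

open Classical in
/-- The belt encoded in a point of the full shift. -/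
noncomputable def dec (x : ℤ → A) (s : ℤ) : Option Cell :=
  if h : ∃ c, ∀ k < N, x (s + (k : ℕ)) = C.code c k then some h.choose else none

open Classical in
/-- The letter encoding some offset and cell satisfying `P`, or `a` if there is none. -/
noncomputable def pick (P : ℕ × Cell → Prop) (a : A) : A :=
  if h : ∃ p, P p then C.code h.choose.2 h.choose.1 else a

/-- Write the cells of the belt `y` over the point `x`. -/
noncomputable def rep (x : ℤ → A) (y : ℤ → Option Cell) (n : ℤ) : A :=
  C.pick (fun p => p.1 < N ∧ y (n - p.1) = some p.2) (x n)

variable {C}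

lemma dec_eq_some {x : ℤ → A} {s : ℤ} {c : Cell} :
    C.dec x s = some c ↔ ∀ k < N, x (s + (k : ℕ)) = C.code c k := by
  classical
  unfold dec
  constructor
  · intro h
    split_ifs at h with h'
    rw [← Option.some.inj h]
    exact h'.choose_spec
  · intro h
    have h' : ∃ c, ∀ k < N, x (s + (k : ℕ)) = C.code c k := ⟨c, h⟩
    rw [dif_pos h', Option.some.injEq]
    exact C.inj _ _ fun k hk => (h'.choose_spec k hk).symm.trans (h k hk)

lemma eq_of_dec {x : ℤ → A} {s : ℤ} {k : ℕ} (hk : k < N) (h1 : (C.dec x s).isSome)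
    (h2 : (C.dec x (s + k)).isSome) : k = 0 := by
  by_contra h0
  obtain ⟨c, hc⟩ := Option.isSome_iff_exists.1 h1
  obtain ⟨c', hc'⟩ := Option.isSome_iff_exists.1 h2
  rw [dec_eq_some] at hc hc'
  obtain ⟨j, hj, hne⟩ := C.overlap c c' k (by omega) hk
  refine hne ?_
  rw [← hc (j + k) hj, ← hc' j (by omega)]
  congr 1; push_cast; ring

lemma eq_of_dec_sub {x : ℤ → A} {n : ℤ} {k k' : ℕ} (hk : k < N) (hk' : k' < N)
    (h1 : (C.dec x (n - k)).isSome) (h2 : (C.dec x (n - k')).isSome) : k = k' := by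
  rcases le_total k k' with h | h
  · have := eq_of_dec (k := k' - k) (by omega) h2 (by
      rwa [show n - (k' : ℤ) + ((k' - k : ℕ) : ℤ) = n - k by omega])
    omega
  · have := eq_of_dec (k := k - k') (by omega) h1 (by
      rwa [show n - (k : ℤ) + ((k - k' : ℕ) : ℤ) = n - k' by omega])
    omega

lemma rep_of_none {x : ℤ → A} {y : ℤ → Option Cell} {n : ℤ}
    (h : ∀ k < N, y (n - (k : ℕ)) = none) : C.rep x y n = x n := by
  classical
  refine dif_neg ?_
  rintro ⟨⟨k, c⟩, hk, hc⟩
  rw [h k hk] at hc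
  cases hc

lemma rep_dec (x : ℤ → A) : C.rep x (C.dec x) = x := by
  classical
  funext n
  unfold rep pick
  split_ifs with h
  · have h1 := h.choose_spec
    rw [← dec_eq_some.1 h1.2 _ h1.1, sub_add_cancel]
  · rfl

variable {x : ℤ → A} {y : ℤ → Option Cell}

lemma rep_of_some (h : ∀ s, (y s).isSome = (C.dec x s).isSome) {s : ℤ} {c : Cell}
    (hc : y s = some c) {k : ℕ} (hk : k < N) : C.rep x y (s + k) = C.code c k := by
  classical
  have h' : ∃ p : ℕ × Cell, p.1 < N ∧ y (s + k - p.1) = some p.2 := ⟨(k, c), hk, by simpa⟩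
  rw [rep, pick, dif_pos h']
  obtain ⟨h1, h2⟩ := h'.choose_spec
  have e : h'.choose.1 = k := by
    refine eq_of_dec_sub (C := C) (x := x) (n := s + k) h1 hk ?_ ?_
    · rw [← h, h2]; rfl
    · rw [← h, add_sub_cancel_right, hc]; rfl
  rw [e, add_sub_cancel_right, hc, Option.some.injEq] at h2
  rw [e, ← h2]

lemma dec_rep (h : ∀ s, (y s).isSome = (C.dec x s).isSome) : C.dec (C.rep x y) = y := by
  have key : ∀ s c, y s = some c → C.dec (C.rep x y) s = some c := fun s c hc =>
    dec_eq_some.2 fun k hk => rep_of_some h hc hk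
  funext s
  cases hs : y s with
  | some c => exact key s c hs
  | none =>
    by_contra hne
    obtain ⟨c', hc'⟩ := Option.ne_none_iff_exists'.1 hne
    have free : ∀ k < N, ∀ k' < N, y (s + (k : ℕ) - (k' : ℕ)) = none := fun k hk k' hk' => by
      by_contra hne'
      obtain ⟨c, hc⟩ := Option.ne_none_iff_exists'.1 hne'
      have : k' = k := by
        refine eq_of_dec_sub (C := C) (x := C.rep x y) (n := s + k) hk' hk ?_ ?_
        · rw [key _ _ hc]; rfl
        · rw [add_sub_cancel_right, hc']; rfl
      subst this
      rw [add_sub_cancel_right, hs] at hc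
      cases hc
    have : C.dec x s = some c' := dec_eq_some.2 fun k hk => by
      rw [← dec_eq_some.1 hc' k hk, rep_of_none (free k hk)]
    have e := h s
    rw [hs, this] at e
    cases e

lemma rep_rep {z : ℤ → Option Cell} (h : ∀ s, (y s).isSome = (z s).isSome) :
    C.rep (C.rep x y) z = C.rep x z := by
  classical
  funext n
  by_cases hz : ∃ p : ℕ × Cell, p.1 < N ∧ z (n - p.1) = some p.2
  · rw [rep, pick, dif_pos hz, rep, pick, dif_pos hz]
  · have hz' : ∀ k < N, z (n - (k : ℕ)) = none := fun k hk => by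
      by_contra hne
      obtain ⟨c, hc⟩ := Option.ne_none_iff_exists'.1 hne
      exact hz ⟨(k, c), hk, hc⟩
    rw [rep_of_none hz', rep_of_none hz', rep_of_none]
    intro k hk
    have := h (n - k)
    rw [hz' k hk] at this
    simpa using this

/-- The action of a rule on the full shift. -/
noncomputable def act (C : BlockCode A N) (ρ : Rule) (x : ℤ → A) : ℤ → A :=
  C.rep x (yStep N ρ (C.dec x))

lemma dec_act (ρ : Rule) (x : ℤ → A) : C.dec (C.act ρ x) = yStep N ρ (C.dec x) :=
  dec_rep fun s => by simp

lemma _root_.SlowMachine.Rule.inv_inv (ρ : Rule) : ρ.inv.inv = ρ := by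
  cases ρ <;> simp [Rule.inv]

lemma act_inv_act (ρ : Rule) (x : ℤ → A) : C.act ρ.inv (C.act ρ x) = x := by
  rw [act, dec_act, yStep_inv_yStep, act, rep_rep fun s => by simp, rep_dec]

/-- The permutation of the full shift induced by a rule. -/
@[simps] noncomputable def actPerm (C : BlockCode A N) (ρ : Rule) : Perm (ℤ → A) where
  toFun := C.act ρ
  invFun := C.act ρ.inv
  left_inv := act_inv_act ρ
  right_inv x := by simpa [Rule.inv_inv] using act_inv_act (C := C) ρ.inv x

/-- The permutation of the full shift induced by a word of rules. -/
noncomputable def evR (C : BlockCode A N) (u : List Rule) : Perm (ℤ → A) := (u.map C.actPerm).prod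

lemma isSome_yRun (N : ℤ) (u : List Rule) (y : ℤ → Option Cell) (s : ℤ) :
    (yRun N u y s).isSome = (y s).isSome := by
  induction u with
  | nil => rfl
  | cons ρ u ih => rw [yRun_cons, isSome_yStep, ih]

lemma evR_apply (u : List Rule) (x : ℤ → A) : C.evR u x = C.rep x (yRun N u (C.dec x)) := by
  induction u with
  | nil => exact (rep_dec x).symm
  | cons ρ u ih =>
    rw [evR, List.map_cons, List.prod_cons, Perm.mul_apply]
    change C.act ρ (C.evR u x) = _
    rw [ih, act, dec_rep fun s => isSome_yRun .., rep_rep fun s => by simp, yRun_cons]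

/-- A point of the full shift encoding the belt `y` along the multiples of `N`. -/
def enc (C : BlockCode A N) (y : ℤ → Option Cell) (n : ℤ) : A :=
  match y (n / N) with
  | some c => C.code c (n % N).toNat
  | none => C.blank

lemma dec_enc (y : ℤ → Option Cell) (p : ℤ) : C.dec (C.enc y) (N * p) = y p := by
  have hN : (0 : ℤ) < N := by exact_mod_cast C.pos
  have e : ∀ k < N, C.enc y (N * p + (k : ℕ)) =
      match y p with
      | some c => C.code c k
      | none => C.blank := fun k hk => by
    have h1 : (N * p + k : ℤ) / N = p := by
      rw [Int.mul_add_ediv_left _ _ hN.ne', Int.ediv_eq_zero_of_lt (by omega) (by omega), add_zero]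
    have h2 : (N * p + k : ℤ) % N = k := by
      rw [Int.mul_add_emod_self_left, Int.emod_eq_of_lt (by omega) (by omega)]
    rw [enc, h1, h2, Int.toNat_natCast]
  cases hy : y p with
  | some c => exact dec_eq_some.2 fun k hk => by rw [e k hk, hy]
  | none =>
    by_contra hne
    obtain ⟨c, hc⟩ := Option.ne_none_iff_exists'.1 hne
    refine C.ne_blank c ?_
    rw [← dec_eq_some.1 hc 0 C.pos, e 0 C.pos, hy]

lemma evR_eq_one_iff (u : List Rule) : C.evR u = 1 ↔ ∀ y, yRun 1 u y = y := by
  constructor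
  · intro h y
    have h1 : C.evR u (C.enc y) = C.enc y := by rw [h]; rfl
    have h2 : yRun N u (C.dec (C.enc y)) = C.dec (C.enc y) := by
      conv_rhs => rw [← h1, evR_apply, dec_rep fun s => isSome_yRun ..]
    funext p
    have h3 := yRun_arith N u (C.dec (C.enc y)) 0 p
    simp only [zero_add, dec_enc] at h3
    rw [← h3, h2, dec_enc]
  · intro h
    ext1 x
    rw [evR_apply, Perm.coe_one, id_eq]
    conv_rhs => rw [← rep_dec (C := C) x]
    congr 1
    funext s
    have := yRun_arith N u (C.dec x) s 0
    simpa [h] using this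

/-! ### Continuity and shift invariance -/

lemma act_shiftMap (ρ : Rule) (x : ℤ → A) : C.act ρ (shiftMap A x) = shiftMap A (C.act ρ x) := by
  classical
  have h1 : ∀ s, C.dec (shiftMap A x) s = C.dec x (s + 1) := fun s => by
    simp only [dec, shiftMap]
    have : ∀ k : ℕ, s + k + 1 = s + 1 + k := fun k => by ring
    simp only [this]
  have h2 : ∀ s, yStep N ρ (C.dec (shiftMap A x)) s = yStep N ρ (C.dec x) (s + 1) := fun s => by
    simp only [yStep, h1]
    congr 4 <;> ring
  funext n
  simp only [act, shiftMap, rep]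
  have h3 : ∀ k : ℕ, n + 1 - (k : ℤ) = n - k + 1 := fun k => by ring
  simp only [h3]
  congr 1
  funext p
  rw [← h2]

lemma act_congr (ρ : Rule) {x x' : ℤ → A} {n : ℤ}
    (h : ∀ t ∈ Finset.Icc (n - 3 * N) (n + 3 * N), x' t = x t) : C.act ρ x' n = C.act ρ x n := by
  have h1 : ∀ s, n - 2 * N ≤ s → s ≤ n + 2 * N → C.dec x' s = C.dec x s := fun s hs hs' => by
    refine Option.ext fun c => ?_
    rw [dec_eq_some, dec_eq_some]
    refine forall₂_congr fun k hk => ?_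
    rw [h _ (Finset.mem_Icc.2 (by omega))]
  have h2 : ∀ s, n - N ≤ s → s ≤ n → yStep N ρ (C.dec x') s = yStep N ρ (C.dec x) s :=
    fun s hs hs' => by
      simp only [yStep, h1 s (by omega) (by omega), h1 (s - N) (by omega) (by omega),
        h1 (s + N) (by omega) (by omega)]
  rw [act, rep, act, rep, h n (Finset.mem_Icc.2 (by omega))]
  congr 1
  funext p
  refine propext (and_congr_right fun hp => ?_)
  rw [h2 _ (by omega) (by omega)]

lemma continuous_act [TopologicalSpace A] [DiscreteTopology A] (ρ : Rule) :
    Continuous (C.act ρ) := by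
  refine continuous_pi fun n => IsLocallyConstant.continuous ?_
  rw [IsLocallyConstant.iff_eventually_eq]
  intro x
  have : ∀ᶠ x' in nhds x, ∀ t ∈ Finset.Icc (n - 3 * N) (n + 3 * N), x' t = x t :=
    (Filter.eventually_all_finset _).2 fun t _ =>
      (continuous_apply t).continuousAt.eventually
        ((isOpen_discrete {x t}).mem_nhds rfl)
  filter_upwards [this] with x' hx'
  exact act_congr ρ hx'

lemma actPerm_mem [TopologicalSpace A] [DiscreteTopology A] (ρ : Rule) :
    C.actPerm ρ ∈ FullShiftAut A :=
  ⟨continuous_act ρ, continuous_act ρ.inv, act_shiftMap ρ⟩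

/-! ### Words of instructions acting on the full shift -/

/-- The permutation of the full shift induced by a word of instructions. -/
noncomputable def evA (C : BlockCode A N) (w : List Instr) : Perm (ℤ → A) :=
  C.evR (w.flatMap Instr.rules)

lemma evA_append (v w : List Instr) : C.evA (v ++ w) = C.evA v * C.evA w := by
  simp [evA, evR]

lemma evA_wpow (w : List Instr) (n : ℕ) : C.evA (wpow w n) = C.evA w ^ n := by
  induction n with
  | zero => rfl
  | succ n ih => rw [wpow_succ, evA_append, ih, pow_succ']

lemma evA_eq_one_iff (w : List Instr) :
    C.evA w = 1 ↔ ∀ n, 0 < n → ev (2 * n) (2 * n) w = 1 := by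
  rw [evA, evR_eq_one_iff, yRun_eq_iff_ev_eq_one]

lemma evA_eq {v w : List Instr} (h : ∀ n, 0 < n → ev (2 * n) (2 * n) v = ev (2 * n) (2 * n) w) :
    C.evA v = C.evA w := by
  have h1 : C.evA v * C.evA (winv w) = 1 := by
    rw [← evA_append, evA_eq_one_iff]
    intro n hn
    simp [h n hn]
  have h2 : C.evA w * C.evA (winv w) = 1 := by
    rw [← evA_append, evA_eq_one_iff]
    intro n _
    simp
  exact mul_right_cancel (h1.trans h2.symm)

lemma length_flatMap_rules (w : List Instr) : (w.flatMap Instr.rules).length ≤ 2 * w.length := by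
  induction w with
  | nil => simp
  | cons i w ih => cases i <;> simp [Instr.rules] at ih ⊢ <;> omega

lemma wordNorm_evA_le (w : List Instr) :
    wordNorm (Set.range C.actPerm) (C.evA w) ≤ 2 * w.length := by
  refine le_trans (Nat.sInf_le ⟨(w.flatMap Instr.rules).map C.actPerm, rfl, ?_, rfl⟩) ?_
  · intro g hg
    obtain ⟨ρ, -, rfl⟩ := List.mem_map.1 hg
    exact .inl ⟨ρ, rfl⟩
  · rw [List.length_map]
    exact length_flatMap_rules w

end BlockCode

end SlowMachine

open SlowMachine SlowMachine.BlockCode in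
/-- **Theorem.** For every finite alphabet `A` with `|A| ≥ 2`, there exist a finite set
`F ⊆ Aut(A^ℤ)` and an element `g` of the subgroup generated by `F` such that `g` has
infinite order and for some `K > 0` the word norm satisfies
`‖g^n‖_F ≤ K·(log₂ n)⁴` for all `n ≥ 2`. -/
theorem distortion_in_full_shift_aut (A : Type) [TopologicalSpace A] [DiscreteTopology A]
    [Fintype A] (hA : 2 ≤ Fintype.card A) :
    ∃ F : Finset (Equiv.Perm (ℤ → A)), ↑F ⊆ FullShiftAut A ∧
      ∃ g ∈ Subgroup.closure (F : Set (Equiv.Perm (ℤ → A))),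
        (∀ n : ℕ, 1 ≤ n → g ^ n ≠ 1) ∧
        ∃ K : ℝ, 0 < K ∧ ∀ n : ℕ, 2 ≤ n →
          (wordNorm (F : Set (Equiv.Perm (ℤ → A))) (g ^ n) : ℝ) ≤
            K * (Real.logb 2 n) ^ 4 := by
  have : Nontrivial A := Fintype.one_lt_card_iff_nontrivial.1 hA
  obtain ⟨N, ⟨C⟩⟩ := exists_blockCode A
  refine ⟨(Set.finite_range C.actPerm).toFinset, ?_, C.evA gW, ?_, ?_, 2 * 14208, by norm_num, ?_⟩
  · rw [Set.Finite.coe_toFinset]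
    rintro _ ⟨ρ, rfl⟩
    exact actPerm_mem ρ
  · rw [Set.Finite.coe_toFinset]
    refine Subgroup.list_prod_mem _ fun g hg => ?_
    obtain ⟨ρ, -, rfl⟩ := List.mem_map.1 hg
    exact Subgroup.subset_closure ⟨ρ, rfl⟩
  · intro n hn h
    obtain ⟨l, hl, hne⟩ := exists_gW_pow_ne_one (n := n) (by omega)
    rw [← evA_wpow, evA_eq_one_iff] at h
    exact hne (by simpa using h l hl)
  · intro n hn
    obtain ⟨w, hw, h⟩ := exists_short_word hn
    rw [Set.Finite.coe_toFinset, ← evA_wpow, ← evA_eq (v := w) fun l hl => by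
      rw [h _ (by omega), ev_wpow]]
    have h1 : (Nat.log 2 n : ℝ) ≤ Real.logb 2 n := by
      exact_mod_cast Real.natLog_le_logb n 2
    calc (wordNorm (Set.range C.actPerm) (C.evA w) : ℝ)
        ≤ ((2 * (14208 * Nat.log 2 n ^ 4) : ℕ) : ℝ) :=
          Nat.cast_le.2 ((wordNorm_evA_le w).trans (Nat.mul_le_mul_left 2 hw))
      _ = 2 * 14208 * (Nat.log 2 n : ℝ) ^ 4 := by push_cast; ring
      _ ≤ 2 * 14208 * Real.logb 2 n ^ 4 := by gcongr
end

section
/- For every finite alphabet A with |A| ≥ 2 there exists a finite set F ⊆ Aut(A^ℤ) such that for every finite alphabet B, every subshift X ⊆ B^ℤ, and every injective group homomorphism from ⟨F⟩ into Aut(X), the lower entropy dimension of X is at least 1/4. -/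
section CellCoding

variable {A : Type*}

/-- The positions at which a codeword `a a b * b * b * b` with data symbols `* ∈ {a, b}` begins. -/
def codeCells (a b : A) (x : ℤ → A) : Set ℤ :=
  {p | x p = a ∧ x (p + 1) = a ∧ x (p + 2) = b ∧ x (p + 4) = b ∧ x (p + 6) = b ∧ x (p + 8) = b ∧
    ∀ i : Fin 3, x (p + 3 + 2 * (i : ℕ)) = a ∨ x (p + 3 + 2 * (i : ℕ)) = b}

/-- Codewords do not overlap. -/
lemma codeCells_separated {a b : A} (hab : a ≠ b) {x : ℤ → A} {p q : ℤ}
    (hp : p ∈ codeCells a b x) (hq : q ∈ codeCells a b x) (h1 : p < q + 9) (h2 : q < p + 9) :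
    p = q := by
  wlog hpq : p ≤ q generalizing p q
  · exact (this hq hp h2 h1 (by omega)).symm
  obtain ⟨d, rfl⟩ : ∃ d, q = p + d := ⟨q - p, by omega⟩
  obtain ⟨-, -, p2, p4, p6, p8, -⟩ := hp
  obtain ⟨q0, q1, -⟩ := hq
  have hd : 0 ≤ d ∧ d < 9 := by omega
  obtain ⟨hd0, hd9⟩ := hd
  interval_cases d <;> simp only [add_assoc] at q0 q1 <;> norm_num at q0 q1 ⊢ <;> simp_all

/-- The total flip that the data increments `v` cause at the position `p`, for a set `C` of
cells. -/
noncomputable def flipAmount (C : Set ℤ) (v : Fin 3 → ℤ → ZMod 2) (p : ℤ) : ZMod 2 :=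
  open Classical in ∑ i : Fin 3, if p - 3 - 2 * (i : ℕ) ∈ C then v i (p - 3 - 2 * (i : ℕ)) else 0

lemma flipAmount_add (C : Set ℤ) (v w : Fin 3 → ℤ → ZMod 2) (p : ℤ) :
    flipAmount C (v + w) p = flipAmount C v p + flipAmount C w p := by
  simp only [flipAmount, ← Finset.sum_add_distrib]
  refine Finset.sum_congr rfl fun i _ => ?_
  split_ifs <;> simp

/-- Adding the increments `v` to the data of the cells of `x`. -/
noncomputable def addData (a b : A) (v : Fin 3 → ℤ → ZMod 2) (x : ℤ → A) (p : ℤ) : A :=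
  open Classical in
  if flipAmount (codeCells a b x) v p = 0 then x p else Equiv.swap a b (x p)

/-- The data bits of a configuration. -/
noncomputable def dataBits (a b : A) (x : ℤ → A) (i : Fin 3) (p : ℤ) : ZMod 2 :=
  open Classical in if p ∈ codeCells a b x ∧ x (p + 3 + 2 * (i : ℕ)) = b then 1 else 0

variable {a b : A}

lemma flipAmount_slot (hab : a ≠ b) {x : ℤ → A} {p : ℤ} (hp : p ∈ codeCells a b x)
    (v : Fin 3 → ℤ → ZMod 2) (i : Fin 3) :
    flipAmount (codeCells a b x) v (p + 3 + 2 * (i : ℕ)) = v i p := by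
  classical
  rw [flipAmount, Finset.sum_eq_single i]
  · rw [show p + 3 + 2 * ((i : ℕ) : ℤ) - 3 - 2 * (i : ℕ) = p by ring, if_pos hp]
  · intro j _ hj
    refine if_neg fun hc => hj ?_
    have := codeCells_separated hab hc hp (by omega) (by omega)
    exact Fin.ext (by omega)
  · simp

lemma flipAmount_frame (hab : a ≠ b) {x : ℤ → A} {p : ℤ} (hp : p ∈ codeCells a b x)
    (v : Fin 3 → ℤ → ZMod 2) (o : ℤ) (ho : 0 ≤ o) (ho' : o ≤ 8)
    (hne : o ≠ 3 ∧ o ≠ 5 ∧ o ≠ 7) :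
    flipAmount (codeCells a b x) v (p + o) = 0 := by
  classical
  refine Finset.sum_eq_zero fun j _ => if_neg fun hc => ?_
  have := codeCells_separated hab hc hp (by omega) (by omega)
  omega

lemma codeCells_subset_addData (hab : a ≠ b) (v : Fin 3 → ℤ → ZMod 2) (x : ℤ → A) :
    codeCells a b x ⊆ codeCells a b (addData a b v x) := by
  intro p hp
  have key : ∀ o : ℤ, 0 ≤ o → o ≤ 8 → (o ≠ 3 ∧ o ≠ 5 ∧ o ≠ 7) →
      addData a b v x (p + o) = x (p + o) := fun o h1 h2 h3 => by
    rw [addData, flipAmount_frame hab hp v o h1 h2 h3, if_pos rfl]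
  have hp' := hp
  obtain ⟨h0, h1, h2, h4, h6, h8, hd⟩ := hp'
  refine ⟨?_, ?_, ?_, ?_, ?_, ?_, fun i => ?_⟩
  · simpa using (key 0 (by norm_num) (by norm_num) (by norm_num)).trans (by simpa using h0)
  · rw [key 1 (by norm_num) (by norm_num) (by norm_num), h1]
  · rw [key 2 (by norm_num) (by norm_num) (by norm_num), h2]
  · rw [key 4 (by norm_num) (by norm_num) (by norm_num), h4]
  · rw [key 6 (by norm_num) (by norm_num) (by norm_num), h6]
  · rw [key 8 (by norm_num) (by norm_num) (by norm_num), h8]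
  · rw [addData]
    split_ifs
    · exact hd i
    · rcases hd i with h | h <;> simp [h]

lemma codeCells_addData (hab : a ≠ b) (v : Fin 3 → ℤ → ZMod 2) (x : ℤ → A) :
    codeCells a b (addData a b v x) = codeCells a b x := by
  classical
  refine Set.Subset.antisymm (fun q hq => ?_) (codeCells_subset_addData hab v x)
  by_cases h : ∃ p, q ≤ p ∧ p ≤ q + 8 ∧ flipAmount (codeCells a b x) v p ≠ 0
  · obtain ⟨p, h1, h2, h3⟩ := h
    obtain ⟨i, -, hi⟩ := Finset.exists_ne_zero_of_sum_ne_zero h3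
    have hc : p - 3 - 2 * ((i : ℕ) : ℤ) ∈ codeCells a b x := by
      by_contra hc
      exact hi (if_neg hc)
    have := codeCells_separated hab (codeCells_subset_addData hab v x hc) hq (by omega) (by omega)
    exact this ▸ hc
  · push Not at h
    have key : ∀ p, q ≤ p → p ≤ q + 8 → addData a b v x p = x p := fun p h1 h2 => by
      rw [addData, h p h1 h2, if_pos rfl]
    obtain ⟨h0, h1, h2, h4, h6, h8, hd⟩ := hq
    rw [key _ (by omega) (by omega)] at h0 h1 h2 h4 h6 h8
    refine ⟨h0, h1, h2, h4, h6, h8, fun i => ?_⟩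
    have := hd i
    rwa [key _ (by omega) (by omega)] at this

lemma addData_addData (hab : a ≠ b) (v w : Fin 3 → ℤ → ZMod 2) (x : ℤ → A) :
    addData a b v (addData a b w x) = addData a b (v + w) x := by
  classical
  funext p
  have two : ∀ d : ZMod 2, d ≠ 0 → d = 1 := by decide
  have h2 : (1 : ZMod 2) + 1 = 0 := by decide
  rw [addData, codeCells_addData hab, addData, addData, flipAmount_add]
  by_cases hv : flipAmount (codeCells a b x) v p = 0 <;>
    by_cases hw : flipAmount (codeCells a b x) w p = 0
  · simp [hv, hw]
  · simp [hv, hw]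
  · simp [hv, hw]
  · rw [if_neg hv, if_neg hw, two _ hv, two _ hw, h2, if_pos rfl, Equiv.swap_apply_self]

lemma addData_zero (x : ℤ → A) : addData a b 0 x = x := by
  funext p
  simp [addData, flipAmount]

lemma dataBits_addData (hab : a ≠ b) (v : Fin 3 → ℤ → ZMod 2) (x : ℤ → A) (i : Fin 3) {p : ℤ}
    (hp : p ∈ codeCells a b x) :
    dataBits a b (addData a b v x) i p = dataBits a b x i p + v i p := by
  have two : ∀ d : ZMod 2, d ≠ 0 → d = 1 := by decide
  have h2 : (1 : ZMod 2) + 1 = 0 := by decide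
  rw [dataBits, dataBits, codeCells_addData hab, addData, flipAmount_slot hab hp]
  obtain ⟨-, -, -, -, -, -, hd⟩ := id hp
  by_cases hv : v i p = 0
  · rw [if_pos hv, hv, add_zero]
  · rw [two _ hv]
    rcases hd i with h | h <;> simp [h, hp, hab, h2]

lemma dataBits_of_notMem {x : ℤ → A} {p : ℤ} (hp : p ∉ codeCells a b x) (i : Fin 3) :
    dataBits a b x i p = 0 := by
  simp [dataBits, hp]

/-- Families, indexed by sets of cells, of linear operators on bit sequences. -/
abbrev CellOp : Type := Set ℤ → Module.End (ZMod 2) (ℤ → ZMod 2)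

/-- An operator family is supported if its values vanish outside the cells. -/
def CellOp.Supported (T : CellOp) : Prop := ∀ C v p, p ∉ C → T C v p = 0

lemma CellOp.Supported.mul {T : CellOp} (hT : T.Supported) (S : CellOp) : (T * S).Supported :=
  fun C v p hp => hT C (S C v) p hp

lemma CellOp.Supported.add {T S : CellOp} (hT : T.Supported) (hS : S.Supported) :
    (T + S).Supported := fun C v p hp => by
  simp [hT C v p hp, hS C v p hp]

lemma CellOp.Supported.smul {T : CellOp} (hT : T.Supported) (c : ZMod 2) :
    (c • T).Supported := fun C v p hp => by
  simp [hT C v p hp]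

lemma CellOp.supported_zero : (0 : CellOp).Supported := fun C v p _ => by simp

lemma CellOp.supported_sum {ι : Type*} (s : Finset ι) {T : ι → CellOp}
    (hT : ∀ i ∈ s, (T i).Supported) : (∑ i ∈ s, T i).Supported :=
  Finset.sum_induction T CellOp.Supported (fun _ _ => CellOp.Supported.add)
    CellOp.supported_zero hT

/-- The elementary map adding `T` applied to the `j`-th track to the `i`-th track. -/
noncomputable def elemMap (a b : A) (i j : Fin 3) (T : CellOp) (x : ℤ → A) : ℤ → A :=
  addData a b (Pi.single i (T (codeCells a b x) (dataBits a b x j))) x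

lemma codeCells_elemMap (hab : a ≠ b) (i j : Fin 3) (T : CellOp) (x : ℤ → A) :
    codeCells a b (elemMap a b i j T x) = codeCells a b x :=
  codeCells_addData hab _ x

lemma dataBits_elemMap_of_ne (hab : a ≠ b) {i k : Fin 3} (j : Fin 3) (hk : k ≠ i) (T : CellOp)
    (x : ℤ → A) : dataBits a b (elemMap a b i j T x) k = dataBits a b x k := by
  funext p
  by_cases hp : p ∈ codeCells a b x
  · simp [elemMap, dataBits_addData hab _ x k hp, Pi.single_eq_of_ne hk]
  · rw [dataBits_of_notMem hp, dataBits_of_notMem (by rwa [codeCells_elemMap hab])]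

lemma dataBits_elemMap_self (hab : a ≠ b) (i j : Fin 3) {T : CellOp} (hT : T.Supported)
    (x : ℤ → A) : dataBits a b (elemMap a b i j T x) i =
      dataBits a b x i + T (codeCells a b x) (dataBits a b x j) := by
  funext p
  by_cases hp : p ∈ codeCells a b x
  · simp [elemMap, dataBits_addData hab _ x i hp]
  · rw [dataBits_of_notMem (by rwa [codeCells_elemMap hab]), Pi.add_apply, dataBits_of_notMem hp,
      hT _ _ _ hp, add_zero]

lemma elemMap_elemMap (hab : a ≠ b) {i j : Fin 3} (hij : i ≠ j) (T S : CellOp) (x : ℤ → A) :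
    elemMap a b i j T (elemMap a b i j S x) = elemMap a b i j (T + S) x := by
  conv_lhs => rw [elemMap, codeCells_elemMap hab, dataBits_elemMap_of_ne hab j hij.symm, elemMap,
    addData_addData hab, ← Pi.single_add]
  rfl

lemma elemMap_zero (i j : Fin 3) (x : ℤ → A) : elemMap a b i j 0 x = x := by
  simp [elemMap, addData_zero]

lemma CellOp.add_self (T : CellOp) : T + T = 0 := by
  rw [← two_smul (ZMod 2) T, show (2 : ZMod 2) = 0 by decide, zero_smul]

/-- The elementary map as a permutation. -/
noncomputable def elemPerm (hab : a ≠ b) {i j : Fin 3} (hij : i ≠ j) (T : CellOp) :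
    Equiv.Perm (ℤ → A) :=
  Function.Involutive.toPerm (elemMap a b i j T) fun x => by
    rw [elemMap_elemMap hab hij, CellOp.add_self, elemMap_zero]

lemma elemPerm_apply (hab : a ≠ b) {i j : Fin 3} (hij : i ≠ j) (T : CellOp) (x : ℤ → A) :
    elemPerm hab hij T x = elemMap a b i j T x := rfl

lemma elemPerm_add (hab : a ≠ b) {i j : Fin 3} (hij : i ≠ j) (T S : CellOp) :
    elemPerm hab hij (T + S) = elemPerm hab hij T * elemPerm hab hij S :=
  Equiv.ext fun x => (elemMap_elemMap hab hij T S x).symm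

lemma elemPerm_zero (hab : a ≠ b) {i j : Fin 3} (hij : i ≠ j) :
    elemPerm hab hij (0 : CellOp) = 1 :=
  Equiv.ext fun x => elemMap_zero i j x

lemma elemPerm_mul_self (hab : a ≠ b) {i j : Fin 3} (hij : i ≠ j) (T : CellOp) :
    elemPerm hab hij T * elemPerm hab hij T = 1 := by
  rw [← elemPerm_add, CellOp.add_self, elemPerm_zero]

lemma elemPerm_comm (hab : a ≠ b) {i j i' j' : Fin 3} (hij : i ≠ j) (hij' : i' ≠ j')
    (h : i ≠ j') (h' : i' ≠ j) (T S : CellOp) :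
    elemPerm hab hij T * elemPerm hab hij' S = elemPerm hab hij' S * elemPerm hab hij T := by
  have key : ∀ {i j i' j' : Fin 3}, i' ≠ j → ∀ (T S : CellOp) (x : ℤ → A),
      elemMap a b i j T (elemMap a b i' j' S x) =
        addData a b (Pi.single i (T (codeCells a b x) (dataBits a b x j)) +
          Pi.single i' (S (codeCells a b x) (dataBits a b x j'))) x := by
    intro i j i' j' h T S x
    conv_lhs => rw [elemMap, codeCells_elemMap hab, dataBits_elemMap_of_ne hab j' h.symm, elemMap,
      addData_addData hab]
  refine Equiv.ext fun x => ?_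
  simp only [Equiv.Perm.mul_apply, elemPerm_apply]
  rw [key h', key h, add_comm]

/-- The Steinberg relation; elementary permutations are involutions. -/
lemma elemPerm_mul (hab : a ≠ b) {i j k : Fin 3} (hij : i ≠ j) (hjk : j ≠ k) (hik : i ≠ k)
    (T : CellOp) {S : CellOp} (hS : S.Supported) :
    elemPerm hab hik (T * S) = elemPerm hab hij T * elemPerm hab hjk S *
      elemPerm hab hij T * elemPerm hab hjk S := by
  refine Equiv.ext fun x => ?_
  simp only [Equiv.Perm.mul_apply, elemPerm_apply]
  set C := codeCells a b x with hC
  set v := dataBits a b x with hv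
  have hd : ∀ w : Fin 3 → ℤ → ZMod 2, w + w = 0 := fun w => by
    funext i p
    exact CharTwo.add_self_eq_zero _
  have e1 : elemMap a b j k S x = addData a b (Pi.single j (S C (v k))) x := rfl
  have c2 := dataBits_elemMap_self hab j k hS x
  rw [← hv, ← hC] at c2
  set y := elemMap a b j k S x with hy
  have cy : codeCells a b y = C := codeCells_elemMap hab _ _ _ _
  have e2 : elemMap a b i j T y =
      addData a b (Pi.single i (T C (v j + S C (v k)))) y := by
    rw [elemMap, cy, c2]
  have k3 : dataBits a b (elemMap a b i j T y) k = v k := by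
    rw [dataBits_elemMap_of_ne hab j hik.symm, hy, dataBits_elemMap_of_ne hab k hjk.symm]
  have j3 : dataBits a b (elemMap a b i j T y) j = v j + S C (v k) := by
    rw [dataBits_elemMap_of_ne hab j hij.symm, c2]
  have cz : codeCells a b (elemMap a b i j T y) = C := by rw [codeCells_elemMap hab, cy]
  set z := elemMap a b i j T y with hz
  have e3 : elemMap a b j k S z = addData a b (Pi.single j (S C (v k))) z := by
    rw [elemMap, cz, k3]
  have j4 : dataBits a b (elemMap a b j k S z) j = v j := by
    rw [dataBits_elemMap_self hab j k hS, cz, j3, k3]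
    funext p
    simp only [Pi.add_apply, add_assoc, CharTwo.add_self_eq_zero, add_zero]
  have e4 : elemMap a b i j T (elemMap a b j k S z) =
      addData a b (Pi.single i (T C (v j))) (elemMap a b j k S z) := by
    rw [elemMap, j4, codeCells_elemMap hab, cz]
  rw [e4, e3, e2, e1, addData_addData hab, addData_addData hab, addData_addData hab]
  rw [elemMap, ← hC, ← hv]
  congr 1
  rw [map_add, Pi.single_add]
  have : (T * S) C (v k) = T C (S C (v k)) := rfl
  rw [this]
  have h1 := hd (Pi.single i (T C (v j)))
  have h2 := hd (Pi.single j (S C (v k)))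
  linear_combination -h1 - h2

end CellCoding

section CellOperators

/-- The operator reading the bit `n` cells away in direction `ε`, if all the cells on the way
are present. -/
noncomputable def walkOp (ε : ℤ) (n : ℕ) : CellOp := fun C => open Classical in
  { toFun := fun v p => if ∀ t : ℕ, t ≤ n → p + 9 * ε * t ∈ C then v (p + 9 * ε * n) else 0
    map_add' := fun v w => by funext p; simp only [Pi.add_apply]; split_ifs <;> simp
    map_smul' := fun c v => by funext p; simp }

/-- The projection to the leftmost cells of runs of adjacent cells. -/
noncomputable def headOp : CellOp := fun C => open Classical in
  { toFun := fun v p => if p ∈ C ∧ p - 9 ∉ C then v p else 0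
    map_add' := fun v w => by funext p; simp only [Pi.add_apply]; split_ifs <;> simp
    map_smul' := fun c v => by funext p; simp }

open Classical in
lemma walkOp_apply (ε : ℤ) (n : ℕ) (C : Set ℤ) (v : ℤ → ZMod 2) (p : ℤ) :
    walkOp ε n C v p = if ∀ t : ℕ, t ≤ n → p + 9 * ε * t ∈ C then v (p + 9 * ε * n) else 0 := rfl

open Classical in
lemma headOp_apply (C : Set ℤ) (v : ℤ → ZMod 2) (p : ℤ) :
    headOp C v p = if p ∈ C ∧ p - 9 ∉ C then v p else 0 := rfl

lemma supported_walkOp (ε : ℤ) (n : ℕ) : (walkOp ε n).Supported := fun C v p hp => by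
  rw [walkOp_apply, if_neg]
  intro h
  exact hp (by simpa using h 0 (Nat.zero_le n))

lemma supported_headOp : headOp.Supported := fun C v p hp => by
  rw [headOp_apply, if_neg fun h => hp h.1]

lemma walkOp_mul (ε : ℤ) (m n : ℕ) : walkOp ε m * walkOp ε n = walkOp ε (m + n) := by
  funext C
  refine LinearMap.ext fun v => funext fun p => ?_
  change walkOp ε m C (walkOp ε n C v) p = _
  rw [walkOp_apply, walkOp_apply, walkOp_apply]
  by_cases h : ∀ t : ℕ, t ≤ m + n → p + 9 * ε * t ∈ C
  · rw [if_pos h, if_pos fun t ht => h t (by omega), if_pos]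
    · congr 1; push_cast; ring
    · intro t ht
      have := h (m + t) (by omega)
      push_cast at this
      convert this using 1; ring
  · rw [if_neg h]
    split_ifs with h1 h2
    · refine absurd (fun t ht => ?_) h
      rcases Nat.le_total t m with htm | htm
      · exact h1 t htm
      · have := h2 (t - m) (by omega)
        push_cast [htm] at this
        convert this using 1; ring
    · rfl
    · rfl

/-- The products of the operators going from the `i`-th cell of a long run to its head, and from
the head to the `j`-th cell, vanish for `i ≠ j`. -/
lemma head_walk_walk_head_eq_zero {n i j : ℕ} (hi : i ≤ n) (hij : i ≠ j) :
    (headOp * walkOp 1 n * walkOp (-1) (n - i)) * (walkOp (-1) j * headOp) = 0 := by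
  rw [mul_assoc, ← mul_assoc (walkOp (-1) (n - i)), walkOp_mul]
  funext C
  refine LinearMap.ext fun v => funext fun p => ?_
  change headOp C (walkOp 1 n C (walkOp (-1) (n - i + j) C (headOp C v))) p = 0
  rw [headOp_apply]
  split_ifs with h1
  swap
  · rfl
  rw [walkOp_apply]
  split_ifs with h2
  swap
  · rfl
  rw [walkOp_apply]
  split_ifs with h3
  swap
  · rfl
  rw [headOp_apply, if_neg]
  rintro ⟨-, h4⟩
  rcases Nat.lt_or_gt_of_ne hij with h | h
  · apply h1.2
    have := h3 (n + 1) (by omega)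
    push_cast at this
    convert this using 1; ring
  · apply h4
    have := h2 (i - j - 1) (by omega)
    convert this using 1
    have e : ((i - j - 1 : ℕ) : ℤ) = i - j - 1 := by omega
    have e' : ((n - i + j : ℕ) : ℤ) = n - i + j := by omega
    rw [e, e']; ring

lemma head_walk_walk_head_self {n i : ℕ} (hi : i ≤ n) :
    (headOp * walkOp 1 n * walkOp (-1) (n - i)) * (walkOp (-1) i * headOp) =
      headOp * walkOp 1 n * walkOp (-1) n * headOp := by
  rw [mul_assoc, ← mul_assoc (walkOp (-1) (n - i)), walkOp_mul, Nat.sub_add_cancel hi,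
    ← mul_assoc]

lemma head_walk_walk_head_apply {n : ℕ} {C : Set ℤ} {p : ℤ} (v : ℤ → ZMod 2) (hp : p - 9 ∉ C)
    (hC : ∀ t : ℕ, p + 9 * t ∈ C) :
    (headOp * walkOp 1 n * walkOp (-1) n * headOp) C v p = v p := by
  change headOp C (walkOp 1 n C (walkOp (-1) n C (headOp C v))) p = v p
  have h0 : p ∈ C := by simpa using hC 0
  rw [headOp_apply, if_pos ⟨h0, hp⟩, walkOp_apply, if_pos fun t _ => by simpa using hC t,
    walkOp_apply, if_pos, headOp_apply]
  · have : p + 9 * 1 * (n : ℤ) + 9 * -1 * n = p := by ring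
    rw [this, if_pos ⟨h0, hp⟩]
  · intro t ht
    have := hC (n - t)
    push_cast [ht] at this
    convert this using 1; ring

/-- Operators whose values depend only on the neighbouring cells and bits. -/
def CellOp.IsLocal (T : CellOp) : Prop :=
  ∀ C C' v v' p, (∀ t, |t - p| ≤ 9 → ((t ∈ C ↔ t ∈ C') ∧ v t = v' t)) → T C v p = T C' v' p

/-- Operators commuting with translations. -/
def CellOp.IsEquivariant (T : CellOp) : Prop :=
  ∀ C v p, T {q | q + 1 ∈ C} (fun q => v (q + 1)) p = T C v (p + 1)

lemma isLocal_walkOp {ε : ℤ} {n : ℕ} (hε : |ε| ≤ 1) (hn : n ≤ 1) : (walkOp ε n).IsLocal := by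
  intro C C' v v' p h
  have key : ∀ t : ℕ, t ≤ n → |p + 9 * ε * t - p| ≤ 9 := fun t ht => by
    have : t = 0 ∨ t = 1 := by omega
    rcases this with rfl | rfl
    · simp
    · rw [abs_le] at hε ⊢
      push_cast
      omega
  classical
  exact if_congr (forall_congr' fun t => imp_congr_right fun ht => (h _ (key t ht)).1)
    (h _ (key n le_rfl)).2 rfl

lemma isLocal_headOp : headOp.IsLocal := by
  intro C C' v v' p h
  classical
  exact if_congr (and_congr (h p (by simp)).1 (not_congr (h (p - 9) (by simp)).1))
    (h p (by simp)).2 rfl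

lemma isEquivariant_walkOp (ε : ℤ) (n : ℕ) : (walkOp ε n).IsEquivariant := by
  intro C v p
  classical
  refine if_congr (forall_congr' fun t => imp_congr_right fun _ => ?_) ?_ rfl
  · rw [Set.mem_ofPred_eq, add_right_comm p _ 1]
  · rw [add_right_comm p _ 1]

lemma isEquivariant_headOp : headOp.IsEquivariant := by
  intro C v p
  classical
  refine if_congr (and_congr Iff.rfl (not_congr ?_)) rfl rfl
  rw [Set.mem_ofPred_eq, sub_add_eq_add_sub]

/-- The operators that generate all the others. -/
noncomputable def genOp : Fin 5 → CellOp :=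
  ![walkOp 1 0, walkOp 1 1, walkOp (-1) 0, walkOp (-1) 1, headOp]

lemma isLocal_genOp (g : Fin 5) : (genOp g).IsLocal := by
  fin_cases g
  · exact isLocal_walkOp (by simp) (by simp)
  · exact isLocal_walkOp (by simp) (by simp)
  · exact isLocal_walkOp (by simp) (by simp)
  · exact isLocal_walkOp (by simp) (by simp)
  · exact isLocal_headOp

lemma isEquivariant_genOp (g : Fin 5) : (genOp g).IsEquivariant := by
  fin_cases g
  · exact isEquivariant_walkOp _ _
  · exact isEquivariant_walkOp _ _
  · exact isEquivariant_walkOp _ _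
  · exact isEquivariant_walkOp _ _
  · exact isEquivariant_headOp

end CellOperators

section Automorphisms

variable {A : Type*} {a b : A}

lemma mem_codeCells_congr {x y : ℤ → A} {p : ℤ} (h : ∀ t, p ≤ t → t ≤ p + 8 → x t = y t) :
    p ∈ codeCells a b x ↔ p ∈ codeCells a b y := by
  have h3 : ∀ i : Fin 3, x (p + 3 + 2 * (i : ℕ)) = y (p + 3 + 2 * (i : ℕ)) :=
    fun i => h _ (by omega) (by omega)
  simp only [codeCells, Set.mem_ofPred_eq, h3, h p (by omega) (by omega),
    h (p + 1) (by omega) (by omega), h (p + 2) (by omega) (by omega),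
    h (p + 4) (by omega) (by omega), h (p + 6) (by omega) (by omega),
    h (p + 8) (by omega) (by omega)]

lemma dataBits_congr {x y : ℤ → A} {p : ℤ} (h : ∀ t, p ≤ t → t ≤ p + 8 → x t = y t)
    (i : Fin 3) : dataBits a b x i p = dataBits a b y i p := by
  have h3 : x (p + 3 + 2 * (i : ℕ)) = y (p + 3 + 2 * (i : ℕ)) := h _ (by omega) (by omega)
  classical
  exact if_congr (and_congr (mem_codeCells_congr h) (by rw [h3])) rfl rfl

lemma elemMap_congr {T : CellOp} (hT : T.IsLocal) (i j : Fin 3) {x y : ℤ → A} {p : ℤ}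
    (h : ∀ t, |t - p| ≤ 20 → x t = y t) : elemMap a b i j T x p = elemMap a b i j T y p := by
  have hf : flipAmount (codeCells a b x)
        (Pi.single i (T (codeCells a b x) (dataBits a b x j))) p =
      flipAmount (codeCells a b y) (Pi.single i (T (codeCells a b y) (dataBits a b y j))) p := by
    refine Finset.sum_congr rfl fun k _ => ?_
    have hc : p - 3 - 2 * ((k : ℕ) : ℤ) ∈ codeCells a b x ↔
        p - 3 - 2 * ((k : ℕ) : ℤ) ∈ codeCells a b y :=
      mem_codeCells_congr fun t h1 h2 => h t (by rw [abs_le]; omega)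
    classical
    refine if_congr hc ?_ rfl
    rcases eq_or_ne k i with rfl | hk
    · rw [Pi.single_eq_same, Pi.single_eq_same]
      refine hT _ _ _ _ _ fun t ht => ?_
      rw [abs_le] at ht
      exact ⟨mem_codeCells_congr fun s h1 h2 => h s (by rw [abs_le]; omega),
        dataBits_congr (fun s h1 h2 => h s (by rw [abs_le]; omega)) j⟩
    · rw [Pi.single_eq_of_ne hk, Pi.single_eq_of_ne hk]
  rw [elemMap, addData, hf, h p (by simp)]
  rfl

lemma continuous_elemMap [TopologicalSpace A] [DiscreteTopology A] {T : CellOp} (hT : T.IsLocal)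
    (i j : Fin 3) : Continuous (elemMap a b i j T) := by
  refine continuous_pi fun p => ?_
  have hl : IsLocallyConstant fun x => elemMap a b i j T x p := by
    refine (IsLocallyConstant.iff_exists_open _).2 fun x =>
      ⟨Set.pi (Finset.Icc (p - 20) (p + 20) : Finset ℤ) fun t => {x t},
        isOpen_set_pi (Finset.finite_toSet _) fun t _ => isOpen_discrete _, by simp, ?_⟩
    intro y hy
    refine elemMap_congr hT i j fun t ht => hy t ?_
    rw [abs_le] at ht
    simp only [Finset.coe_Icc, Set.mem_Icc]
    omega
  exact hl.continuous

lemma codeCells_shiftMap (x : ℤ → A) :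
    codeCells a b (shiftMap A x) = {q | q + 1 ∈ codeCells a b x} := by
  ext p
  simp only [codeCells, shiftMap, Set.mem_ofPred_eq, add_right_comm p _ 1,
    add_right_comm (p + 3) _ 1]

lemma dataBits_shiftMap (x : ℤ → A) (j : Fin 3) :
    dataBits a b (shiftMap A x) j = fun q => dataBits a b x j (q + 1) := by
  funext p
  rw [dataBits, dataBits, codeCells_shiftMap]
  classical
  refine if_congr (and_congr Iff.rfl ?_) rfl rfl
  rw [shiftMap, add_right_comm (p + 3) _ 1, add_right_comm p _ 1]

lemma elemMap_shiftMap {T : CellOp} (hT : T.IsEquivariant) (i j : Fin 3) (x : ℤ → A) :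
    elemMap a b i j T (shiftMap A x) = shiftMap A (elemMap a b i j T x) := by
  have hf : ∀ p, flipAmount (codeCells a b (shiftMap A x))
      (Pi.single i (T (codeCells a b (shiftMap A x)) (dataBits a b (shiftMap A x) j))) p =
      flipAmount (codeCells a b x)
        (Pi.single i (T (codeCells a b x) (dataBits a b x j))) (p + 1) := by
    intro p
    refine Finset.sum_congr rfl fun k _ => ?_
    have e : p + 1 - 3 - 2 * ((k : ℕ) : ℤ) = p - 3 - 2 * ((k : ℕ) : ℤ) + 1 := by ring
    rw [codeCells_shiftMap, dataBits_shiftMap, e]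
    classical
    refine if_congr Iff.rfl ?_ rfl
    rcases eq_or_ne k i with rfl | hk
    · rw [Pi.single_eq_same, Pi.single_eq_same, hT]
    · rw [Pi.single_eq_of_ne hk, Pi.single_eq_of_ne hk]; rfl
  funext p
  rw [elemMap, addData, hf]
  rfl

lemma elemPerm_mem_fullShiftAut [TopologicalSpace A] [DiscreteTopology A] (hab : a ≠ b)
    {i j : Fin 3} (hij : i ≠ j) {T : CellOp} (hT : T.IsLocal) (hT' : T.IsEquivariant) :
    elemPerm hab hij T ∈ FullShiftAut A :=
  ⟨continuous_elemMap hT i j, continuous_elemMap hT i j, elemMap_shiftMap hT' i j⟩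

/-- The long-run projection acts nontrivially. -/
lemma elemPerm_head_walk_walk_head_ne_one (hab : a ≠ b) {i j : Fin 3} (hij : i ≠ j) (n : ℕ) :
    elemPerm hab hij (headOp * walkOp 1 n * walkOp (-1) n * headOp) ≠ 1 := by
  set w := headOp * walkOp 1 n * walkOp (-1) n * headOp with hw
  have hws : w.Supported := ((supported_headOp.mul _).mul _).mul _
  let x : ℤ → A := fun p => if 0 ≤ p ∧ (p % 9 = 0 ∨ p % 9 = 1) then a else b
  have hC : ∀ t : ℕ, (0 : ℤ) + 9 * t ∈ codeCells a b x := by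
    intro t
    refine ⟨if_pos ?_, if_pos ?_, if_neg ?_, if_neg ?_, if_neg ?_, if_neg ?_,
      fun k => Or.inr (if_neg ?_)⟩ <;> omega
  have h9 : (0 : ℤ) - 9 ∉ codeCells a b x := fun h => by
    have := h.1
    simp only [x] at this
    norm_num at this
    exact hab this.symm
  intro h
  have h1 := dataBits_elemMap_self hab i j hws x
  rw [← elemPerm_apply hab hij, h, Equiv.Perm.one_apply] at h1
  have h2 := congrFun h1 0
  rw [Pi.add_apply, head_walk_walk_head_apply _ h9 hC, left_eq_add, dataBits, if_pos] at h2
  · exact one_ne_zero h2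
  · refine ⟨by simpa using hC 0, if_neg ?_⟩
    omega

end Automorphisms

section Heisenberg

/-- Two orthogonal subspaces of `𝔽₂ⁿ` have together at most `2 ^ n` pairs of elements. -/
lemma card_mul_card_le_of_dotProduct_eq_zero {n : ℕ} (P Q : AddSubgroup (Fin n → ZMod 2))
    (h : ∀ v ∈ P, ∀ w ∈ Q, v ⬝ᵥ w = 0) : Nat.card P * Nat.card Q ≤ 2 ^ n := by
  set P' : Submodule (ZMod 2) (Fin n → ZMod 2) := AddSubgroup.toZModSubmodule 2 P with hP'
  set Q' : Submodule (ZMod 2) (Fin n → ZMod 2) := AddSubgroup.toZModSubmodule 2 Q with hQ'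
  have e1 : Nat.card P = 2 ^ Module.finrank (ZMod 2) P' := by
    have := Module.natCard_eq_pow_finrank (K := ZMod 2) (V := P')
    rwa [Nat.card_zmod] at this
  have e2 : Nat.card Q = 2 ^ Module.finrank (ZMod 2) Q' := by
    have := Module.natCard_eq_pow_finrank (K := ZMod 2) (V := Q')
    rwa [Nat.card_zmod] at this
  have hle : Q'.map (dotProductEquiv (ZMod 2) (Fin n)).toLinearMap ≤ P'.dualAnnihilator := by
    rintro _ ⟨w, hw, rfl⟩
    rw [Submodule.mem_dualAnnihilator]
    intro v hv
    change w ⬝ᵥ v = 0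
    rw [dotProduct_comm]
    exact h v hv w hw
  have h1 := Submodule.finrank_mono hle
  rw [LinearEquiv.finrank_map_eq] at h1
  have h2 := Subspace.finrank_add_finrank_dualAnnihilator_eq P'
  rw [Module.finrank_fin_fun] at h2
  rw [e1, e2, ← pow_add]
  exact Nat.pow_le_pow_right (by norm_num) (by omega)

lemma card_le_card_mul_card_of_fibers {V W : Type*} [AddCommGroup V] [Finite W]
    (S : AddSubgroup V) (f : V → W) (hf : ∀ v w, f v = f w → v - w ∈ S) :
    Nat.card V ≤ Nat.card W * Nat.card S := by
  rw [AddSubgroup.card_eq_card_quotient_mul_card_addSubgroup S]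
  refine Nat.mul_le_mul_right _ (Nat.card_le_card_of_injective (fun q : V ⧸ S => f q.out) ?_)
  intro q q' h
  have := hf _ _ h
  rw [← QuotientAddGroup.out_eq' q, ← QuotientAddGroup.out_eq' q', QuotientAddGroup.eq]
  convert S.neg_mem this using 1
  abel

/-- A function on the Heisenberg group over `𝔽₂ⁿ` that separates the centre takes many values:
if right translations by the two abelian subgroups only depend on labels in `W`, then there are at
least `2 ^ (n / 2)` labels. -/
lemma two_pow_le_card_sq_of_heisenberg {n : ℕ} {B W : Type*} [Finite W]
    (τ : (Fin n → ZMod 2) → (Fin n → ZMod 2) → ZMod 2 → B) (f g : (Fin n → ZMod 2) → W)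
    (hz : τ 0 0 1 ≠ τ 0 0 0)
    (hf : ∀ I I', f I = f I' → ∀ K J c, τ (K + I) J (c + I ⬝ᵥ J) = τ (K + I') J (c + I' ⬝ᵥ J))
    (hg : ∀ J J', g J = g J' → ∀ I K c, τ I (K + J) c = τ I (K + J') c) :
    2 ^ n ≤ Nat.card W ^ 2 := by
  let P : AddSubgroup (Fin n → ZMod 2) :=
    { carrier := {I | ∀ K J c, τ (K + I) J (c + I ⬝ᵥ J) = τ K J c}
      zero_mem' := fun K J c => by simp
      add_mem' := fun {I I'} h h' K J c => by
        have := (h' (K + I) J (c + I ⬝ᵥ J)).trans (h K J c)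
        rwa [add_assoc, add_assoc, ← add_dotProduct] at this
      neg_mem' := fun {I} h K J c => by
        have := h (K + -I) J (c + (-I) ⬝ᵥ J)
        rw [add_assoc, add_assoc, ← add_dotProduct, neg_add_cancel, zero_dotProduct, add_zero,
          add_zero] at this
        exact this.symm }
  let Q : AddSubgroup (Fin n → ZMod 2) :=
    { carrier := {J | ∀ I K c, τ I (K + J) c = τ I K c}
      zero_mem' := fun I K c => by simp
      add_mem' := fun {J J'} h h' I K c => by
        rw [← add_assoc]
        exact (h' I (K + J) c).trans (h I K c)
      neg_mem' := fun {J} h I K c => by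
        have := h I (K + -J) c
        rw [add_assoc, neg_add_cancel, add_zero] at this
        exact this.symm }
  have hP : ∀ I I', f I = f I' → I - I' ∈ P := fun I I' h K J c => by
    have := hf I I' h (K - I') J (c - I' ⬝ᵥ J)
    rw [sub_add_cancel, sub_add_cancel] at this
    rw [← this, sub_dotProduct]
    congr 1 <;> abel
  have hQ : ∀ J J', g J = g J' → J - J' ∈ Q := fun J J' h I K c => by
    have := hg J J' h I (K - J') c
    rw [sub_add_cancel] at this
    rw [← this]
    congr 1
    abel
  have horth : ∀ I ∈ P, ∀ J ∈ Q, I ⬝ᵥ J = 0 := by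
    intro I hI J hJ
    have h1 := hI 0 J 0
    have h2 := hJ I 0 (0 + I ⬝ᵥ J)
    have h3 := hI 0 0 (I ⬝ᵥ J)
    have h4 := hJ 0 0 0
    simp only [zero_add, dotProduct_zero, add_zero] at h1 h2 h3 h4
    have h5 : τ 0 0 (I ⬝ᵥ J) = τ 0 0 0 := by rw [← h3, ← h2, h1, h4]
    have two : ∀ d : ZMod 2, d = 0 ∨ d = 1 := by decide
    rcases two (I ⬝ᵥ J) with h | h
    · exact h
    · exact absurd (h ▸ h5) hz
  have c1 := card_le_card_mul_card_of_fibers P f hP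
  have c2 := card_le_card_mul_card_of_fibers Q g hQ
  have c3 := card_mul_card_le_of_dotProduct_eq_zero P Q horth
  have cV : Nat.card (Fin n → ZMod 2) = 2 ^ n := by simp
  rw [cV] at c1 c2
  have : 2 ^ n * 2 ^ n ≤ Nat.card W ^ 2 * 2 ^ n := calc
    2 ^ n * 2 ^ n ≤ (Nat.card W * Nat.card P) * (Nat.card W * Nat.card Q) := Nat.mul_le_mul c1 c2
    _ = Nat.card W ^ 2 * (Nat.card P * Nat.card Q) := by ring
    _ ≤ Nat.card W ^ 2 * 2 ^ n := Nat.mul_le_mul_left _ c3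
  exact Nat.le_of_mul_le_mul_right this (by positivity)

end Heisenberg

section Radius

variable {B : Type*} {X : Set (ℤ → B)}

/-- A permutation of `X` has radius `r` if every coordinate of the image is determined by the
coordinates at distance at most `r`. -/
def HasRadius (f : Equiv.Perm X) (r : ℕ) : Prop :=
  ∀ (x y : X) (i : ℤ), (∀ j, |j - i| ≤ r → x.1 j = y.1 j) → (f x).1 i = (f y).1 i

lemma HasRadius.mono {f : Equiv.Perm X} {r s : ℕ} (hf : HasRadius f r) (h : r ≤ s) :
    HasRadius f s := fun x y i hxy => hf x y i fun j hj => hxy j (hj.trans (by exact_mod_cast h))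

lemma HasRadius.mul {f g : Equiv.Perm X} {r s : ℕ} (hf : HasRadius f r) (hg : HasRadius g s) :
    HasRadius (f * g) (r + s) := by
  refine fun x y i hxy => hf _ _ i fun j hj => hg x y j fun k hk => hxy k ?_
  rw [abs_le] at *
  push_cast
  omega

lemma hasRadius_one : HasRadius (1 : Equiv.Perm X) 0 := fun x y i hxy => hxy i (by simp)

lemma translate_mem (hX : shiftMap B '' X = X) (i : ℤ) :
    ∀ x ∈ X, (fun j => x (j + i)) ∈ X := by
  have hs : ∀ x ∈ X, shiftMap B x ∈ X := fun x hx => hX ▸ Set.mem_image_of_mem _ hx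
  have hp : ∀ x ∈ X, (fun j => x (j - 1)) ∈ X := fun x hx => by
    rw [← hX] at hx
    obtain ⟨y, hy, rfl⟩ := hx
    simpa [shiftMap] using hy
  induction i with
  | zero => intro x hx; simpa using hx
  | succ i ih =>
    intro x hx
    convert hs _ (ih x hx) using 1
    funext j
    simp only [shiftMap]
    congr 1; ring
  | pred i ih =>
    intro x hx
    convert hp _ (ih x hx) using 1
    funext j
    congr 1; ring

variable [TopologicalSpace B]

lemma subshiftAut_translate (hX : shiftMap B '' X = X) {f : Equiv.Perm X} (hf : f ∈ SubshiftAut X)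
    (i : ℤ) : ∀ x y : X, (y.1 = fun j => x.1 (j + i)) → (f y).1 = fun j => (f x).1 (j + i) := by
  induction i with
  | zero =>
    intro x y h
    have : y = x := Subtype.ext (by simpa using h)
    simp [this]
  | succ i ih =>
    intro x y h
    have h1 := ih x ⟨_, translate_mem hX i x.1 x.2⟩ rfl
    rw [hf.2.2 ⟨_, translate_mem hX i x.1 x.2⟩ y (by
      rw [h]; funext j; simp only [shiftMap]; ring_nf), h1]
    funext j
    simp only [shiftMap]
    ring_nf
  | pred i ih =>
    intro x y h
    have h1 := ih x ⟨_, translate_mem hX (-i) x.1 x.2⟩ rfl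
    have h2 := hf.2.2 y ⟨_, translate_mem hX (-i) x.1 x.2⟩ (by
      rw [h]; funext j; simp only [shiftMap]; ring_nf)
    rw [h1] at h2
    funext j
    have := congrFun h2 (j - 1)
    simp only [shiftMap, sub_add_cancel] at this
    rw [← this]
    ring_nf

/-- The Curtis–Hedlund–Lyndon theorem: automorphisms of subshifts have finite radius. -/
lemma exists_hasRadius [DiscreteTopology B] [Finite B] (hX : IsSubshift X) {f : Equiv.Perm X}
    (hf : f ∈ SubshiftAut X) : ∃ r, HasRadius f r := by
  have : CompactSpace X := isCompact_iff_compactSpace.1 hX.1.isCompact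
  have key : ∃ r : ℕ, ∀ x y : X, (∀ j, |j| ≤ (r : ℤ) → x.1 j = y.1 j) → (f x).1 0 = (f y).1 0 := by
    by_contra! hcon
    let K : ℕ → Set (X × X) := fun r =>
      {q | (∀ j, |j| ≤ (r : ℤ) → q.1.1 j = q.2.1 j) ∧ (f q.1).1 0 ≠ (f q.2).1 0}
    have hclosed : ∀ r, IsClosed (K r) := by
      intro r
      have hK : K r = (⋂ j : ℤ, ⋂ _ : |j| ≤ (r : ℤ), {q : X × X | q.1.1 j = q.2.1 j}) ∩
          {q | (f q.1).1 0 ≠ (f q.2).1 0} := by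
        ext q
        simp [K]
      rw [hK]
      refine IsClosed.inter ?_ ?_
      · refine isClosed_iInter fun j => isClosed_iInter fun _ => isClosed_eq ?_ ?_
        · exact (continuous_apply j).comp (continuous_subtype_val.comp continuous_fst)
        · exact (continuous_apply j).comp (continuous_subtype_val.comp continuous_snd)
      · have h1 : Continuous fun q : X × X => ((f q.1).1 0, (f q.2).1 0) := by
          refine Continuous.prodMk ?_ ?_
          · exact (continuous_apply 0).comp
              (continuous_subtype_val.comp (hf.1.comp continuous_fst))
          · exact (continuous_apply 0).comp
              (continuous_subtype_val.comp (hf.1.comp continuous_snd))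
        exact (isClosed_discrete {q : B × B | q.1 ≠ q.2}).preimage h1
    obtain ⟨q, hq⟩ := IsCompact.nonempty_iInter_of_directed_nonempty_isCompact_isClosed K
      (directed_of_isDirected_le fun r s hrs q hq =>
        ⟨fun j hj => hq.1 j (hj.trans (by exact_mod_cast hrs)), hq.2⟩)
      (fun r => by
        obtain ⟨x, y, h1, h2⟩ := hcon r
        exact ⟨(x, y), h1, h2⟩)
      (fun r => (hclosed r).isCompact) hclosed
    rw [Set.mem_iInter] at hq
    have hxy : q.1 = q.2 := Subtype.ext (funext fun j =>
      (hq j.natAbs).1 j (by rw [Int.abs_eq_natAbs]))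
    exact (hq 0).2 (by rw [hxy])
  obtain ⟨r, hr⟩ := key
  refine ⟨r, fun x y i hxy => ?_⟩
  have hx := subshiftAut_translate hX.2 hf i x ⟨_, translate_mem hX.2 i x.1 x.2⟩ rfl
  have hy := subshiftAut_translate hX.2 hf i y ⟨_, translate_mem hX.2 i y.1 y.2⟩ rfl
  have := hr ⟨_, translate_mem hX.2 i x.1 x.2⟩ ⟨_, translate_mem hX.2 i y.1 y.2⟩
    fun j hj => hxy (j + i) (by simpa using hj)
  rw [hx, hy] at this
  simpa using this

end Radius

section Cost

variable {G : Type*} [Group G] {H : Subgroup G} {B : Type*} {X : Set (ℤ → B)}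

/-- The element `g` lies in `H` and is mapped to a permutation of radius `r`. -/
def ActsWithRadius (φ : H →* Equiv.Perm X) (g : G) (r : ℕ) : Prop :=
  ∃ h : g ∈ H, HasRadius (φ ⟨g, h⟩) r

variable {φ : H →* Equiv.Perm X}

lemma ActsWithRadius.mono {g : G} {r s : ℕ} (hg : ActsWithRadius φ g r) (h : r ≤ s) :
    ActsWithRadius φ g s := ⟨hg.1, hg.2.mono h⟩

lemma ActsWithRadius.mul {g g' : G} {r s : ℕ} (hg : ActsWithRadius φ g r)
    (hg' : ActsWithRadius φ g' s) : ActsWithRadius φ (g * g') (r + s) := by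
  obtain ⟨h, hr⟩ := hg
  obtain ⟨h', hs⟩ := hg'
  refine ⟨H.mul_mem h h', ?_⟩
  have : (⟨g * g', H.mul_mem h h'⟩ : H) = ⟨g, h⟩ * ⟨g', h'⟩ := rfl
  rw [this, map_mul]
  exact hr.mul hs

lemma actsWithRadius_one : ActsWithRadius φ 1 0 := by
  refine ⟨H.one_mem, ?_⟩
  have : (⟨1, H.one_mem⟩ : H) = 1 := rfl
  rw [this, map_one]
  exact hasRadius_one

end Cost

section ElementaryCost

variable {A : Type*} {a b : A} {H : Subgroup (Equiv.Perm (ℤ → A))} {B : Type*} {X : Set (ℤ → B)}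

/-- All elementary permutations with the operator `T` act with radius `r`. -/
def OpRadius (hab : a ≠ b) (φ : H →* Equiv.Perm X) (T : CellOp) (r : ℕ) : Prop :=
  ∀ (i j : Fin 3) (hij : i ≠ j), ActsWithRadius φ (elemPerm hab hij T) r

variable {hab : a ≠ b} {φ : H →* Equiv.Perm X}

lemma OpRadius.mono {T : CellOp} {r s : ℕ} (hT : OpRadius hab φ T r) (h : r ≤ s) :
    OpRadius hab φ T s := fun i j hij => (hT i j hij).mono h

lemma OpRadius.mul {T S : CellOp} {r s : ℕ} (hT : OpRadius hab φ T r) (hS : OpRadius hab φ S s)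
    (hS' : S.Supported) : OpRadius hab φ (T * S) (2 * (r + s)) := by
  intro i k hik
  obtain ⟨j, hij, hjk⟩ : ∃ j : Fin 3, i ≠ j ∧ j ≠ k := by
    revert i k
    decide
  rw [elemPerm_mul hab hij hjk hik T hS']
  exact ((((hT i j hij).mul (hS j k hjk)).mul (hT i j hij)).mul (hS j k hjk)).mono (by omega)

lemma OpRadius.add {T S : CellOp} {r s : ℕ} (hT : OpRadius hab φ T r)
    (hS : OpRadius hab φ S s) : OpRadius hab φ (T + S) (r + s) := fun i j hij => by
  rw [elemPerm_add]
  exact (hT i j hij).mul (hS i j hij)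

lemma opRadius_zero : OpRadius hab φ 0 0 := fun i j hij => by
  rw [elemPerm_zero]
  exact actsWithRadius_one

lemma OpRadius.smul {T : CellOp} {r : ℕ} (hT : OpRadius hab φ T r) (c : ZMod 2) :
    OpRadius hab φ (c • T) r := by
  have two : ∀ d : ZMod 2, d = 0 ∨ d = 1 := by decide
  rcases two c with rfl | rfl
  · rw [zero_smul]
    exact opRadius_zero.mono (Nat.zero_le r)
  · rwa [one_smul]

lemma opRadius_sum {ι : Type*} (s : Finset ι) {T : ι → CellOp} {r : ℕ}
    (hT : ∀ i ∈ s, OpRadius hab φ (T i) r) : OpRadius hab φ (∑ i ∈ s, T i) (s.card * r) := by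
  classical
  induction s using Finset.induction_on with
  | empty => simpa using opRadius_zero
  | insert i s hi ih =>
    rw [Finset.sum_insert hi, Finset.card_insert_of_notMem hi]
    exact ((hT i (by simp)).add (ih fun j hj => hT j (by simp [hj]))).mono (by ring_nf; rfl)

lemma opRadius_walkOp {ε : ℤ} {ρ : ℕ} (h0 : OpRadius hab φ (walkOp ε 0) ρ)
    (h1 : OpRadius hab φ (walkOp ε 1) ρ) (m : ℕ) :
    ∀ n, n ≤ 2 ^ m → OpRadius hab φ (walkOp ε n) (4 ^ m * ρ) := by
  induction m with
  | zero =>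
    intro n hn
    have : n = 0 ∨ n = 1 := by simp at hn; omega
    rcases this with rfl | rfl
    · simpa using h0
    · simpa using h1
  | succ m ih =>
    intro n hn
    rw [pow_succ] at hn
    have h := (ih (n / 2) (by omega)).mul (ih (n - n / 2) (by omega)) (supported_walkOp _ _)
    rw [walkOp_mul, Nat.add_sub_cancel' (Nat.div_le_self n 2)] at h
    exact h.mono (by rw [pow_succ]; ring_nf; rfl)

end ElementaryCost

section WordCount

variable {A : Type*} {a b : A} {H : Subgroup (Equiv.Perm (ℤ → A))} {B : Type*}
  [TopologicalSpace B] [Finite B] {X : Set (ℤ → B)}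

/-- If the generating elementary permutations act with radius `ρ`, then `X` has many words. -/
lemma two_pow_le_wordCount_sq (hab : a ≠ b) (hX : IsSubshift X) (φ : H →* Equiv.Perm X)
    (hφ : Function.Injective φ) (haut : ∀ h, φ h ∈ SubshiftAut X) {ρ : ℕ}
    (hgen : ∀ g, OpRadius hab φ (genOp g) ρ) (m k : ℕ) (hk : 84 * 8 ^ m * ρ + 1 ≤ k) :
    2 ^ 2 ^ m ≤ wordCount X k ^ 2 := by
  set n := 2 ^ m with hn
  have hup : ∀ t ≤ n, OpRadius hab φ (walkOp 1 t) (4 ^ m * ρ) :=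
    opRadius_walkOp (hgen 0) (hgen 1) m
  have hdown : ∀ t ≤ n, OpRadius hab φ (walkOp (-1) t) (4 ^ m * ρ) :=
    opRadius_walkOp (hgen 2) (hgen 3) m
  have hρ : ρ ≤ 4 ^ m * ρ := Nat.le_mul_of_pos_left ρ (by positivity)
  have hhead : OpRadius hab φ headOp (4 ^ m * ρ) := (hgen 4).mono hρ
  let r : Fin n → CellOp := fun i => headOp * walkOp 1 n * walkOp (-1) (n - i)
  let q : Fin n → CellOp := fun j => walkOp (-1) j * headOp
  let w : CellOp := headOp * walkOp 1 n * walkOp (-1) n * headOp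
  have hr : ∀ i, OpRadius hab φ (r i) (10 * (4 ^ m * ρ)) := fun i =>
    ((hhead.mul (hup n le_rfl) (supported_walkOp _ _)).mul (hdown _ (Nat.sub_le _ _))
      (supported_walkOp _ _)).mono (by omega)
  have hq : ∀ j, OpRadius hab φ (q j) (4 * (4 ^ m * ρ)) := fun j =>
    ((hdown j j.2.le).mul hhead supported_headOp).mono (by omega)
  have hqs : ∀ j, (q j).Supported := fun j => (supported_walkOp _ _).mul _
  have hrq : ∀ i j, r i * q j = if i = j then w else 0 := fun i j => by
    split_ifs with h
    · subst h
      exact head_walk_walk_head_self i.2.le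
    · exact head_walk_walk_head_eq_zero i.2.le fun h' => h (Fin.ext h')
  have hw : OpRadius hab φ w (28 * (4 ^ m * ρ)) :=
    (((hhead.mul (hup n le_rfl) (supported_walkOp _ _)).mul (hdown n le_rfl)
      (supported_walkOp _ _)).mul hhead supported_headOp).mono (by omega)
  let R : (Fin n → ZMod 2) → CellOp := fun I => ∑ i, I i • r i
  let S : (Fin n → ZMod 2) → CellOp := fun J => ∑ j, J j • q j
  have hSs : ∀ J, (S J).Supported := fun J =>
    CellOp.supported_sum _ fun j _ => (hqs j).smul _
  have hRS : ∀ I J, R I * S J = (I ⬝ᵥ J) • w := fun I J => by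
    simp only [R, S, Finset.sum_mul_sum, smul_mul_smul_comm, hrq, dotProduct, Finset.sum_smul]
    refine Finset.sum_congr rfl fun i _ => ?_
    simp [smul_ite]
  have h01 : (0 : Fin 3) ≠ 1 := by decide
  have h12 : (1 : Fin 3) ≠ 2 := by decide
  have h02 : (0 : Fin 3) ≠ 2 := by decide
  have h84 : n * (4 ^ m * ρ) = 8 ^ m * ρ := by
    rw [hn, ← mul_assoc, ← mul_pow]
    norm_num
  have h48 : 4 ^ m * ρ ≤ 8 ^ m * ρ := Nat.mul_le_mul_right _ (Nat.pow_le_pow_left (by norm_num) m)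
  have hP : ∀ I, ActsWithRadius φ (elemPerm hab h01 (R I)) (10 * (8 ^ m * ρ)) := fun I => by
    refine (opRadius_sum Finset.univ fun i _ => (hr i).smul (I i)).mono ?_ 0 1 h01
    rw [Finset.card_univ, Fintype.card_fin, ← h84]
    exact le_of_eq (by ring)
  have hQ : ∀ J, ActsWithRadius φ (elemPerm hab h12 (S J)) (4 * (8 ^ m * ρ)) := fun J => by
    refine (opRadius_sum Finset.univ fun j _ => (hq j).smul (J j)).mono ?_ 1 2 h12
    rw [Finset.card_univ, Fintype.card_fin, ← h84]
    exact le_of_eq (by ring)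
  have hZ : ∀ c : ZMod 2, ActsWithRadius φ (elemPerm hab h02 (c • w)) (28 * (8 ^ m * ρ)) :=
    fun c => (hw.smul c).mono (by omega) 0 2 h02
  let P : (Fin n → ZMod 2) → H := fun I => ⟨_, (hP I).1⟩
  let Q : (Fin n → ZMod 2) → H := fun J => ⟨_, (hQ J).1⟩
  let Z : ZMod 2 → H := fun c => ⟨_, (hZ c).1⟩
  have hPadd : ∀ I I', P I * P I' = P (I + I') := fun I I' => Subtype.ext <| by
    change elemPerm hab h01 (R I) * elemPerm hab h01 (R I') = elemPerm hab h01 (R (I + I'))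
    rw [← elemPerm_add]
    simp [R, add_smul, Finset.sum_add_distrib]
  have hQadd : ∀ J J', Q J * Q J' = Q (J + J') := fun J J' => Subtype.ext <| by
    change elemPerm hab h12 (S J) * elemPerm hab h12 (S J') = elemPerm hab h12 (S (J + J'))
    rw [← elemPerm_add]
    simp [S, add_smul, Finset.sum_add_distrib]
  have hZadd : ∀ c c', Z c * Z c' = Z (c + c') := fun c c' => Subtype.ext <| by
    change elemPerm hab h02 (c • w) * elemPerm hab h02 (c' • w) =
      elemPerm hab h02 ((c + c') • w)
    rw [← elemPerm_add, add_smul]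
  have hZP : ∀ c I, Z c * P I = P I * Z c := fun c I => Subtype.ext <|
    elemPerm_comm hab h02 h01 h01 h02 _ _
  have hZQ : ∀ c J, Z c * Q J = Q J * Z c := fun c J => Subtype.ext <|
    elemPerm_comm hab h02 h12 h02 h12 _ _
  have hPP : ∀ I, P I * P I = 1 := fun I => Subtype.ext (elemPerm_mul_self hab h01 _)
  have hQQ : ∀ J, Q J * Q J = 1 := fun J => Subtype.ext (elemPerm_mul_self hab h12 _)
  have hPQ : ∀ I J, P I * Q J * P I * Q J = Z (I ⬝ᵥ J) := fun I J => Subtype.ext <| by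
    change elemPerm hab h01 (R I) * elemPerm hab h12 (S J) * elemPerm hab h01 (R I) *
      elemPerm hab h12 (S J) = elemPerm hab h02 ((I ⬝ᵥ J) • w)
    rw [← elemPerm_mul hab h01 h12 h02 _ (hSs J), hRS]
  have hQP : ∀ I J, Q J * P I = P I * Q J * Z (I ⬝ᵥ J) := fun I J => by
    calc Q J * P I = (P I * P I) * (Q J * P I) * (Q J * Q J) := by rw [hPP, hQQ, one_mul, mul_one]
      _ = P I * (P I * Q J * P I * Q J) * Q J := by group
      _ = P I * Q J * Z (I ⬝ᵥ J) := by rw [hPQ, mul_assoc, hZQ, mul_assoc]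
  have hmulP : ∀ K J c I, P K * Q J * Z c * P I = P (K + I) * Q J * Z (c + I ⬝ᵥ J) :=
    fun K J c I => by
      rw [mul_assoc _ (Z c), hZP, ← mul_assoc, mul_assoc (P K), hQP, ← hPadd, add_comm c,
        ← hZadd]
      group
  have hmulQ : ∀ I K c J, P I * Q K * Z c * Q J = P I * Q (K + J) * Z c := fun I K c J => by
    rw [mul_assoc _ (Z c), hZQ, ← hQadd]
    group
  have hone : P 0 = 1 ∧ Q 0 = 1 ∧ Z 0 = 1 := by
    refine ⟨?_, ?_, ?_⟩
    · simpa using hPadd 0 0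
    · simpa using hQadd 0 0
    · simpa using hZadd 0 0
  have hZ1 : Z 1 ≠ 1 := fun h => by
    have h' := congrArg Subtype.val h
    change elemPerm hab h02 ((1 : ZMod 2) • w) = 1 at h'
    rw [one_smul] at h'
    exact elemPerm_head_walk_walk_head_ne_one hab h02 n h'
  obtain ⟨x, hx⟩ : ∃ x : X, (φ (Z 1) x).1 0 ≠ x.1 0 := by
    by_contra! hcon
    refine hZ1 (hφ ?_)
    rw [map_one]
    refine Equiv.ext fun x => Subtype.ext (funext fun i => ?_)
    have h1 := hcon ⟨_, translate_mem hX.2 i x.1 x.2⟩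
    rw [subshiftAut_translate hX.2 (haut (Z 1)) i x ⟨_, translate_mem hX.2 i x.1 x.2⟩ rfl] at h1
    simpa using h1
  set K := 42 * (8 ^ m * ρ) with hK
  have hkK : 2 * K + 1 ≤ k := le_trans (le_of_eq (by rw [hK]; ring)) hk
  have hrad : ∀ I J c, HasRadius (φ (P I * Q J * Z c)) K := fun I J c =>
    ((((hP I).mul (hQ J)).mul (hZ c)).mono (by omega)).2
  let W := {u : Fin k → B | ∃ x ∈ X, ∃ i : ℤ, ∀ j : Fin k, x (i + (j : ℤ)) = u j}
  let window : X → W := fun y => ⟨fun j => y.1 (-K + j), y.1, y.2, -K, fun j => rfl⟩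
  have hwindow : ∀ y y' : X, window y = window y' → ∀ I J c,
      (φ (P I * Q J * Z c) y).1 0 = (φ (P I * Q J * Z c) y').1 0 := by
    intro y y' h I J c
    refine hrad I J c y y' 0 fun j hj => ?_
    rw [sub_zero, abs_le] at hj
    have h1 : (window y).1 ⟨(j + K).toNat, by omega⟩ = (window y').1 ⟨(j + K).toNat, by omega⟩ := by
      rw [h]
    have e : -(K : ℤ) + ((j + K).toNat : ℤ) = j := by omega
    simpa only [window, e] using h1
  have := two_pow_le_card_sq_of_heisenberg (W := W)
    (fun I J c => (φ (P I * Q J * Z c) x).1 0)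
    (fun I => window (φ (P I) x)) (fun J => window (φ (Q J) x))
    (by simpa [hone] using hx)
    (fun I I' h K J c => by
      have := hwindow _ _ h K J c
      rwa [← Equiv.Perm.mul_apply, ← Equiv.Perm.mul_apply, ← map_mul, ← map_mul, hmulP, hmulP]
        at this)
    (fun J J' h I K c => by
      have := hwindow _ _ h I K c
      rwa [← Equiv.Perm.mul_apply, ← Equiv.Perm.mul_apply, ← map_mul, ← map_mul, hmulQ, hmulQ]
        at this)
  rwa [Nat.card_coe_set_eq] at this

end WordCount

section EntropyDimension

lemma wordCount_le_pow {B : Type*} [Fintype B] (X : Set (ℤ → B)) (k : ℕ) :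
    wordCount X k ≤ Fintype.card B ^ k := by
  refine (Set.ncard_le_card _).trans ?_
  simp

lemma quarter_le_lowerEntropyDim {B : Type*} [Fintype B] {X : Set (ℤ → B)} {c : ℕ} (hc : 0 < c)
    (h : ∀ m k, c * 8 ^ m ≤ k → 2 ^ 2 ^ m ≤ wordCount X k ^ 2) :
    (1 : ℝ) / 4 ≤ lowerEntropyDim X := by
  have hev : ∀ᶠ k : ℕ in Filter.atTop,
      (1 : ℝ) / 4 ≤ Real.logb 2 (Real.logb 2 (wordCount X k)) / Real.logb 2 k ∧
        Real.logb 2 (Real.logb 2 (wordCount X k)) / Real.logb 2 k ≤ 1 + Fintype.card B := by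
    filter_upwards [Filter.eventually_ge_atTop (c * 8 ^ (c + 7))] with k hk
    set m := Nat.log 8 (k / c) with hm
    have hk' : 8 ^ (c + 7) ≤ k / c := (Nat.le_div_iff_mul_le hc).2 (by linarith)
    have hkc0 : k / c ≠ 0 := by
      have : 0 < 8 ^ (c + 7) := by positivity
      omega
    have hmc : c + 7 ≤ m := Nat.le_log_of_pow_le (by norm_num) hk'
    have hm1 : 8 ^ m ≤ k / c := Nat.pow_log_le_self 8 hkc0
    have hm2 : k / c < 8 ^ (m + 1) := Nat.lt_pow_succ_log_self (by norm_num) _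
    have hN := h m k (by
      have := (Nat.le_div_iff_mul_le hc).1 hm1
      linarith)
    have hk2 : k < 2 ^ (c + 3 * m + 3) := calc
      k < c * 8 ^ (m + 1) := by
        have := (Nat.div_lt_iff_lt_mul hc).1 hm2
        linarith
      _ ≤ 2 ^ c * 8 ^ (m + 1) := Nat.mul_le_mul_right _ (Nat.lt_two_pow_self).le
      _ = 2 ^ (c + 3 * m + 3) := by
        rw [show (8 : ℕ) = 2 ^ 3 by norm_num, ← pow_mul, ← pow_add]
        congr 1
    have hk3 : 2 ≤ k := by
      have h8 : 8 ^ 1 ≤ 8 ^ (c + 7) := Nat.pow_le_pow_right (by norm_num) (by omega)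
      have : k / c ≤ k := Nat.div_le_self k c
      omega
    have hlogk : Real.logb 2 k ≤ c + 3 * m + 3 := by
      rw [Real.logb_le_iff_le_rpow (by norm_num) (by exact_mod_cast (by omega : 0 < k))]
      exact_mod_cast hk2.le
    have hlogk1 : 1 ≤ Real.logb 2 k := by
      rw [Real.le_logb_iff_rpow_le (by norm_num) (by exact_mod_cast (by omega : 0 < k))]
      simpa using (by exact_mod_cast hk3 : (2 : ℝ) ≤ k)
    have hNpos : 0 < wordCount X k := by
      rcases Nat.eq_zero_or_pos (wordCount X k) with h0 | h0
      · rw [h0] at hN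
        have : 0 < 2 ^ 2 ^ m := by positivity
        omega
      · exact h0
    have hNpos' : (0 : ℝ) < wordCount X k := by exact_mod_cast hNpos
    have hlogN : (2 : ℝ) ^ ((m : ℝ) - 1) ≤ Real.logb 2 (wordCount X k) := by
      have h1 : ((2 : ℝ) ^ (2 ^ m : ℕ)) ≤ (wordCount X k : ℝ) ^ 2 := by exact_mod_cast hN
      have h2 := Real.logb_le_logb_of_le (by norm_num : (1 : ℝ) < 2) (by positivity) h1
      rw [Real.logb_pow, Real.logb_pow, Real.logb_self_eq_one (by norm_num)] at h2
      push_cast at h2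
      rw [Real.rpow_sub_one (by norm_num), Real.rpow_natCast]
      linarith
    have hlogNpos : 0 < Real.logb 2 (wordCount X k) :=
      lt_of_lt_of_le (by positivity) hlogN
    have hlow : (m : ℝ) - 1 ≤ Real.logb 2 (Real.logb 2 (wordCount X k)) := by
      rwa [Real.le_logb_iff_rpow_le (by norm_num) hlogNpos]
    have hmc' : (c : ℝ) + 7 ≤ m := by exact_mod_cast hmc
    refine ⟨?_, ?_⟩
    · rw [le_div_iff₀ (by linarith)]
      linarith
    · have hB : 0 < Fintype.card B := by
        rcases Nat.eq_zero_or_pos (Fintype.card B) with h0 | h0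
        · have := wordCount_le_pow X k
          rw [h0, zero_pow (by omega)] at this
          omega
        · exact h0
      have hB' : (0 : ℝ) < Fintype.card B := by exact_mod_cast hB
      have h5 : Real.logb 2 (Fintype.card B) ≤ Fintype.card B := by
        rw [Real.logb_le_iff_le_rpow (by norm_num) hB', Real.rpow_natCast]
        exact_mod_cast (Nat.lt_two_pow_self).le
      have h1 : Real.logb 2 (wordCount X k) ≤ k * Fintype.card B := by
        have h2 : (wordCount X k : ℝ) ≤ (Fintype.card B : ℝ) ^ k := by
          exact_mod_cast wordCount_le_pow X k
        have h3 := Real.logb_le_logb_of_le (by norm_num : (1 : ℝ) < 2) hNpos' h2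
        rw [Real.logb_pow] at h3
        exact h3.trans (mul_le_mul_of_nonneg_left h5 (by positivity))
      have hkpos : (0 : ℝ) < k := by exact_mod_cast (by omega : 0 < k)
      have h4 := Real.logb_le_logb_of_le (by norm_num : (1 : ℝ) < 2) hlogNpos h1
      rw [Real.logb_mul hkpos.ne' hB'.ne'] at h4
      rw [div_le_iff₀ (by linarith)]
      nlinarith
  refine Filter.le_liminf_of_le ?_ (hev.mono fun k hk => hk.1)
  exact Filter.IsBoundedUnder.isCoboundedUnder_ge ⟨_, (hev.mono fun k hk => hk.2)⟩

end EntropyDimension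

/-- **Theorem.** For every finite alphabet `A` with `|A| ≥ 2` there exists a finite set
`F ⊆ Aut(A^ℤ)` such that every subshift `X ⊆ B^ℤ` whose automorphism group contains a copy
of `⟨F⟩` (i.e. admits an injective group homomorphism from `⟨F⟩` into `Aut(X)`) has lower
entropy dimension at least `1/4`. -/
theorem lower_entropy_dim_ge_quarter (A : Type) [TopologicalSpace A] [DiscreteTopology A]
    [Fintype A] (hA : 2 ≤ Fintype.card A) :
    ∃ F : Finset (Equiv.Perm (ℤ → A)), ↑F ⊆ FullShiftAut A ∧
      ∀ (B : Type) [TopologicalSpace B] [DiscreteTopology B] [Fintype B]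
        (X : Set (ℤ → B)), IsSubshift X →
        ∀ φ : ↥(Subgroup.closure (F : Set (Equiv.Perm (ℤ → A)))) →* Equiv.Perm X,
          Function.Injective φ → (∀ h, φ h ∈ SubshiftAut X) →
          (1 : ℝ) / 4 ≤ lowerEntropyDim X := by
  obtain ⟨a, b, hab⟩ := Fintype.one_lt_card_iff.1 hA
  let gen : {s : Fin 3 × Fin 3 // s.1 ≠ s.2} × Fin 5 → Equiv.Perm (ℤ → A) :=
    fun s => elemPerm hab s.1.2 (genOp s.2)
  have hfin : (Set.range gen).Finite := Set.finite_range gen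
  refine ⟨hfin.toFinset, ?_, ?_⟩
  · rw [Set.Finite.coe_toFinset]
    rintro _ ⟨s, rfl⟩
    exact elemPerm_mem_fullShiftAut hab s.1.2 (isLocal_genOp s.2) (isEquivariant_genOp s.2)
  · intro B _ _ _ X hX φ hφ haut
    have hmem : ∀ s, gen s ∈ Subgroup.closure (hfin.toFinset : Set (Equiv.Perm (ℤ → A))) :=
      fun s => Subgroup.subset_closure (by simp)
    choose r hr using fun s => exists_hasRadius hX (haut ⟨gen s, hmem s⟩)
    have hgen : ∀ g, OpRadius hab φ (genOp g) (∑ s, r s) := fun g i j hij =>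
      ⟨hmem (⟨(i, j), hij⟩, g), (hr (⟨(i, j), hij⟩, g)).mono
        (Finset.single_le_sum (fun _ _ => Nat.zero_le _) (Finset.mem_univ _))⟩
    refine quarter_le_lowerEntropyDim (c := 84 * (∑ s, r s) + 1) (Nat.succ_pos _) fun m k hk =>
      two_pow_le_wordCount_sq hab hX φ hφ haut hgen m k (le_trans ?_ hk)
    have : 1 ≤ 8 ^ m := Nat.one_le_pow _ _ (by norm_num)
    calc 84 * 8 ^ m * (∑ s, r s) + 1 ≤ 84 * 8 ^ m * (∑ s, r s) + 8 ^ m := by omega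
      _ = (84 * (∑ s, r s) + 1) * 8 ^ m := by ring
end
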